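/- arXiv:2511.10584 — 3 statements merged into one kernel-verified Lean document; each statement's English description precedes it below -/
import Mathlib

section
/- Let Ĝ : ℍ^q → ℍ^k and 𝒵𝒢̂ : ℍ^q → ℍ^n be ℝ-linear maps on Hermitian matrices that send positive semidefinite matrices to positive semidefinite matrices and positive definite matrices to positive definite matrices, let S be an n×k complex matrix with S†S = I_k, and let α ∈ [1/2, 1). Define Ψ̂_α(ρ) := Tr[(Ĝ(ρ)^{1/2} S† 𝒵𝒢̂(ρ)^{(1−α)/α} S Ĝ(ρ)^{1/2})^α] on positive definite ρ ∈ ℍ^q. Then the function f(u, ρ) := −log(Ψ̂_α(ρ) − u) − log det(ρ), defined on the open convex set D := {(u,ρ) ∈ ℝ × ℍ^q : ρ ≻ 0, u < Ψ̂_α(ρ)}, is a (1+q)-self-concordant barrier for the closure of D. -/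
open Matrix
open scoped ComplexOrder

noncomputable section

/-- The real vector space of `d × d` complex Hermitian (self-adjoint) matrices. -/
abbrev Herm (d : ℕ) := selfAdjoint (Matrix (Fin d) (Fin d) ℂ)

/-- The real power of a matrix, taken via the continuous functional calculus applied to
`x ↦ x ^ p` (real `rpow`). -/
def mpow {n : ℕ} (A : Matrix (Fin n) (Fin n) ℂ) (p : ℝ) : Matrix (Fin n) (Fin n) ℂ :=
  cfc (fun x : ℝ => x ^ p) A

/-- `Ψ_{α,S}(G, Z) := Tr[(G^{1/2} Sᴴ Z^{(1−α)/α} S G^{1/2})^α]` (real-valued). -/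
def PsiS {n k : ℕ} (α : ℝ) (S : Matrix (Fin n) (Fin k) ℂ)
    (G : Matrix (Fin k) (Fin k) ℂ) (Z : Matrix (Fin n) (Fin n) ℂ) : ℝ :=
  ((mpow (mpow G (1 / 2) * Sᴴ * mpow Z ((1 - α) / α) * S * mpow G (1 / 2)) α).trace).re

/-- A `C³` function `f` on an open convex set `D` of a finite-dimensional real vector space
is a `ν`-self-concordant barrier for `cl D` if: (i) `f` is convex on `D`; (ii) `f(x) → +∞`
as `x` approaches any boundary point of `D`; (iii) `|D³f(x)[h,h,h]| ≤ 2 (D²f(x)[h,h])^{3/2}`;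
(iv) `(Df(x)[h])² ≤ ν · D²f(x)[h,h]`, for all `x ∈ D` and all directions `h`, where the
derivatives are taken along the line `t ↦ x + t h`. -/
def IsSelfConcordantBarrier {V : Type*} [AddCommGroup V] [Module ℝ V] [TopologicalSpace V]
    (ν : ℝ) (D : Set V) (f : V → ℝ) : Prop :=
  ConvexOn ℝ D f ∧
  (∀ x ∈ frontier D, Filter.Tendsto f (nhdsWithin x D) Filter.atTop) ∧
  (∀ x ∈ D, ∀ h : V,
    |iteratedDeriv 3 (fun t : ℝ => f (x + t • h)) 0|
      ≤ 2 * (iteratedDeriv 2 (fun t : ℝ => f (x + t • h)) 0) ^ (3 / 2 : ℝ)) ∧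
  (∀ x ∈ D, ∀ h : V,
    (deriv (fun t : ℝ => f (x + t • h)) 0) ^ 2
      ≤ ν * iteratedDeriv 2 (fun t : ℝ => f (x + t • h)) 0)

section

open MeasureTheory Set Filter Topology

/-- `μ` is a finite measure on `[0, 1)` representing the power function `y ↦ y ^ p` as an average
of the functions `y ↦ y / ((1 - x) + x y)`. -/
structure RepresentsRpow (p : ℝ) (μ : Measure ℝ) : Prop where
  finite : IsFiniteMeasure μ
  ae_mem : ∀ᵐ x ∂μ, x ∈ Ico (0 : ℝ) 1
  integral_eq : ∀ y : ℝ, 0 < y → ∫ x, y / ((1 - x) + x * y) ∂μ = y ^ p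

lemma exists_representsRpow_of_mem_Ioo {p : ℝ} (hp : p ∈ Ioo (0 : ℝ) 1) :
    ∃ μ : Measure ℝ, RepresentsRpow p μ := by
  obtain ⟨ν, hν⟩ := Real.exists_measure_rpow_eq_integral_rpowIntegrand₀₁ hp
  set d : ℝ → ℝ := fun t => Real.rpowIntegrand₀₁ p t 1 with hd
  have hint : Integrable d (ν.restrict (Ioi 0)) := (hν 1 (by simp)).1
  have hdpos : ∀ᵐ t ∂(ν.restrict (Ioi 0)), 0 ≤ d t := by
    filter_upwards [ae_restrict_mem measurableSet_Ioi] with t ht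
    exact Real.rpowIntegrand₀₁_nonneg hp.1 (le_of_lt ht) zero_le_one
  set κ := (ν.restrict (Ioi 0)).withDensity (fun t => ENNReal.ofReal (d t)) with hκ
  have hfin : IsFiniteMeasure κ := isFiniteMeasure_withDensity_ofReal hint.2
  have hmeas : Measurable (fun t : ℝ => 1 / (1 + t)) := by fun_prop
  refine ⟨κ.map (fun t : ℝ => 1 / (1 + t)), ⟨inferInstance, ?_, ?_⟩⟩
  · refine (ae_map_iff hmeas.aemeasurable (p := fun x => x ∈ Ico (0 : ℝ) 1) measurableSet_Ico).2 ?_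
    have : ∀ᵐ t ∂(ν.restrict (Ioi 0)), 1 / (1 + t) ∈ Ico (0 : ℝ) 1 := by
      filter_upwards [ae_restrict_mem measurableSet_Ioi] with t ht
      have ht : 0 < t := ht
      refine ⟨by positivity, ?_⟩
      rw [div_lt_one (by positivity)]; linarith
    exact (withDensity_absolutelyContinuous _ _).ae_le this
  · intro y hy
    rw [integral_map hmeas.aemeasurable]
    swap
    · apply Measurable.aestronglyMeasurable
      fun_prop
    rw [hκ, integral_withDensity_eq_integral_toReal_smul₀ hint.aemeasurable.ennreal_ofReal
      (by simp), (hν y hy.le).2]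
    apply integral_congr_ae
    filter_upwards [ae_restrict_mem measurableSet_Ioi, hdpos] with t ht h0
    have ht : 0 < t := ht
    rw [ENNReal.toReal_ofReal h0, hd]
    simp only
    rw [Real.rpowIntegrand₀₁_eq_pow_div hp ht.le zero_le_one,
      Real.rpowIntegrand₀₁_eq_pow_div hp ht.le hy.le]
    have h1 : 1 - 1 / (1 + t) + 1 / (1 + t) * y = (t + y) / (1 + t) := by field_simp; ring
    rw [h1, smul_eq_mul]
    field_simp
    ring

lemma exists_representsRpow {p : ℝ} (hp : p ∈ Ioc (0 : ℝ) 1) :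
    ∃ μ : Measure ℝ, RepresentsRpow p μ := by
  rcases hp.2.eq_or_lt with rfl | h
  · refine ⟨Measure.dirac 0, ⟨inferInstance, ?_, ?_⟩⟩
    · refine (ae_dirac_iff (p := fun x => x ∈ Ico (0 : ℝ) 1) measurableSet_Ico).2 ?_
      simp
    · intro y hy; simp
  · exact exists_representsRpow_of_mem_Ioo ⟨hp.1, h⟩

/-- Differentiability of a parametric integral with respect to a finite measure, for a locally
uniformly bounded holomorphic integrand. -/
lemma differentiableOn_integral_of_bounded {μ : Measure ℝ} [IsFiniteMeasure μ] {U : Set ℂ}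
    (hU : IsOpen U) {f : ℂ → ℝ → ℂ}
    (hmeas : ∀ w ∈ U, AEStronglyMeasurable (f w) μ)
    (hdiff : ∀ᵐ x ∂μ, DifferentiableOn ℂ (fun w => f w x) U)
    (hbound : ∀ w ∈ U, ∃ r > 0, Metric.closedBall w r ⊆ U ∧
      ∃ C, ∀ᵐ x ∂μ, ∀ z ∈ Metric.closedBall w r, ‖f z x‖ ≤ C) :
    DifferentiableOn ℂ (fun w => ∫ x, f w x ∂μ) U := by
  intro w hw
  apply DifferentiableAt.differentiableWithinAt
  obtain ⟨r, hr, hsub, C, hC⟩ := hbound w hw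
  have hball : Metric.ball w (r / 2) ∈ 𝓝 w := Metric.ball_mem_nhds _ (by positivity)
  have hUw : U ∈ 𝓝 w := hU.mem_nhds hw
  refine (hasDerivAt_integral_of_dominated_loc_of_deriv_le (F := f)
    (F' := fun z x => deriv (fun y => f y x) z) (bound := fun _ => C / (r / 2)) hball
    ?_ ?_ ?_ ?_ (integrable_const _) ?_).2.differentiableAt
  · filter_upwards [hUw] with z hz using hmeas z hz
  · refine Integrable.of_bound (hmeas w hw) C ?_
    filter_upwards [hC] with x hx using hx w (Metric.mem_closedBall_self hr.le)
  · -- the derivative is a limit of difference quotients along a sequence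
    obtain ⟨u, hu⟩ : ∃ u : ℕ → ℂ, (∀ n, w + u n ∈ U ∧ u n ≠ 0) ∧ Tendsto u atTop (𝓝 0) := by
      refine ⟨fun n => ((r / (n + 1) : ℝ) : ℂ), fun n => ⟨hsub ?_, ?_⟩, ?_⟩
      · rw [Metric.mem_closedBall, dist_eq_norm, add_sub_cancel_left, Complex.norm_real,
          Real.norm_of_nonneg (by positivity)]
        exact div_le_self hr.le (by linarith [n.cast_nonneg (α := ℝ)])
      · exact Complex.ofReal_ne_zero.2 (by positivity : (r / (n + 1) : ℝ) ≠ 0)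
      · have : Tendsto (fun n : ℕ => (r / (n + 1) : ℝ)) atTop (𝓝 0) :=
          tendsto_const_div_atTop_nhds_zero_nat r |>.comp (tendsto_add_atTop_nat 1) |>.congr
            (by intro n; simp)
        exact_mod_cast (Complex.continuous_ofReal.tendsto 0).comp this
    refine aestronglyMeasurable_of_tendsto_ae atTop
      (f := fun n x => (u n)⁻¹ • (f (w + u n) x - f w x)) ?_ ?_
    · intro n
      exact ((hmeas _ (hu.1 n).1).sub (hmeas w hw)).const_smul (u n)⁻¹
    · filter_upwards [hdiff] with x hx
      have := (hx.differentiableAt hUw).hasDerivAt.tendsto_slope_zero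
      refine this.comp (tendsto_nhdsWithin_iff.2 ⟨hu.2, ?_⟩)
      exact Eventually.of_forall fun n => (hu.1 n).2
  · filter_upwards [hC, hdiff] with x hx hdx z hz
    have hz' : Metric.closedBall z (r / 2) ⊆ Metric.closedBall w r := by
      apply Metric.closedBall_subset_closedBall'
      have := Metric.mem_ball.1 hz
      linarith
    apply Complex.norm_deriv_le_of_forall_mem_sphere_norm_le (by positivity)
    · exact ((hdx.mono (hz'.trans hsub)).diffContOnCl_ball (subset_refl _))
    · intro y hy
      exact hx y (hz' (Metric.sphere_subset_closedBall hy))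
  · filter_upwards [hdiff] with x hx z hz
    have hzU : z ∈ U := hsub (Metric.ball_subset_closedBall (Metric.ball_subset_ball (by linarith) hz))
    exact (hx.differentiableAt (hU.mem_nhds hzU)).hasDerivAt

/-- A version for integrands that are jointly continuous on `U × [0, 1]`. -/
lemma differentiableOn_integral_of_continuousOn {μ : Measure ℝ} [IsFiniteMeasure μ]
    (hμ : ∀ᵐ x ∂μ, x ∈ Icc (0 : ℝ) 1) {U : Set ℂ} (hU : IsOpen U) {f : ℂ → ℝ → ℂ}
    (hcont : ContinuousOn (fun q : ℂ × ℝ => f q.1 q.2) (U ×ˢ Icc (0 : ℝ) 1))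
    (hdiff : ∀ x ∈ Icc (0 : ℝ) 1, DifferentiableOn ℂ (fun w => f w x) U) :
    DifferentiableOn ℂ (fun w => ∫ x, f w x ∂μ) U := by
  have hres : μ.restrict (Icc 0 1) = μ := Measure.restrict_eq_self_of_ae_mem hμ
  apply differentiableOn_integral_of_bounded hU
  · intro w hw
    rw [← hres]
    refine ContinuousOn.aestronglyMeasurable ?_ measurableSet_Icc
    exact hcont.comp (f := fun x : ℝ => (w, x)) (by fun_prop) (fun x hx => ⟨hw, hx⟩)
  · filter_upwards [hμ] with x hx using hdiff x hx
  · intro w hw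
    obtain ⟨r, hr, hsub⟩ := Metric.nhds_basis_closedBall.mem_iff.1 (hU.mem_nhds hw)
    refine ⟨r, hr, hsub, ?_⟩
    obtain ⟨C, hC⟩ := ((isCompact_closedBall w r).prod (isCompact_Icc (a := (0 : ℝ)) (b := 1))).exists_bound_of_continuousOn
      (hcont.mono (prod_mono hsub subset_rfl))
    refine ⟨C, ?_⟩
    filter_upwards [hμ] with x hx z hz using hC (z, x) ⟨hz, hx⟩

lemma slitPlane_den_ne_zero {y : ℂ} (hy : y ∈ Complex.slitPlane) {x : ℝ} (hx : x ∈ Icc (0 : ℝ) 1) :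
    (1 - x : ℂ) + x * y ≠ 0 := by
  intro h
  rcases Complex.mem_slitPlane_iff.1 hy with h1 | h1
  · have := congrArg Complex.re h
    simp at this
    rcases hx.1.eq_or_lt with h0 | h0
    · rw [← h0] at this; simp at this
    · nlinarith [mul_pos h0 h1, hx.2]
  · have := congrArg Complex.im h
    simp [h1] at this
    rw [this] at h; simp at h

lemma RepresentsRpow.ae_mem_Icc {p : ℝ} {μ : Measure ℝ} (h : RepresentsRpow p μ) :
    ∀ᵐ x ∂μ, x ∈ Icc (0 : ℝ) 1 := h.ae_mem.mono fun _ hx => ⟨hx.1, hx.2.le⟩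

lemma RepresentsRpow.integral_eq_cpow {p : ℝ} {μ : Measure ℝ} (h : RepresentsRpow p μ)
    {y : ℂ} (hy : y ∈ Complex.slitPlane) :
    ∫ x : ℝ, y / ((1 - x : ℂ) + x * y) ∂μ = y ^ (p : ℂ) := by
  have := h.finite
  have hU : IsOpen Complex.slitPlane := Complex.isOpen_slitPlane
  have h1 : DifferentiableOn ℂ (fun y : ℂ => ∫ x : ℝ, y / ((1 - x : ℂ) + x * y) ∂μ)
      Complex.slitPlane := by
    apply differentiableOn_integral_of_continuousOn h.ae_mem_Icc hU
    · apply ContinuousOn.div (by fun_prop) (by fun_prop)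
      rintro ⟨y, x⟩ ⟨hy, hx⟩
      exact slitPlane_den_ne_zero hy hx
    · intro x hx
      apply DifferentiableOn.div (by fun_prop) (by fun_prop)
      intro y hy
      exact slitPlane_den_ne_zero hy hx
  have h2 : DifferentiableOn ℂ (fun y : ℂ => y ^ (p : ℂ)) Complex.slitPlane := by
    intro y hy
    exact (DifferentiableAt.cpow_const differentiableAt_id hy).differentiableWithinAt
  have hconn : IsPreconnected Complex.slitPlane :=
    (Complex.starConvex_one_slitPlane.isPathConnected (by simp)).isConnected.isPreconnected
  refine AnalyticOnNhd.eqOn_of_preconnected_of_frequently_eq (h1.analyticOnNhd hU)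
    (h2.analyticOnNhd hU) hconn (z₀ := 1) (by simp) ?_ hy
  have ht : Tendsto (fun t : ℝ => (t : ℂ)) (𝓝[≠] 1) (𝓝[≠] 1) := by
    refine tendsto_nhdsWithin_iff.2 ⟨?_, ?_⟩
    · exact (Complex.continuous_ofReal.tendsto' 1 1 (by simp)).mono_left nhdsWithin_le_nhds
    · filter_upwards [self_mem_nhdsWithin] with t ht
      simpa using ht
  refine ht.frequently (Eventually.frequently ?_)
  filter_upwards [nhdsWithin_le_nhds (lt_mem_nhds zero_lt_one)] with t ht
  rw [← Complex.ofReal_cpow ht.le, ← h.integral_eq t ht, ← integral_complex_ofReal]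
  simp

section

variable {n m : Type*} [Fintype n] [DecidableEq n] [Fintype m] [DecidableEq m]

/-- All eigenvalues of `M` lie off the closed negative real axis. -/
def SlitSpectrum (M : Matrix n n ℂ) : Prop :=
  ∀ v : n → ℂ, v ≠ 0 → ∀ y : ℂ, M *ᵥ v = y • v → y ∈ Complex.slitPlane

/-- The rational matrix functions `M ↦ M ((1 - x) + x M)⁻¹` whose averages are the powers. -/
def rpowKernel (M : Matrix n n ℂ) (x : ℝ) : Matrix n n ℂ :=
  M * ((1 - x : ℂ) • 1 + (x : ℂ) • M)⁻¹

/-- The entrywise integral of the kernels `rpowKernel M x`. -/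
def rpowIntegral (μ : Measure ℝ) (M : Matrix n n ℂ) : Matrix n n ℂ :=
  Matrix.of fun i j => ∫ x, rpowKernel M x i j ∂μ

lemma SlitSpectrum.det_ne_zero {M : Matrix n n ℂ} (hM : SlitSpectrum M) {x : ℝ}
    (hx : x ∈ Icc (0 : ℝ) 1) : ((1 - x : ℂ) • (1 : Matrix n n ℂ) + (x : ℂ) • M).det ≠ 0 := by
  intro h
  obtain ⟨v, hv, hv0⟩ := Matrix.exists_mulVec_eq_zero_iff.2 h
  rw [Matrix.add_mulVec, Matrix.smul_mulVec, Matrix.smul_mulVec, Matrix.one_mulVec] at hv0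
  rcases hx.1.eq_or_lt with h0 | h0
  · rw [← h0] at hv0
    simp at hv0
    exact hv hv0
  · have hx0 : (x : ℂ) ≠ 0 := by exact_mod_cast h0.ne'
    have h1 : M *ᵥ v = (-(1 - x : ℂ) / x) • v := by
      have h2 : (x : ℂ) • (M *ᵥ v) = (-(1 - x : ℂ)) • v := by
        rw [neg_smul]; exact eq_neg_of_add_eq_zero_right hv0
      rw [div_eq_inv_mul, mul_smul, ← h2, smul_smul, inv_mul_cancel₀ hx0, one_smul]
    have h3 := slitPlane_den_ne_zero (hM v hv _ h1) hx
    apply h3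
    field_simp
    ring

/-- Entrywise holomorphy of a matrix-valued function. -/
def MatDiffOn (M : ℂ → Matrix m n ℂ) (U : Set ℂ) : Prop :=
  ∀ i j, DifferentiableOn ℂ (fun w => M w i j) U

lemma MatDiffOn.mul {a b c : Type*} [Fintype b] {U : Set ℂ} {M : ℂ → Matrix a b ℂ}
    {N : ℂ → Matrix b c ℂ}
    (hM : MatDiffOn M U) (hN : MatDiffOn N U) : MatDiffOn (fun w => M w * N w) U := by
  intro i j
  simp only [Matrix.mul_apply]
  exact DifferentiableOn.fun_sum fun k _ => (hM i k).mul (hN k j)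

lemma MatDiffOn.const {U : Set ℂ} (A : Matrix m n ℂ) : MatDiffOn (fun _ => A) U :=
  fun _ _ => differentiableOn_const _

lemma MatDiffOn.smul {U : Set ℂ} {M : ℂ → Matrix m n ℂ} {c : ℂ → ℂ}
    (hc : DifferentiableOn ℂ c U) (hM : MatDiffOn M U) : MatDiffOn (fun w => c w • M w) U :=
  fun i j => hc.mul (hM i j)

lemma MatDiffOn.add {U : Set ℂ} {M N : ℂ → Matrix m n ℂ}
    (hM : MatDiffOn M U) (hN : MatDiffOn N U) : MatDiffOn (fun w => M w + N w) U :=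
  fun i j => (hM i j).add (hN i j)

lemma MatDiffOn.det {U : Set ℂ} {M : ℂ → Matrix n n ℂ} (hM : MatDiffOn M U) :
    DifferentiableOn ℂ (fun w => (M w).det) U := by
  simp only [Matrix.det_apply']
  exact DifferentiableOn.fun_sum fun σ _ => (differentiableOn_const _).mul
    (DifferentiableOn.fun_finsetProd fun i _ => hM _ _)

lemma MatDiffOn.adjugate {U : Set ℂ} {M : ℂ → Matrix n n ℂ} (hM : MatDiffOn M U) :
    MatDiffOn (fun w => (M w).adjugate) U := by
  intro i j
  simp only [Matrix.adjugate_apply]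
  apply MatDiffOn.det
  intro a b
  by_cases h : a = j
  · subst h; simp
  · simpa [Matrix.updateRow_ne h] using hM a b

lemma MatDiffOn.inv {U : Set ℂ} {M : ℂ → Matrix n n ℂ} (hM : MatDiffOn M U)
    (h0 : ∀ w ∈ U, (M w).det ≠ 0) : MatDiffOn (fun w => (M w)⁻¹) U := by
  simp only [Matrix.inv_def, Ring.inverse_eq_inv]
  exact MatDiffOn.smul (hM.det.inv h0) hM.adjugate

lemma MatDiffOn.continuousOn {U : Set ℂ} {M : ℂ → Matrix m n ℂ} (hM : MatDiffOn M U) :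
    ContinuousOn M U :=
  continuousOn_pi.2 fun i => continuousOn_pi.2 fun j => (hM i j).continuousOn

lemma continuousOn_matrix_inv {X : Type*} [TopologicalSpace X] {s : Set X}
    {M : X → Matrix n n ℂ} (hM : ContinuousOn M s) (h0 : ∀ x ∈ s, (M x).det ≠ 0) :
    ContinuousOn (fun x => (M x)⁻¹) s := by
  intro x hx
  have h1 : ContinuousAt (fun A : Matrix n n ℂ => A⁻¹) (M x) := by
    apply continuousAt_matrix_inv
    simp only [Ring.inverse_eq_inv']
    exact continuousAt_inv₀ (h0 x hx)
  exact h1.comp_continuousWithinAt (hM x hx)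

lemma continuousOn_rpowKernel {X : Type*} [TopologicalSpace X] {s : Set X}
    {M : X → Matrix n n ℂ} {x : X → ℝ} (hM : ContinuousOn M s) (hx : ContinuousOn x s)
    (hs : ∀ z ∈ s, SlitSpectrum (M z)) (hx01 : ∀ z ∈ s, x z ∈ Icc (0 : ℝ) 1) :
    ContinuousOn (fun z => rpowKernel (M z) (x z)) s := by
  have hxc : ContinuousOn (fun z => (x z : ℂ)) s := Complex.continuous_ofReal.comp_continuousOn hx
  have h1 : ContinuousOn
      (fun z => ((1 - x z : ℂ) • (1 : Matrix n n ℂ) + (x z : ℂ) • M z)⁻¹) s := by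
    apply continuousOn_matrix_inv
    · exact ((continuousOn_const.sub hxc).smul continuousOn_const).add (hxc.smul hM)
    · exact fun z hz => (hs z hz).det_ne_zero (hx01 z hz)
  exact ContinuousOn.mul hM h1

lemma MatDiffOn.rpowKernel {U : Set ℂ} {M : ℂ → Matrix n n ℂ} (hM : MatDiffOn M U)
    (hs : ∀ w ∈ U, SlitSpectrum (M w)) {x : ℝ} (hx : x ∈ Icc (0 : ℝ) 1) :
    MatDiffOn (fun w => rpowKernel (M w) x) U := by
  refine MatDiffOn.mul hM (MatDiffOn.inv ?_ fun w hw => (hs w hw).det_ne_zero hx)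
  exact (MatDiffOn.const _).add (MatDiffOn.smul (differentiableOn_const _) hM)

lemma MatDiffOn.rpowIntegral {μ : Measure ℝ} [IsFiniteMeasure μ]
    (hμ : ∀ᵐ x ∂μ, x ∈ Icc (0 : ℝ) 1) {U : Set ℂ} (hU : IsOpen U) {M : ℂ → Matrix n n ℂ}
    (hM : MatDiffOn M U) (hs : ∀ w ∈ U, SlitSpectrum (M w)) :
    MatDiffOn (fun w => rpowIntegral μ (M w)) U := by
  intro i j
  apply differentiableOn_integral_of_continuousOn hμ hU
  · have h := continuousOn_rpowKernel (s := U ×ˢ Icc (0 : ℝ) 1) (M := fun q : ℂ × ℝ => M q.1)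
      (x := fun q => q.2) (hM.continuousOn.comp continuousOn_fst fun q hq => hq.1)
      continuousOn_snd (fun q hq => hs _ hq.1) (fun q hq => hq.2)
    exact continuousOn_pi.1 (continuousOn_pi.1 h i) j
  · exact fun x hx => hM.rpowKernel hs hx i j

lemma SlitSpectrum.integrable_rpowKernel {μ : Measure ℝ} [IsFiniteMeasure μ]
    (hμ : ∀ᵐ x ∂μ, x ∈ Icc (0 : ℝ) 1) {M : Matrix n n ℂ} (hM : SlitSpectrum M) (i j : n) :
    Integrable (fun x => rpowKernel M x i j) μ := by
  have h := continuousOn_rpowKernel (s := Icc (0 : ℝ) 1) (M := fun _ => M) (x := fun x => x)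
    continuousOn_const continuousOn_id (fun _ _ => hM) (fun _ hx => hx)
  have h1 : ContinuousOn (fun x => rpowKernel M x i j) (Icc (0 : ℝ) 1) :=
    continuousOn_pi.1 (continuousOn_pi.1 h i) j
  rw [← Measure.restrict_eq_self_of_ae_mem hμ]
  exact h1.integrableOn_compact isCompact_Icc

lemma SlitSpectrum.map_rpowIntegral {μ : Measure ℝ} [IsFiniteMeasure μ]
    (hμ : ∀ᵐ x ∂μ, x ∈ Icc (0 : ℝ) 1) {M : Matrix n n ℂ} (hM : SlitSpectrum M)
    (L : Matrix n n ℂ →ₗ[ℂ] ℂ) :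
    Integrable (fun x => L (rpowKernel M x)) μ ∧
      L (rpowIntegral μ M) = ∫ x, L (rpowKernel M x) ∂μ := by
  have hL : ∀ A : Matrix n n ℂ, L A = ∑ i, ∑ j, A i j * L (Matrix.single i j 1) := by
    intro A
    conv_lhs => rw [Matrix.matrix_eq_sum_single A]
    simp only [map_sum]
    refine Finset.sum_congr rfl fun i _ => Finset.sum_congr rfl fun j _ => ?_
    rw [← smul_eq_mul, ← map_smul, Matrix.smul_single, smul_eq_mul, mul_one]
  have hi : ∀ i j, Integrable (fun x => rpowKernel M x i j * L (Matrix.single i j 1)) μ :=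
    fun i j => (hM.integrable_rpowKernel hμ i j).mul_const _
  constructor
  · simp only [hL (rpowKernel M _)]
    exact integrable_finsetSum _ fun i _ => integrable_finsetSum _ fun j _ => hi i j
  · simp only [hL (rpowKernel M _)]
    rw [hL, integral_finsetSum _ fun i _ => integrable_finsetSum _ fun j _ => hi i j]
    refine Finset.sum_congr rfl fun i _ => ?_
    rw [integral_finsetSum _ fun j _ => hi i j]
    refine Finset.sum_congr rfl fun j _ => ?_
    rw [integral_mul_const]
    rfl

lemma Matrix.exists_mulVec_eq_smul_of_mem_roots {M : Matrix n n ℂ} {y : ℂ}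
    (hy : y ∈ M.charpoly.roots) : ∃ v : n → ℂ, v ≠ 0 ∧ M *ᵥ v = y • v := by
  have h1 : (Matrix.scalar n y - M).det = 0 := by
    rw [← Matrix.eval_charpoly]
    exact (Polynomial.mem_roots'.1 hy).2
  obtain ⟨v, hv, hv0⟩ := Matrix.exists_mulVec_eq_zero_iff.2 h1
  refine ⟨v, hv, ?_⟩
  rw [Matrix.sub_mulVec, sub_eq_zero] at hv0
  rw [← hv0]
  ext i
  simp [Matrix.scalar_apply, Matrix.mulVec_diagonal]

lemma SlitSpectrum.mem_of_mem_roots {M : Matrix n n ℂ} (hM : SlitSpectrum M) {y : ℂ}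
    (hy : y ∈ M.charpoly.roots) : y ∈ Complex.slitPlane := by
  obtain ⟨v, hv, hvy⟩ := Matrix.exists_mulVec_eq_smul_of_mem_roots hy
  exact hM v hv y hvy

lemma Matrix.det_smul_one_add_smul (M : Matrix n n ℂ) (a b : ℂ) :
    (a • (1 : Matrix n n ℂ) + b • M).det = (M.charpoly.roots.map fun y => a + b * y).prod := by
  have hsp := IsAlgClosed.splits M.charpoly
  have hcard : M.charpoly.roots.card = Fintype.card n := by
    rw [← hsp.natDegree_eq_card_roots, Matrix.charpoly_natDegree_eq_dim]
  rcases eq_or_ne b 0 with rfl | hb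
  · simp [hcard]
  · have h1 : a • (1 : Matrix n n ℂ) + b • M = (-b) • (Matrix.scalar n (-a / b) - M) := by
      ext i j
      by_cases hij : i = j
      · subst hij; simp; field_simp; ring
      · simp [hij]
    rw [h1, Matrix.det_smul, ← Matrix.eval_charpoly,
      hsp.eval_eq_prod_roots_of_monic M.charpoly_monic, ← hcard, ← Multiset.card_map
        (fun y => -a / b - y), ← Multiset.prod_replicate, ← Multiset.map_const',
        ]
    rw [Multiset.map_map, ← Multiset.prod_map_mul]
    congr 1
    refine Multiset.map_congr rfl fun y _ => ?_
    simp
    field_simp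
    ring

lemma hasDerivAt_multiset_prod_linear (s : Multiset ℂ) (a b : ℂ)
    (h : ∀ y ∈ s, a + b * y ≠ 0) :
    HasDerivAt (fun z : ℂ => (s.map fun y => a + (b + z) * y).prod)
      ((s.map fun y => a + b * y).prod * (s.map fun y => y / (a + b * y)).sum) 0 := by
  induction s using Multiset.induction_on with
  | empty => simpa using hasDerivAt_const (0 : ℂ) (1 : ℂ)
  | cons y s ih =>
    have h1 := ih fun z hz => h z (Multiset.mem_cons_of_mem hz)
    have hy := h y (Multiset.mem_cons_self y s)
    have h2 : HasDerivAt (fun z : ℂ => a + (b + z) * y) y 0 := by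
      have := (((hasDerivAt_id (0 : ℂ)).const_add b).mul_const y).const_add a
      simpa using this
    simp only [Multiset.map_cons, Multiset.prod_cons, Multiset.sum_cons]
    convert! h2.mul h1 using 1
    simp only [add_zero]
    field_simp

lemma hasDerivAt_det_one_add_smul (M : Matrix n n ℂ) :
    HasDerivAt (fun z : ℂ => (1 + z • M).det) M.trace 0 := by
  have h := (Matrix.det (1 + (Polynomial.X : Polynomial ℂ) • M.map Polynomial.C)).hasDerivAt 0
  rw [Matrix.derivative_det_one_add_X_smul] at h
  convert! h using 2 with z
  rw [← Polynomial.coe_evalRingHom, RingHom.map_det]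
  congr 1
  ext i j
  by_cases hij : i = j
  · subst hij; simp; exact mul_comm _ _
  · simp [hij]; exact mul_comm _ _

lemma SlitSpectrum.trace_rpowKernel {M : Matrix n n ℂ} (hM : SlitSpectrum M) {x : ℝ}
    (hx : x ∈ Icc (0 : ℝ) 1) :
    (rpowKernel M x).trace = (M.charpoly.roots.map fun y => y / ((1 - x : ℂ) + x * y)).sum := by
  set A : Matrix n n ℂ := (1 - x : ℂ) • 1 + (x : ℂ) • M with hA
  have hdet : A.det ≠ 0 := hM.det_ne_zero hx
  have hu : IsUnit A.det := isUnit_iff_ne_zero.2 hdet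
  have h1 := (hasDerivAt_det_one_add_smul (A⁻¹ * M)).const_mul A.det
  have h2 := hasDerivAt_multiset_prod_linear M.charpoly.roots (1 - x) x
    fun y hy => slitPlane_den_ne_zero (hM.mem_of_mem_roots hy) hx
  have h3 : (fun z : ℂ => A.det * (1 + z • (A⁻¹ * M)).det)
      = fun z : ℂ => (M.charpoly.roots.map fun y => (1 - x : ℂ) + (x + z) * y).prod := by
    ext z
    rw [← Matrix.det_smul_one_add_smul, ← Matrix.det_mul, mul_add, mul_one, Matrix.mul_smul,
      ← Matrix.mul_assoc, Matrix.mul_nonsing_inv A hu, one_mul, hA, add_smul, add_assoc]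
  rw [h3] at h1
  have h4 := h1.unique h2
  rw [← Matrix.det_smul_one_add_smul, ← hA] at h4
  rw [rpowKernel, Matrix.trace_mul_comm]
  exact mul_left_cancel₀ hdet h4

lemma integral_multiset_sum {X : Type*} [MeasurableSpace X] {μ : Measure X} {ι : Type*}
    (s : Multiset ι) (f : ι → X → ℂ) (hf : ∀ i ∈ s, Integrable (f i) μ) :
    Integrable (fun x => (s.map fun i => f i x).sum) μ ∧
      ∫ x, (s.map fun i => f i x).sum ∂μ = (s.map fun i => ∫ x, f i x ∂μ).sum := by
  induction s using Multiset.induction_on with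
  | empty => simp
  | cons i s ih =>
    have h1 := ih fun j hj => hf j (Multiset.mem_cons_of_mem hj)
    have h2 := hf i (Multiset.mem_cons_self i s)
    simp only [Multiset.map_cons, Multiset.sum_cons]
    exact ⟨h2.add h1.1, by rw [integral_add h2 h1.1, h1.2]⟩

lemma RepresentsRpow.integrable {p : ℝ} {μ : Measure ℝ} (h : RepresentsRpow p μ)
    {y : ℂ} (hy : y ∈ Complex.slitPlane) :
    Integrable (fun x : ℝ => y / ((1 - x : ℂ) + x * y)) μ := by
  have := h.finite
  rw [← Measure.restrict_eq_self_of_ae_mem h.ae_mem_Icc]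
  refine ContinuousOn.integrableOn_compact isCompact_Icc ?_
  exact ContinuousOn.div (by fun_prop) (by fun_prop) fun x hx => slitPlane_den_ne_zero hy hx

lemma RepresentsRpow.trace_rpowIntegral {p : ℝ} {μ : Measure ℝ} (h : RepresentsRpow p μ)
    {M : Matrix n n ℂ} (hM : SlitSpectrum M) :
    (rpowIntegral μ M).trace = (M.charpoly.roots.map fun y => y ^ (p : ℂ)).sum := by
  have := h.finite
  have h1 := (hM.map_rpowIntegral h.ae_mem_Icc (Matrix.traceLinearMap n ℂ ℂ)).2
  simp only [Matrix.traceLinearMap_apply] at h1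
  rw [h1, integral_congr_ae (h.ae_mem_Icc.mono fun x hx => hM.trace_rpowKernel hx),
    (integral_multiset_sum M.charpoly.roots (fun (y : ℂ) (x : ℝ) => y / ((1 - x : ℂ) + x * y))
      fun y hy => h.integrable (hM.mem_of_mem_roots hy)).2]
  congr 1
  exact Multiset.map_congr rfl fun y hy => h.integral_eq_cpow (hM.mem_of_mem_roots hy)

lemma RepresentsRpow.ne_zero {p : ℝ} {μ : Measure ℝ} (h : RepresentsRpow p μ) : μ ≠ 0 := by
  rintro rfl
  simpa using h.integral_eq 1 one_pos

lemma star_dotProduct_smul_self (v : n → ℂ) :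
    ∃ r : ℝ, star v ⬝ᵥ v = r ∧ 0 ≤ r ∧ (v ≠ 0 → 0 < r) := by
  have h0 := dotProduct_star_self_nonneg v
  refine ⟨(star v ⬝ᵥ v).re, ?_, ?_, ?_⟩
  · exact Complex.ext rfl (by simpa using (Complex.le_def.1 h0).2.symm)
  · exact (Complex.le_def.1 h0).1
  · intro hv
    exact (Complex.lt_def.1 (dotProduct_star_self_pos_iff.2 hv)).1

/-- The numerical range of `M` lies in the open upper (`σ > 0`) or lower (`σ < 0`) half-plane. -/
def HalfPlaneRange (σ : ℝ) (M : Matrix n n ℂ) : Prop :=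
  ∀ v : n → ℂ, v ≠ 0 → 0 < σ * (star v ⬝ᵥ (M *ᵥ v)).im

lemma HalfPlaneRange.slitSpectrum {σ : ℝ} {M : Matrix n n ℂ} (hM : HalfPlaneRange σ M) :
    SlitSpectrum M := by
  intro v hv y hy
  have h := hM v hv
  obtain ⟨r, hr, -, hr0⟩ := star_dotProduct_smul_self v
  rw [hy, dotProduct_smul, hr, smul_eq_mul, Complex.im_mul_ofReal] at h
  rw [Complex.mem_slitPlane_iff]
  right
  intro h0
  simp [h0] at h

lemma HalfPlaneRange.rpowKernel {σ : ℝ} {M : Matrix n n ℂ} (hM : HalfPlaneRange σ M) {x : ℝ}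
    (hx : x ∈ Ico (0 : ℝ) 1) : HalfPlaneRange σ (rpowKernel M x) := by
  intro v hv
  set A : Matrix n n ℂ := (1 - x : ℂ) • 1 + (x : ℂ) • M with hA
  have hu : IsUnit A.det :=
    isUnit_iff_ne_zero.2 (hM.slitSpectrum.det_ne_zero ⟨hx.1, hx.2.le⟩)
  set u := A⁻¹ *ᵥ v with hu_def
  have hAu : A *ᵥ u = v := by
    rw [hu_def, Matrix.mulVec_mulVec, Matrix.mul_nonsing_inv A hu, Matrix.one_mulVec]
  have hu0 : u ≠ 0 := by
    intro h
    rw [h, Matrix.mulVec_zero] at hAu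
    exact hv hAu.symm
  have hker : _root_.rpowKernel M x *ᵥ v = M *ᵥ u := by
    rw [hu_def, Matrix.mulVec_mulVec]; rfl
  have hv' : v = (1 - x : ℂ) • u + (x : ℂ) • (M *ᵥ u) := by
    rw [← hAu, hA, Matrix.add_mulVec, Matrix.smul_mulVec, Matrix.smul_mulVec, Matrix.one_mulVec]
  obtain ⟨r, hr, -, -⟩ := star_dotProduct_smul_self (M *ᵥ u)
  have h1 : star v ⬝ᵥ (M *ᵥ u) = ((1 - x : ℝ) : ℂ) * (star u ⬝ᵥ (M *ᵥ u)) + ((x * r : ℝ) : ℂ) := by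
    conv_lhs => rw [hv']
    rw [star_add, star_smul, star_smul, add_dotProduct, smul_dotProduct, smul_dotProduct, hr]
    simp
  rw [hker, h1, Complex.add_im, Complex.ofReal_im, add_zero, Complex.im_ofReal_mul]
  have := hM u hu0
  have h2 : 0 < 1 - x := sub_pos.2 hx.2
  nlinarith [mul_pos h2 this]

/-- The sesquilinear form `A ↦ ⟨u, A v⟩` as a linear functional. -/
def mulVecFunctional (u : m → ℂ) (v : n → ℂ) : Matrix m n ℂ →ₗ[ℂ] ℂ where
  toFun A := u ⬝ᵥ (A *ᵥ v)
  map_add' A B := by rw [Matrix.add_mulVec, dotProduct_add]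
  map_smul' c A := by rw [Matrix.smul_mulVec, dotProduct_smul]; rfl

lemma HalfPlaneRange.rpowIntegral {σ p : ℝ} {μ : Measure ℝ} (h : RepresentsRpow p μ)
    {M : Matrix n n ℂ} (hM : HalfPlaneRange σ M) : HalfPlaneRange σ (rpowIntegral μ M) := by
  intro v hv
  have := h.finite
  obtain ⟨hi, h1⟩ := hM.slitSpectrum.map_rpowIntegral h.ae_mem_Icc (mulVecFunctional (star v) v)
  have h2 : σ * (star v ⬝ᵥ (_root_.rpowIntegral μ M *ᵥ v)).im
      = ∫ x, σ * (star v ⬝ᵥ (_root_.rpowKernel M x *ᵥ v)).im ∂μ := by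
    rw [integral_const_mul]
    congr 1
    change (mulVecFunctional (star v) v (_root_.rpowIntegral μ M)).im = _
    rw [h1]
    exact ((integral_im hi).symm :)
  rw [h2]
  have hpos : ∀ᵐ x ∂μ, 0 < σ * (star v ⬝ᵥ (_root_.rpowKernel M x *ᵥ v)).im :=
    h.ae_mem.mono fun x hx => hM.rpowKernel hx v hv
  have hnn : 0 ≤ᵐ[μ] fun x => σ * (star v ⬝ᵥ (_root_.rpowKernel M x *ᵥ v)).im :=
    hpos.mono fun x hx => hx.le
  have hi' : Integrable (fun x => σ * (star v ⬝ᵥ (_root_.rpowKernel M x *ᵥ v)).im) μ :=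
    Integrable.const_mul hi.im σ
  refine lt_of_le_of_ne (integral_nonneg_of_ae hnn) fun h0 => h.ne_zero ?_
  have h3 := (integral_eq_zero_iff_of_nonneg_ae hnn hi').1 h0.symm
  have h4 : ∀ᵐ x ∂μ, False := by
    filter_upwards [hpos, h3] with x h5 h6
    exact h5.ne' h6
  simpa using h4

lemma rpowKernel_conj (U V M : Matrix n n ℂ) (hUV : U * V = 1) (x : ℝ) :
    rpowKernel (U * M * V) x = U * rpowKernel M x * V := by
  have hVU : V * U = 1 := mul_eq_one_comm.1 hUV
  have h1 : (1 - x : ℂ) • (1 : Matrix n n ℂ) + (x : ℂ) • (U * M * V)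
      = U * ((1 - x : ℂ) • 1 + (x : ℂ) • M) * V := by
    rw [Matrix.mul_add, Matrix.add_mul, Matrix.mul_smul, Matrix.smul_mul, Matrix.mul_one, hUV,
      Matrix.mul_smul, Matrix.smul_mul]
  rw [rpowKernel, rpowKernel, h1, Matrix.mul_inv_rev, Matrix.mul_inv_rev,
    Matrix.inv_eq_right_inv hUV, Matrix.inv_eq_right_inv hVU]
  calc U * M * V * (U * (((1 - x : ℂ) • 1 + (x : ℂ) • M)⁻¹ * V))
      = U * M * (V * U) * (((1 - x : ℂ) • 1 + (x : ℂ) • M)⁻¹ * V) := by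
        simp only [Matrix.mul_assoc]
    _ = _ := by rw [hVU, Matrix.mul_one]; simp only [Matrix.mul_assoc]

lemma SlitSpectrum.rpowIntegral_conj {p : ℝ} {μ : Measure ℝ} (h : RepresentsRpow p μ)
    {M : Matrix n n ℂ} (hM : SlitSpectrum M) (U V : Matrix n n ℂ) (hUV : U * V = 1) :
    rpowIntegral μ (U * M * V) = U * rpowIntegral μ M * V := by
  have := h.finite
  ext i j
  have h1 := (hM.map_rpowIntegral h.ae_mem_Icc (mulVecFunctional (U i) (fun k => V k j))).2
  have h2 : ∀ A : Matrix n n ℂ, mulVecFunctional (U i) (fun k => V k j) A = (U * A * V) i j := by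
    intro A
    rw [Matrix.mul_assoc]
    rfl
  simp only [h2, ← rpowKernel_conj U V _ hUV] at h1
  rw [h1]
  rfl

lemma slitSpectrum_diagonal {d : n → ℂ} (hd : ∀ i, d i ∈ Complex.slitPlane) :
    SlitSpectrum (Matrix.diagonal d) := by
  intro v hv y hy
  obtain ⟨i, hi⟩ := Function.ne_iff.1 hv
  have := congrFun hy i
  rw [Matrix.mulVec_diagonal, Pi.smul_apply, smul_eq_mul] at this
  rw [← mul_right_cancel₀ hi this]
  exact hd i

lemma RepresentsRpow.rpowIntegral_diagonal {p : ℝ} {μ : Measure ℝ} (h : RepresentsRpow p μ)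
    {d : n → ℂ} (hd : ∀ i, d i ∈ Complex.slitPlane) :
    rpowIntegral μ (Matrix.diagonal d) = Matrix.diagonal fun i => d i ^ (p : ℂ) := by
  have hk : ∀ x ∈ Icc (0 : ℝ) 1, rpowKernel (Matrix.diagonal d) x
      = Matrix.diagonal fun i => d i / ((1 - x : ℂ) + x * d i) := by
    intro x hx
    have h1 : ((1 - x : ℂ) • (1 : Matrix n n ℂ) + (x : ℂ) • Matrix.diagonal d)⁻¹
        = Matrix.diagonal fun i => ((1 - x : ℂ) + x * d i)⁻¹ := by
      apply Matrix.inv_eq_right_inv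
      rw [← Matrix.diagonal_one, ← Matrix.diagonal_smul, ← Matrix.diagonal_smul,
        Matrix.diagonal_add, Matrix.diagonal_mul_diagonal, Matrix.diagonal_eq_diagonal_iff]
      intro i
      have := slitPlane_den_ne_zero (hd i) hx
      simp [mul_inv_cancel₀ this]
    rw [rpowKernel, h1, Matrix.diagonal_mul_diagonal]
    rfl
  ext i j
  have h1 : rpowIntegral μ (Matrix.diagonal d) i j
      = ∫ x : ℝ, Matrix.diagonal (fun i => d i / ((1 - x : ℂ) + x * d i)) i j ∂μ :=
    integral_congr_ae (h.ae_mem_Icc.mono fun x hx => by simp only [hk x hx])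
  rw [h1]
  by_cases hij : i = j
  · subst hij
    simp only [Matrix.diagonal_apply_eq]
    exact h.integral_eq_cpow (hd i)
  · simp [hij]

lemma mul_mem_slitPlane_of_pos {c : ℂ} (hc : c ∈ Complex.slitPlane) {r : ℝ} (hr : 0 < r) :
    c * r ∈ Complex.slitPlane := by
  rw [Complex.mem_slitPlane_iff] at hc ⊢
  rw [Complex.re_mul_ofReal, Complex.im_mul_ofReal]
  exact hc.imp (fun h => mul_pos h hr) fun h => mul_ne_zero h hr.ne'

lemma mul_ofReal_cpow {c : ℂ} (hc : c ≠ 0) {r : ℝ} (hr : 0 < r) (p : ℝ) :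
    (c * r) ^ (p : ℂ) = c ^ (p : ℂ) * ((r ^ p : ℝ) : ℂ) := by
  have hr' : (r : ℂ) ≠ 0 := by exact_mod_cast hr.ne'
  rw [Complex.ofReal_cpow hr.le, Complex.cpow_def_of_ne_zero (mul_ne_zero hc hr'),
    Complex.cpow_def_of_ne_zero hc, Complex.cpow_def_of_ne_zero hr', mul_comm c,
    Complex.log_ofReal_mul hr hc, ← Complex.exp_add, Complex.ofReal_log hr.le]
  congr 1
  ring

lemma RepresentsRpow.rpowIntegral_smul_posDef {p : ℝ} {μ : Measure ℝ} (h : RepresentsRpow p μ)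
    {Z : Matrix n n ℂ} (hZ : Z.PosDef) {c : ℂ} (hc : c ∈ Complex.slitPlane) :
    rpowIntegral μ (c • Z) = (c ^ (p : ℂ)) • cfc (fun x : ℝ => x ^ p) Z := by
  set H := hZ.isHermitian with hH
  set U : Matrix n n ℂ := (H.eigenvectorUnitary : Matrix n n ℂ) with hU
  have hUU : U * star U = 1 := Unitary.mul_star_self_of_mem H.eigenvectorUnitary.2
  have hpos := hZ.eigenvalues_pos
  have h1 : c • Z = U * Matrix.diagonal (fun i => c * (H.eigenvalues i : ℂ)) * star U := by
    conv_lhs => rw [H.spectral_theorem, Unitary.conjStarAlgAut_apply]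
    rw [← Matrix.smul_mul, ← Matrix.mul_smul, ← Matrix.diagonal_smul]
    rfl
  have hd : ∀ i, c * (H.eigenvalues i : ℂ) ∈ Complex.slitPlane :=
    fun i => mul_mem_slitPlane_of_pos hc (hpos i)
  rw [h1, (slitSpectrum_diagonal hd).rpowIntegral_conj h U (star U) hUU,
    h.rpowIntegral_diagonal hd, H.cfc_eq, Matrix.IsHermitian.cfc, Unitary.conjStarAlgAut_apply]
  have hc0 := Complex.slitPlane_ne_zero hc
  have h2 : (Matrix.diagonal fun i => (c * (H.eigenvalues i : ℂ)) ^ (p : ℂ))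
      = c ^ (p : ℂ) • Matrix.diagonal (RCLike.ofReal ∘ (fun x : ℝ => x ^ p) ∘ H.eigenvalues) := by
    rw [← Matrix.diagonal_smul, Matrix.diagonal_eq_diagonal_iff]
    intro i
    exact mul_ofReal_cpow hc0 (hpos i) p
  rw [h2, Matrix.mul_smul, Matrix.smul_mul]

end

section

variable {n m k : Type*} [Fintype n] [DecidableEq n] [Fintype m] [DecidableEq m] [Fintype k]
  [DecidableEq k]

lemma eqOn_ball_of_eq_ofReal {f g : ℂ → ℂ} (hf : DifferentiableOn ℂ f (Metric.ball 0 1))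
    (hg : DifferentiableOn ℂ g (Metric.ball 0 1)) (h : ∀ t : ℝ, |t| < 1 → f t = g t) :
    EqOn f g (Metric.ball 0 1) := by
  have hU : IsOpen (Metric.ball (0 : ℂ) 1) := Metric.isOpen_ball
  refine AnalyticOnNhd.eqOn_of_preconnected_of_frequently_eq (hf.analyticOnNhd hU)
    (hg.analyticOnNhd hU) (convex_ball (0 : ℂ) 1).isPreconnected (z₀ := 0) (by simp) ?_
  have ht : Tendsto (fun t : ℝ => (t : ℂ)) (𝓝[≠] 0) (𝓝[≠] 0) := by
    refine tendsto_nhdsWithin_iff.2 ⟨?_, ?_⟩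
    · exact (Complex.continuous_ofReal.tendsto' 0 0 (by simp)).mono_left nhdsWithin_le_nhds
    · filter_upwards [self_mem_nhdsWithin] with t ht
      simpa using ht
  refine ht.frequently (Eventually.frequently ?_)
  filter_upwards [nhdsWithin_le_nhds (Metric.ball_mem_nhds (0 : ℝ) one_pos)] with t ht
  exact h t (by simpa using ht)

/-- The numerical range of `Z` lies in the open right half-plane. -/
def Accretive (Z : Matrix n n ℂ) : Prop :=
  ∀ v : n → ℂ, v ≠ 0 → 0 < (star v ⬝ᵥ (Z *ᵥ v)).re

lemma Matrix.PosDef.exists_dotProduct_eq {Z : Matrix n n ℂ} (hZ : Z.PosDef) {v : n → ℂ}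
    (hv : v ≠ 0) : ∃ r : ℝ, 0 < r ∧ star v ⬝ᵥ (Z *ᵥ v) = r := by
  have h := Complex.lt_def.1 (hZ.dotProduct_mulVec_pos hv)
  exact ⟨_, h.1, Complex.ext rfl (by simpa using h.2.symm)⟩

lemma accretive_smul_add_smul {Z₁ Z₂ : Matrix n n ℂ} (h₁ : Z₁.PosDef) (h₂ : Z₂.PosDef)
    {c₁ c₂ : ℂ} (hc₁ : 0 < c₁.re) (hc₂ : 0 < c₂.re) : Accretive (c₁ • Z₁ + c₂ • Z₂) := by
  intro v hv
  obtain ⟨r₁, hr₁, h1⟩ := h₁.exists_dotProduct_eq hv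
  obtain ⟨r₂, hr₂, h2⟩ := h₂.exists_dotProduct_eq hv
  rw [Matrix.add_mulVec, dotProduct_add, Matrix.smul_mulVec, Matrix.smul_mulVec, dotProduct_smul,
    dotProduct_smul, h1, h2, smul_eq_mul, smul_eq_mul, Complex.add_re, Complex.re_mul_ofReal,
    Complex.re_mul_ofReal]
  positivity

lemma Accretive.halfPlaneRange_I {Z : Matrix n n ℂ} (hZ : Accretive Z) :
    HalfPlaneRange 1 (Complex.I • Z) := by
  intro v hv
  have := hZ v hv
  rw [Matrix.smul_mulVec, dotProduct_smul]
  simpa using this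

lemma Accretive.halfPlaneRange_neg_I {Z : Matrix n n ℂ} (hZ : Accretive Z) :
    HalfPlaneRange (-1) ((-Complex.I) • Z) := by
  intro v hv
  have := hZ v hv
  rw [Matrix.smul_mulVec, dotProduct_smul]
  simpa using this

lemma Accretive.det_ne_zero {G : Matrix n n ℂ} (hG : Accretive G) : G.det ≠ 0 := by
  intro h
  obtain ⟨v, hv, hv0⟩ := Matrix.exists_mulVec_eq_zero_iff.2 h
  simpa [hv0] using hG v hv

lemma im_exp_mul_I_mul (a : ℝ) (z : ℂ) :
    (Complex.exp (a * Complex.I) * z).im = ‖z‖ * Real.sin (a + z.arg) := by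
  conv_lhs => rw [← Complex.norm_mul_exp_arg_mul_I z]
  rw [mul_left_comm, ← Complex.exp_add, ← add_mul, ← Complex.ofReal_add, Complex.im_ofReal_mul,
    Complex.exp_ofReal_mul_I_im]

lemma abs_arg_lt_of_rotated {z : ℂ} {a : ℝ} (ha : a ∈ Ioc 0 Real.pi)
    (h₁ : 0 < (Complex.exp (a * Complex.I) * z).im)
    (h₂ : (Complex.exp (-a * Complex.I) * z).im < 0) : z ≠ 0 ∧ |z.arg| < a := by
  have hz : z ≠ 0 := by rintro rfl; simp at h₁
  refine ⟨hz, ?_⟩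
  have hn := norm_pos_iff.2 hz
  rw [im_exp_mul_I_mul] at h₁
  rw [← Complex.ofReal_neg, im_exp_mul_I_mul] at h₂
  have hs₁ : 0 < Real.sin (a + z.arg) := pos_of_mul_pos_right h₁ hn.le
  have hs₂ : Real.sin (-a + z.arg) < 0 := by
    by_contra! h
    exact absurd h₂ (not_lt.2 (mul_nonneg hn.le h))
  have hlo := Complex.neg_pi_lt_arg z
  have hhi := Complex.arg_le_pi z
  rw [abs_lt]
  constructor
  · by_contra! h
    have := Real.sin_nonpos_of_nonpos_of_neg_pi_le (x := a + z.arg) (by linarith)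
      (by linarith [ha.1])
    linarith
  · by_contra! h
    have := Real.sin_nonneg_of_nonneg_of_le_pi (x := -a + z.arg) (by linarith)
      (by linarith [ha.1])
    linarith

lemma slitPlane_and_cpow_re_nonneg {z w : ℂ} {a α : ℝ} (hz : z ≠ 0) (hza : |z.arg| < a)
    (hw : 0 < w.re) (hα : 0 < α) (hα2 : 1 / 2 ≤ α) (ha : (a + Real.pi / 2) * α ≤ Real.pi / 2) :
    z * w⁻¹ ∈ Complex.slitPlane ∧ 0 ≤ ((z * w⁻¹) ^ (α : ℂ)).re := by
  have hw0 : w ≠ 0 := by rintro rfl; simp at hw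
  have hwa : |w⁻¹.arg| < Real.pi / 2 := by
    rw [Complex.abs_arg_inv]; exact Complex.abs_arg_lt_pi_div_two_iff.2 (Or.inl hw)
  have hsum : |z.arg + w⁻¹.arg| < a + Real.pi / 2 :=
    (abs_add_le _ _).trans_lt (add_lt_add hza hwa)
  have hpi : a + Real.pi / 2 ≤ Real.pi := by
    by_contra! h
    nlinarith [Real.pi_pos]
  have h1 := abs_lt.1 (hsum.trans_le hpi)
  have harg : (z * w⁻¹).arg = z.arg + w⁻¹.arg :=
    Complex.arg_mul hz (inv_ne_zero hw0) ⟨h1.1, h1.2.le⟩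
  have hne : z * w⁻¹ ≠ 0 := mul_ne_zero hz (inv_ne_zero hw0)
  constructor
  · rw [Complex.mem_slitPlane_iff_arg, harg]
    exact ⟨h1.2.ne, hne⟩
  · rw [Complex.cpow_def_of_ne_zero hne, Complex.exp_re, Complex.im_mul_ofReal, Complex.log_im,
      harg]
    refine mul_nonneg (Real.exp_pos _).le (Real.cos_nonneg_of_mem_Icc ?_)
    have h2 : |(z.arg + w⁻¹.arg) * α| ≤ Real.pi / 2 := by
      rw [abs_mul, abs_of_pos hα]
      exact (mul_le_mul_of_nonneg_right hsum.le hα.le).trans ha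
    exact ⟨(abs_le.1 h2).1, (abs_le.1 h2).2⟩

lemma Accretive.eigenvalue_mul {G K : Matrix n n ℂ} {a α : ℝ} (hG : Accretive G)
    (hK : ∀ v : n → ℂ, v ≠ 0 →
      (star v ⬝ᵥ (K *ᵥ v)) ≠ 0 ∧ |(star v ⬝ᵥ (K *ᵥ v)).arg| < a)
    (hα : 0 < α) (hα2 : 1 / 2 ≤ α) (ha : (a + Real.pi / 2) * α ≤ Real.pi / 2)
    {v : n → ℂ} (hv : v ≠ 0) {y : ℂ} (hy : (G * K) *ᵥ v = y • v) :
    y ∈ Complex.slitPlane ∧ 0 ≤ (y ^ (α : ℂ)).re := by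
  have hu : IsUnit G.det := isUnit_iff_ne_zero.2 hG.det_ne_zero
  set u := G⁻¹ *ᵥ v with hu_def
  have hGu : G *ᵥ u = v := by
    rw [hu_def, Matrix.mulVec_mulVec, Matrix.mul_nonsing_inv G hu, Matrix.one_mulVec]
  have hu0 : u ≠ 0 := by
    intro h
    rw [h, Matrix.mulVec_zero] at hGu
    exact hv hGu.symm
  have hKv : K *ᵥ v = y • u := by
    rw [hu_def, ← Matrix.mulVec_smul, ← hy, Matrix.mulVec_mulVec, ← Matrix.mul_assoc,
      Matrix.nonsing_inv_mul G hu, Matrix.one_mul]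
  have hre : 0 < (star v ⬝ᵥ u).re := by
    have h1 := hG u hu0
    rw [hGu] at h1
    have h2 : star v ⬝ᵥ u = star (star u ⬝ᵥ v) := Matrix.star_dotProduct v u
    rw [h2]
    simpa using h1
  have hne : star v ⬝ᵥ u ≠ 0 := by intro h; simp [h] at hre
  obtain ⟨h1, h2⟩ := hK v hv
  have hyeq : y = (star v ⬝ᵥ (K *ᵥ v)) * (star v ⬝ᵥ u)⁻¹ := by
    rw [hKv, dotProduct_smul, smul_eq_mul, mul_assoc, mul_inv_cancel₀ hne, mul_one]
  rw [hyeq]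
  exact slitPlane_and_cpow_re_nonneg h1 h2 hre hα hα2 ha

lemma Matrix.PosDef.cfc_rpow {Z : Matrix n n ℂ} (hZ : Z.PosDef) (p : ℝ) :
    (cfc (fun x : ℝ => x ^ p) Z).PosDef := by
  rw [hZ.isHermitian.cfc_eq, Matrix.IsHermitian.cfc, Unitary.conjStarAlgAut_apply,
    Matrix.IsUnit.posDef_star_right_conjugate_iff
      Unitary.isUnit_coe]
  rw [Matrix.posDef_diagonal_iff]
  intro i
  have := Real.rpow_pos_of_pos (hZ.eigenvalues_pos i) p
  simpa using this

lemma Matrix.PosDef.cfc_rpow_half_mul_self {Z : Matrix n n ℂ} (hZ : Z.PosDef) :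
    cfc (fun x : ℝ => x ^ (1 / 2 : ℝ)) Z * cfc (fun x : ℝ => x ^ (1 / 2 : ℝ)) Z = Z := by
  have hs : IsSelfAdjoint Z := hZ.isHermitian
  have hc : Continuous fun x : ℝ => x ^ (1 / 2 : ℝ) := Real.continuous_rpow_const (by norm_num)
  rw [← cfc_mul _ _ Z hc.continuousOn hc.continuousOn]
  conv_rhs => rw [← cfc_id ℝ Z hs]
  refine cfc_congr fun x hx => ?_
  rw [hZ.isHermitian.spectrum_real_eq_range_eigenvalues] at hx
  obtain ⟨i, rfl⟩ := hx
  have := hZ.eigenvalues_pos i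
  simp only [id]
  rw [← Real.rpow_add this]
  norm_num

lemma Matrix.mulVec_injective_of_conjTranspose_mul_self {S : Matrix n k ℂ} (hS : Sᴴ * S = 1) :
    Function.Injective S.mulVec := by
  intro v w h
  have := congrArg (fun u => Sᴴ *ᵥ u) h
  simpa [Matrix.mulVec_mulVec, hS] using this

/-- The pencil through `A` and `B`, holomorphic on the unit disc, with coefficients mapping the
disc to the right half-plane. -/
def discMix (A B : Matrix n n ℂ) (w : ℂ) : Matrix n n ℂ :=
  ((1 + w) / (2 * (1 - w))) • A + ((1 - w) / (2 * (1 + w))) • B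

lemma one_sub_ne_zero_of_mem_ball {w : ℂ} (hw : w ∈ Metric.ball (0 : ℂ) 1) : 1 - w ≠ 0 := by
  intro h
  rw [sub_eq_zero] at h
  simp [← h] at hw

lemma one_add_ne_zero_of_mem_ball {w : ℂ} (hw : w ∈ Metric.ball (0 : ℂ) 1) : 1 + w ≠ 0 := by
  simpa using one_sub_ne_zero_of_mem_ball (w := -w) (by simpa using hw)

lemma re_cayley_pos {w : ℂ} (hw : w ∈ Metric.ball (0 : ℂ) 1) :
    0 < ((1 + w) / (2 * (1 - w))).re := by
  have h1 := one_sub_ne_zero_of_mem_ball hw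
  have h2 : w.re ^ 2 + w.im ^ 2 < 1 := by
    have h3 : ‖w‖ < 1 := by simpa using hw
    have h4 : Complex.normSq w < 1 := by
      rw [Complex.normSq_eq_norm_sq]; nlinarith [norm_nonneg w]
    rw [Complex.normSq_apply] at h4
    nlinarith
  have h5 : 0 < Complex.normSq (2 * (1 - w)) :=
    Complex.normSq_pos.2 (mul_ne_zero two_ne_zero h1)
  rw [Complex.div_re, ← add_div]
  apply div_pos _ h5
  simp
  nlinarith

lemma re_cayley_neg_pos {w : ℂ} (hw : w ∈ Metric.ball (0 : ℂ) 1) :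
    0 < ((1 - w) / (2 * (1 + w))).re := by
  simpa [sub_eq_add_neg] using re_cayley_pos (w := -w) (by simpa using hw)

lemma matDiffOn_discMix (A B : Matrix n n ℂ) : MatDiffOn (discMix A B) (Metric.ball 0 1) := by
  refine MatDiffOn.add (MatDiffOn.smul ?_ (MatDiffOn.const A)) (MatDiffOn.smul ?_ (MatDiffOn.const B))
  · exact DifferentiableOn.div (by fun_prop) (by fun_prop)
      fun w hw => mul_ne_zero two_ne_zero (one_sub_ne_zero_of_mem_ball hw)
  · exact DifferentiableOn.div (by fun_prop) (by fun_prop)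
      fun w hw => mul_ne_zero two_ne_zero (one_add_ne_zero_of_mem_ball hw)

lemma accretive_discMix {A B : Matrix n n ℂ} (hA : A.PosDef) (hB : B.PosDef) {w : ℂ}
    (hw : w ∈ Metric.ball (0 : ℂ) 1) : Accretive (discMix A B w) :=
  accretive_smul_add_smul hA hB (re_cayley_pos hw) (re_cayley_neg_pos hw)

lemma posDef_discMix {A B : Matrix n n ℂ} (hA : A.PosDef) (hB : B.PosDef) {t : ℝ}
    (ht : |t| < 1) : (discMix A B t).PosDef := by
  obtain ⟨h1, h2⟩ := abs_lt.1 ht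
  have hp : 0 < (1 + t) / (2 * (1 - t)) := div_pos (by linarith) (by linarith)
  have hm : 0 < (1 - t) / (2 * (1 + t)) := div_pos (by linarith) (by linarith)
  have := (hA.smul hp).add (hB.smul hm)
  convert! this using 1
  simp [discMix, ← Complex.coe_smul]

lemma ofReal_mem_ball {t : ℝ} (ht : |t| < 1) : (t : ℂ) ∈ Metric.ball (0 : ℂ) 1 := by
  simpa using ht

lemma exp_mul_neg_I_cpow (p : ℝ) :
    Complex.exp ((Real.pi * p / 2 : ℝ) * Complex.I) * (-Complex.I) ^ (p : ℂ) = 1 := by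
  rw [Complex.cpow_def_of_ne_zero (neg_ne_zero.2 Complex.I_ne_zero), Complex.log_neg_I,
    ← Complex.exp_add]
  rw [← Complex.exp_zero]
  congr 1
  push_cast
  ring

lemma exp_neg_mul_I_cpow (p : ℝ) :
    Complex.exp (-(Real.pi * p / 2 : ℝ) * Complex.I) * Complex.I ^ (p : ℂ) = 1 := by
  rw [Complex.cpow_def_of_ne_zero Complex.I_ne_zero, Complex.log_I, ← Complex.exp_add]
  rw [← Complex.exp_zero]
  congr 1
  push_cast
  ring

lemma neg_I_mem_slitPlane : -Complex.I ∈ Complex.slitPlane := by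
  simp [Complex.mem_slitPlane_iff]

lemma I_mem_slitPlane : Complex.I ∈ Complex.slitPlane := by
  simp [Complex.mem_slitPlane_iff]

/-- The holomorphic continuation of `t ↦ (discMix Z₁ Z₂ t) ^ p` to the unit disc. -/
lemma RepresentsRpow.exists_disc_rpow {p : ℝ} (hp : p ∈ Ioc (0 : ℝ) 1) {μ : Measure ℝ}
    (h : RepresentsRpow p μ) {Z₁ Z₂ : Matrix n n ℂ} (h₁ : Z₁.PosDef) (h₂ : Z₂.PosDef) :
    ∃ X : ℂ → Matrix n n ℂ, MatDiffOn X (Metric.ball 0 1) ∧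
      (∀ w ∈ Metric.ball (0 : ℂ) 1, ∀ v : n → ℂ, v ≠ 0 →
        star v ⬝ᵥ (X w *ᵥ v) ≠ 0 ∧ |(star v ⬝ᵥ (X w *ᵥ v)).arg| < Real.pi * p / 2) ∧
      ∀ t : ℝ, |t| < 1 → X t = cfc (fun x : ℝ => x ^ p) (discMix Z₁ Z₂ t) := by
  have hfin := h.finite
  set a : ℝ := Real.pi * p / 2 with ha
  set X : ℂ → Matrix n n ℂ := fun w =>
    Complex.exp (a * Complex.I) • rpowIntegral μ ((-Complex.I) • discMix Z₁ Z₂ w) with hX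
  set Y : ℂ → Matrix n n ℂ := fun w =>
    Complex.exp (-a * Complex.I) • rpowIntegral μ (Complex.I • discMix Z₁ Z₂ w) with hY
  have hac := fun (w : ℂ) (hw : w ∈ Metric.ball (0 : ℂ) 1) => accretive_discMix h₁ h₂ hw
  have hXd : MatDiffOn X (Metric.ball 0 1) :=
    MatDiffOn.smul (differentiableOn_const _) (MatDiffOn.rpowIntegral h.ae_mem_Icc
      Metric.isOpen_ball (MatDiffOn.smul (differentiableOn_const _) (matDiffOn_discMix Z₁ Z₂))
      fun w hw => (hac w hw).halfPlaneRange_neg_I.slitSpectrum)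
  have hYd : MatDiffOn Y (Metric.ball 0 1) :=
    MatDiffOn.smul (differentiableOn_const _) (MatDiffOn.rpowIntegral h.ae_mem_Icc
      Metric.isOpen_ball (MatDiffOn.smul (differentiableOn_const _) (matDiffOn_discMix Z₁ Z₂))
      fun w hw => (hac w hw).halfPlaneRange_I.slitSpectrum)
  have hXt : ∀ t : ℝ, |t| < 1 → X t = cfc (fun x : ℝ => x ^ p) (discMix Z₁ Z₂ t) := by
    intro t ht
    simp only [hX]
    rw [h.rpowIntegral_smul_posDef (posDef_discMix h₁ h₂ ht) neg_I_mem_slitPlane, smul_smul,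
      exp_mul_neg_I_cpow, one_smul]
  have hYt : ∀ t : ℝ, |t| < 1 → Y t = cfc (fun x : ℝ => x ^ p) (discMix Z₁ Z₂ t) := by
    intro t ht
    simp only [hY]
    rw [h.rpowIntegral_smul_posDef (posDef_discMix h₁ h₂ ht) I_mem_slitPlane, smul_smul,
      exp_neg_mul_I_cpow, one_smul]
  have hXY : ∀ w ∈ Metric.ball (0 : ℂ) 1, X w = Y w := by
    intro w hw
    ext i j
    exact eqOn_ball_of_eq_ofReal (hXd i j) (hYd i j)
      (fun t ht => by simp only [hXt t ht, hYt t ht]) hw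
  refine ⟨X, hXd, ?_, hXt⟩
  intro w hw v hv
  have hpi := Real.pi_pos
  apply abs_arg_lt_of_rotated
  · exact ⟨by rw [ha]; have := hp.1; positivity, by rw [ha]; nlinarith [hp.2]⟩
  · have := (hac w hw).halfPlaneRange_I.rpowIntegral h v hv
    rw [hXY w hw]
    simp only [hY]
    rw [Matrix.smul_mulVec, dotProduct_smul, smul_eq_mul, ← mul_assoc, ← Complex.exp_add]
    simpa using this
  · have := (hac w hw).halfPlaneRange_neg_I.rpowIntegral h v hv
    simp only [hX]
    rw [Matrix.smul_mulVec, dotProduct_smul, smul_eq_mul, ← mul_assoc, ← Complex.exp_add]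
    simpa using this

/-- `t ↦ Ψ(G(t), Z(t))` along a disc pencil is the trace of a function holomorphic on the unit
disc with nonnegative real part. -/
lemma exists_disc_PsiS {k n : ℕ} {α : ℝ} (hα : α ∈ Ico (1 / 2 : ℝ) 1)
    {S : Matrix (Fin n) (Fin k) ℂ} (hS : Sᴴ * S = 1) {G₁ G₂ : Matrix (Fin k) (Fin k) ℂ}
    {Z₁ Z₂ : Matrix (Fin n) (Fin n) ℂ} (hG₁ : G₁.PosDef) (hG₂ : G₂.PosDef) (hZ₁ : Z₁.PosDef)
    (hZ₂ : Z₂.PosDef) :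
    ∃ Q : ℂ → ℂ, DifferentiableOn ℂ Q (Metric.ball 0 1) ∧
      (∀ w ∈ Metric.ball (0 : ℂ) 1, 0 ≤ (Q w).re) ∧
      ∀ t : ℝ, |t| < 1 → (Q t).re = PsiS α S (discMix G₁ G₂ t) (discMix Z₁ Z₂ t) := by
  have hα0 : 0 < α := by linarith [hα.1]
  have hp : (1 - α) / α ∈ Ioc (0 : ℝ) 1 :=
    ⟨div_pos (by linarith [hα.2]) hα0, by rw [div_le_one hα0]; linarith [hα.1]⟩
  obtain ⟨μ, hμ⟩ := exists_representsRpow hp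
  obtain ⟨ν, hν⟩ := exists_representsRpow (p := α) ⟨hα0, hα.2.le⟩
  have hνf := hν.finite
  obtain ⟨X, hXd, hXarg, hXt⟩ := hμ.exists_disc_rpow hp hZ₁ hZ₂
  set M : ℂ → Matrix (Fin k) (Fin k) ℂ := fun w => discMix G₁ G₂ w * (Sᴴ * X w * S) with hM
  have hMd : MatDiffOn M (Metric.ball 0 1) :=
    (matDiffOn_discMix G₁ G₂).mul (((MatDiffOn.const _).mul hXd).mul (MatDiffOn.const _))
  have hSinj := Matrix.mulVec_injective_of_conjTranspose_mul_self hS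
  have heig : ∀ w ∈ Metric.ball (0 : ℂ) 1, ∀ v : Fin k → ℂ, v ≠ 0 → ∀ y : ℂ,
      M w *ᵥ v = y • v → y ∈ Complex.slitPlane ∧ 0 ≤ (y ^ (α : ℂ)).re := by
    intro w hw v hv y hy
    refine (accretive_discMix hG₁ hG₂ hw).eigenvalue_mul (a := Real.pi * ((1 - α) / α) / 2) ?_
      hα0 hα.1 (le_of_eq ?_) hv hy
    · intro v hv
      have h0 : S *ᵥ v ≠ 0 := fun h => hv (hSinj (by simpa using h))
      have h1 : star v ⬝ᵥ ((Sᴴ * X w * S) *ᵥ v) = star (S *ᵥ v) ⬝ᵥ (X w *ᵥ (S *ᵥ v)) := by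
        rw [Matrix.star_mulVec, Matrix.mulVec_mulVec, Matrix.mul_assoc, Matrix.dotProduct_mulVec,
          Matrix.dotProduct_mulVec, Matrix.vecMul_vecMul]
      rw [h1]
      exact hXarg w hw _ h0
    · field_simp
      ring
  have hslit : ∀ w ∈ Metric.ball (0 : ℂ) 1, SlitSpectrum (M w) :=
    fun w hw v hv y hy => (heig w hw v hv y hy).1
  have hRd := MatDiffOn.rpowIntegral hν.ae_mem_Icc Metric.isOpen_ball hMd hslit
  refine ⟨fun w => (rpowIntegral ν (M w)).trace, ?_, ?_, ?_⟩
  · simp only [Matrix.trace, Matrix.diag]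
    exact DifferentiableOn.fun_sum fun i _ => hRd i i
  · intro w hw
    simp only
    rw [hν.trace_rpowIntegral (hslit w hw), ← Complex.coe_reAddGroupHom, map_multiset_sum,
      Multiset.map_map]
    apply Multiset.sum_nonneg
    intro r hr
    obtain ⟨y, hy, rfl⟩ := Multiset.mem_map.1 hr
    obtain ⟨v, hv, hvy⟩ := Matrix.exists_mulVec_eq_smul_of_mem_roots hy
    exact (heig w hw v hv y hvy).2
  · intro t ht
    have hG := posDef_discMix hG₁ hG₂ ht
    have hZ := posDef_discMix hZ₁ hZ₂ ht
    set R := mpow (discMix G₁ G₂ t) (1 / 2) with hR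
    have hRpd : R.PosDef := hG.cfc_rpow _
    have hRR : R * R = discMix G₁ G₂ t := hG.cfc_rpow_half_mul_self
    set K : Matrix (Fin k) (Fin k) ℂ := Sᴴ * X t * S with hK
    have hKpd : K.PosDef := by
      rw [hK, hXt t ht]
      exact (hZ.cfc_rpow _).conjTranspose_mul_mul_same hSinj
    have hNpd : (R * K * R).PosDef := by
      have := hKpd.conjTranspose_mul_mul_same (Matrix.mulVec_injective_of_isUnit hRpd.isUnit)
      rwa [hRpd.isHermitian.eq] at this
    have h1 : (R * K * R).charpoly = (M t).charpoly := by
      rw [Matrix.charpoly_mul_comm, ← Matrix.mul_assoc, hRR]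
    have h2 : rpowIntegral ν (R * K * R) = mpow (R * K * R) α := by
      have := hν.rpowIntegral_smul_posDef hNpd (c := 1) (by simp)
      rwa [one_smul, Complex.one_cpow, one_smul] at this
    have h3 : SlitSpectrum (R * K * R) := by
      intro v hv y hy
      obtain ⟨r, hr, h4⟩ := hNpd.exists_dotProduct_eq hv
      obtain ⟨s, hs, -, hs0⟩ := star_dotProduct_smul_self v
      rw [hy, dotProduct_smul, hs, smul_eq_mul] at h4
      have hsv := hs0 hv
      have : y = ((r / s : ℝ) : ℂ) := by
        have hs' : (s : ℂ) ≠ 0 := by exact_mod_cast hsv.ne'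
        push_cast
        rw [← h4, mul_div_cancel_right₀ _ hs']
      rw [this]
      exact Complex.ofReal_mem_slitPlane.2 (div_pos hr hsv)
    simp only
    rw [hν.trace_rpowIntegral (hslit _ (ofReal_mem_ball ht)), ← h1, ← hν.trace_rpowIntegral h3, h2,
      PsiS, hK, hXt t ht, ← hR]
    simp only [Matrix.mul_assoc]
    rfl

end

lemma cfc_rpow_smul {n : Type*} [Fintype n] [DecidableEq n] {Z : Matrix n n ℂ} (hZ : Z.PosDef)
    {c : ℝ} (hc : 0 < c) {p : ℝ} (hp : p ∈ Ioc (0 : ℝ) 1) :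
    cfc (fun x : ℝ => x ^ p) ((c : ℂ) • Z) = ((c ^ p : ℝ) : ℂ) • cfc (fun x : ℝ => x ^ p) Z := by
  obtain ⟨μ, hμ⟩ := exists_representsRpow hp
  have hcZ : ((c : ℂ) • Z).PosDef := by
    rw [Complex.coe_smul]; exact hZ.smul hc
  have h1 := hμ.rpowIntegral_smul_posDef hcZ (c := 1) (by simp)
  rw [one_smul, Complex.one_cpow, one_smul] at h1
  rw [← h1, hμ.rpowIntegral_smul_posDef hZ (Complex.ofReal_mem_slitPlane.2 hc),
    Complex.ofReal_cpow hc.le]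

lemma exponent_mem_Ioc {α : ℝ} (hα : α ∈ Ico (1 / 2 : ℝ) 1) : (1 - α) / α ∈ Ioc (0 : ℝ) 1 := by
  have hα0 : 0 < α := by linarith [hα.1]
  exact ⟨div_pos (by linarith [hα.2]) hα0, by rw [div_le_one hα0]; linarith [hα.1]⟩

lemma posDef_inner_PsiS {k n : ℕ} (α : ℝ)
    {S : Matrix (Fin n) (Fin k) ℂ} (hS : Sᴴ * S = 1) {G : Matrix (Fin k) (Fin k) ℂ}
    {Z : Matrix (Fin n) (Fin n) ℂ} (hG : G.PosDef) (hZ : Z.PosDef) :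
    (mpow G (1 / 2) * Sᴴ * mpow Z ((1 - α) / α) * S * mpow G (1 / 2)).PosDef := by
  have hR : (mpow G (1 / 2)).PosDef := hG.cfc_rpow _
  have hK : (Sᴴ * mpow Z ((1 - α) / α) * S).PosDef :=
    (hZ.cfc_rpow _).conjTranspose_mul_mul_same
      (Matrix.mulVec_injective_of_conjTranspose_mul_self hS)
  have := hK.conjTranspose_mul_mul_same (Matrix.mulVec_injective_of_isUnit hR.isUnit)
  rw [hR.isHermitian.eq] at this
  simpa only [Matrix.mul_assoc] using this

lemma PsiS_nonneg {k n : ℕ} (α : ℝ)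
    {S : Matrix (Fin n) (Fin k) ℂ} (hS : Sᴴ * S = 1) {G : Matrix (Fin k) (Fin k) ℂ}
    {Z : Matrix (Fin n) (Fin n) ℂ} (hG : G.PosDef) (hZ : Z.PosDef) : 0 ≤ PsiS α S G Z :=
  (Complex.le_def.1 ((posDef_inner_PsiS α hS hG hZ).cfc_rpow α).posSemidef.trace_nonneg).1

lemma PsiS_smul {k n : ℕ} {α : ℝ} (hα : α ∈ Ico (1 / 2 : ℝ) 1)
    {S : Matrix (Fin n) (Fin k) ℂ} (hS : Sᴴ * S = 1) {G : Matrix (Fin k) (Fin k) ℂ}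
    {Z : Matrix (Fin n) (Fin n) ℂ} (hG : G.PosDef) (hZ : Z.PosDef) {c : ℝ} (hc : 0 < c) :
    PsiS α S ((c : ℂ) • G) ((c : ℂ) • Z) = c * PsiS α S G Z := by
  have hα0 : 0 < α := by linarith [hα.1]
  have hN := posDef_inner_PsiS α hS hG hZ
  have hhalf : (1 / 2 : ℝ) ∈ Ioc (0 : ℝ) 1 := by norm_num
  have h1 : mpow ((c : ℂ) • G) (1 / 2) = ((c ^ (1 / 2 : ℝ) : ℝ) : ℂ) • mpow G (1 / 2) :=
    cfc_rpow_smul hG hc hhalf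
  have h2 : mpow ((c : ℂ) • Z) ((1 - α) / α)
      = ((c ^ ((1 - α) / α) : ℝ) : ℂ) • mpow Z ((1 - α) / α) :=
    cfc_rpow_smul hZ hc (exponent_mem_Ioc hα)
  rw [PsiS, h1, h2]
  simp only [Matrix.smul_mul, Matrix.mul_smul, smul_smul]
  rw [← Complex.ofReal_mul, ← Complex.ofReal_mul, ← Real.rpow_add hc, ← Real.rpow_add hc]
  have h3 := cfc_rpow_smul hN (c := c ^ (1 / 2 + (1 - α) / α + 1 / 2)) (Real.rpow_pos_of_pos hc _)
    (p := α) ⟨hα0, hα.2.le⟩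
  have h4 : (c ^ (1 / 2 + (1 - α) / α + 1 / 2)) ^ α = c := by
    rw [← Real.rpow_mul hc.le]
    have : (1 / 2 + (1 - α) / α + 1 / 2) * α = 1 := by field_simp; ring
    rw [this, Real.rpow_one]
  rw [h4] at h3
  rw [mpow, show (1 / 2 + ((1 - α) / α + 1 / 2) : ℝ) = 1 / 2 + (1 - α) / α + 1 / 2 by ring, h3,
    Matrix.trace_smul, smul_eq_mul, Complex.re_ofReal_mul]
  rfl

lemma smul_discMix_eq {n : Type*} (A B : Matrix n n ℂ) {t : ℝ} (ht : |t| < 1) :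
    ((Real.sqrt (1 - t ^ 2) : ℝ) : ℂ) • discMix A B ((t / (1 + Real.sqrt (1 - t ^ 2)) : ℝ) : ℂ)
      = (((1 + t) / 2 : ℝ) : ℂ) • A + (((1 - t) / 2 : ℝ) : ℂ) • B := by
  obtain ⟨h1, h2⟩ := abs_lt.1 ht
  have hnn : 0 < 1 - t ^ 2 := by nlinarith
  set s := Real.sqrt (1 - t ^ 2) with hs
  have hs0 : 0 < s := Real.sqrt_pos.2 hnn
  have hss : s * s = 1 - t ^ 2 := Real.mul_self_sqrt hnn.le
  have hne1 : 1 + s - t ≠ 0 := by linarith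
  have hne2 : 1 + s + t ≠ 0 := by linarith
  have hw1 : 1 - t / (1 + s) = (1 + s - t) / (1 + s) := by field_simp
  have hw2 : 1 + t / (1 + s) = (1 + s + t) / (1 + s) := by field_simp
  have e1 : s * ((1 + t / (1 + s)) / (2 * (1 - t / (1 + s)))) = (1 + t) / 2 := by
    rw [hw1, hw2]; field_simp; nlinarith
  have e2 : s * ((1 - t / (1 + s)) / (2 * (1 + t / (1 + s)))) = (1 - t) / 2 := by
    rw [hw1, hw2]; field_simp; nlinarith
  rw [discMix, smul_add, smul_smul, smul_smul, ← e1, ← e2]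
  push_cast
  rfl

/-- Along a segment through positive definite matrices, `Ψ` is given by a holomorphic function of
nonnegative real part on the unit disc. -/
lemma exists_segment_PsiS {k n : ℕ} {α : ℝ} (hα : α ∈ Ico (1 / 2 : ℝ) 1)
    {S : Matrix (Fin n) (Fin k) ℂ} (hS : Sᴴ * S = 1) {G₁ G₂ : Matrix (Fin k) (Fin k) ℂ}
    {Z₁ Z₂ : Matrix (Fin n) (Fin n) ℂ} (hG₁ : G₁.PosDef) (hG₂ : G₂.PosDef) (hZ₁ : Z₁.PosDef)
    (hZ₂ : Z₂.PosDef) :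
    ∃ Q : ℂ → ℂ, DifferentiableOn ℂ Q (Metric.ball 0 1) ∧
      (∀ w ∈ Metric.ball (0 : ℂ) 1, 0 ≤ (Q w).re) ∧
      ∀ t : ℝ, |t| < 1 →
        PsiS α S ((((1 + t) / 2 : ℝ) : ℂ) • G₁ + (((1 - t) / 2 : ℝ) : ℂ) • G₂)
          ((((1 + t) / 2 : ℝ) : ℂ) • Z₁ + (((1 - t) / 2 : ℝ) : ℂ) • Z₂)
        = Real.sqrt (1 - t ^ 2) * (Q ((t / (1 + Real.sqrt (1 - t ^ 2)) : ℝ) : ℂ)).re := by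
  obtain ⟨Q, hQ, hQre, hQt⟩ := exists_disc_PsiS hα hS hG₁ hG₂ hZ₁ hZ₂
  refine ⟨Q, hQ, hQre, fun t ht => ?_⟩
  obtain ⟨h1, h2⟩ := abs_lt.1 ht
  have hs0 : 0 < Real.sqrt (1 - t ^ 2) := Real.sqrt_pos.2 (by nlinarith)
  have hw : |t / (1 + Real.sqrt (1 - t ^ 2))| < 1 := by
    rw [abs_div, abs_of_pos (by linarith : 0 < 1 + Real.sqrt (1 - t ^ 2)),
      div_lt_one (by linarith)]
    linarith
  rw [← smul_discMix_eq G₁ G₂ ht, ← smul_discMix_eq Z₁ Z₂ ht,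
    PsiS_smul hα hS (posDef_discMix hG₁ hG₂ hw) (posDef_discMix hZ₁ hZ₂ hw) hs0, hQt _ hw]

/-- Third-order Taylor expansion of a holomorphic function with holomorphic remainder. -/
lemma exists_taylor_three {Q : ℂ → ℂ} (hQ : DifferentiableOn ℂ Q (Metric.ball 0 1)) :
    ∃ (a₀ a₁ a₂ a₃ : ℂ) (H : ℂ → ℂ), DifferentiableOn ℂ H (Metric.ball 0 1) ∧
      ∀ z, Q z = a₀ + a₁ * z + a₂ * z ^ 2 + a₃ * z ^ 3 + z ^ 4 * H z := by
  have key : ∀ f : ℂ → ℂ, DifferentiableOn ℂ f (Metric.ball 0 1) →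
      DifferentiableOn ℂ (dslope f 0) (Metric.ball 0 1) ∧ ∀ z, f z = f 0 + z * dslope f 0 z := by
    intro f hf
    refine ⟨(Complex.differentiableOn_dslope (Metric.ball_mem_nhds 0 one_pos)).2 hf, fun z => ?_⟩
    have := sub_smul_dslope f 0 z
    rw [sub_zero, smul_eq_mul] at this
    rw [this]; ring
  obtain ⟨d1, e1⟩ := key Q hQ
  obtain ⟨d2, e2⟩ := key _ d1
  obtain ⟨d3, e3⟩ := key _ d2
  obtain ⟨d4, e4⟩ := key _ d3
  refine ⟨Q 0, dslope Q 0 0, dslope (dslope Q 0) 0 0, dslope (dslope (dslope Q 0) 0) 0 0, _, d4,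
    fun z => ?_⟩
  rw [e1 z, e2 z, e3 z, e4 z]
  ring

lemma re_zero_nonneg_of_re_sphere_nonneg {P : ℂ → ℂ} {U : Set ℂ}
    (hsub : Metric.closedBall 0 1 ⊆ U) (hP : DifferentiableOn ℂ P U)
    (h : ∀ z : ℂ, ‖z‖ = 1 → 0 ≤ (P z).re) : 0 ≤ (P 0).re := by
  have hd : DiffContOnCl ℂ P (Metric.ball 0 |1|) := by
    rw [abs_one]
    exact (hP.mono (closure_mono Metric.ball_subset_closedBall |>.trans
      (by simpa using hsub))).diffContOnCl
  rw [← hd.circleAverage, Real.circleAverage, Complex.smul_re]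
  have hc : Continuous fun θ : ℝ => P (circleMap 0 1 θ) := by
    refine (hP.continuousOn.comp_continuous (continuous_circleMap 0 1) fun θ => hsub ?_)
    exact circleMap_mem_closedBall 0 zero_le_one θ
  have h1 : (∫ θ in (0)..2 * Real.pi, P (circleMap 0 1 θ)).re
      = ∫ θ in (0)..2 * Real.pi, (P (circleMap 0 1 θ)).re := by
    have := Complex.reCLM.intervalIntegral_comp_comm (hc.intervalIntegrable (μ := volume) 0 (2 * Real.pi))
    exact this.symm
  rw [h1]
  refine smul_nonneg (by positivity) (intervalIntegral.integral_nonneg (by positivity) fun θ _ => ?_)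
  exact h _ (by simp)

open scoped ComplexConjugate in
lemma taylor_coeff_nonneg_of_re_sphere_nonneg {g h : ℂ → ℂ} {b₀ b₁ b₂ b₃ : ℂ} {U : Set ℂ}
    (hsub : Metric.closedBall 0 1 ⊆ U) (hh : DifferentiableOn ℂ h U)
    (hg : ∀ z, g z = b₀ + b₁ * z + b₂ * z ^ 2 + b₃ * z ^ 3 + z ^ 4 * h z)
    (hre : ∀ z : ℂ, ‖z‖ = 1 → 0 ≤ (g z).re) {ε : ℝ} (hε : |ε| ≤ 1) :
    0 ≤ (4 * b₀ - 2 * b₂ + ε * (b₃ - b₁)).re := by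
  set P : ℂ → ℂ := fun z =>
    (b₀ + b₁ * z + b₂ * z ^ 2 + b₃ * z ^ 3 + z ^ 4 * h z) * (4 - 2 * z ^ 2 + ε * (z ^ 3 - z))
      - 2 * (conj b₀ * z ^ 2 + conj b₁ * z + b₂ + b₃ * z + z ^ 2 * h z)
      + ε * (conj b₀ * z ^ 3 + conj b₁ * z ^ 2 + conj b₂ * z + b₃ + z * h z)
      - ε * (conj b₀ * z + b₁ + b₂ * z + b₃ * z ^ 2 + z ^ 3 * h z) with hP
  have hPd : DifferentiableOn ℂ P U := by
    simp only [hP]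
    fun_prop
  have h0 := re_zero_nonneg_of_re_sphere_nonneg hsub hPd fun z hz => ?_
  · have : P 0 = 4 * b₀ - 2 * b₂ + ε * (b₃ - b₁) := by simp only [hP]; ring
    rwa [this] at h0
  · have hzw : z * conj z = 1 := by
      rw [Complex.mul_conj, Complex.normSq_eq_norm_sq, hz]; norm_num
    have hz0 : z ≠ 0 := fun h => by simp [h] at hzw
    have hw : conj z = z⁻¹ := eq_inv_of_mul_eq_one_right hzw
    have hT : (4 - 2 * z ^ 2 + ε * (z ^ 3 - z) - 2 * (conj z) ^ 2
        + ε * ((conj z) ^ 3 - conj z) : ℂ) = ((8 * z.im ^ 2 * (1 - ε * z.re) : ℝ) : ℂ) := by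
      have hn : z.re ^ 2 + z.im ^ 2 = 1 := by
        have := congrArg Complex.re hzw
        simp [Complex.mul_re] at this
        nlinarith
      apply Complex.ext
      · simp [pow_succ]
        linear_combination (2 * ε * z.re - 4) * hn
      · simp [pow_succ]; ring
    have key : P z = g z * ((8 * z.im ^ 2 * (1 - ε * z.re) : ℝ) : ℂ)
        + (-2) * (conj b₀ * z ^ 2 - b₀ * (conj z) ^ 2 + (conj b₁ * z - b₁ * conj z))
        + ε * (conj b₀ * z ^ 3 - b₀ * (conj z) ^ 3 + (conj b₁ * z ^ 2 - b₁ * (conj z) ^ 2)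
          + (conj b₂ * z - b₂ * conj z) - (conj b₀ * z - b₀ * conj z)) := by
      rw [← hT, hg, hw]
      simp only [hP]
      field_simp
      ring
    have hcz : ∀ (c : ℂ) (j : ℕ), (conj c * z ^ j - c * (conj z) ^ j).re = 0 := by
      intro c j
      have : c * (conj z) ^ j = conj (conj c * z ^ j) := by simp
      rw [this, Complex.sub_re, Complex.conj_re, sub_self]
    have e1 := hcz b₀ 1
    have e2 := hcz b₀ 2
    have e3 := hcz b₀ 3
    have e4 := hcz b₁ 1
    have e5 := hcz b₁ 2
    have e6 := hcz b₂ 1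
    rw [pow_one, pow_one] at e1 e4 e6
    rw [key, show (-2 : ℂ) = ((-2 : ℝ) : ℂ) by simp, Complex.add_re, Complex.add_re,
      Complex.re_mul_ofReal, Complex.re_ofReal_mul, Complex.re_ofReal_mul]
    rw [Complex.add_re (_ - _), Complex.sub_re (_ + _), Complex.add_re (_ + _),
      Complex.add_re (_ - _), e1, e2, e3, e4, e5, e6]
    have hzre : |z.re| ≤ 1 := hz ▸ Complex.abs_re_le_norm z
    have h1 : ε * z.re ≤ 1 := by
      calc ε * z.re ≤ |ε * z.re| := le_abs_self _
        _ = |ε| * |z.re| := abs_mul _ _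
        _ ≤ 1 := mul_le_one₀ hε (abs_nonneg _) hzre
    have := hre z hz
    have h2 : 0 ≤ 8 * z.im ^ 2 * (1 - ε * z.re) := by
      have : 0 ≤ 1 - ε * z.re := by linarith
      positivity
    nlinarith [mul_nonneg (hre z hz) h2]

lemma abs_taylor_coeff_le {Q H : ℂ → ℂ} {a₀ a₁ a₂ a₃ : ℂ}
    (hH : DifferentiableOn ℂ H (Metric.ball 0 1))
    (hQ : ∀ z, Q z = a₀ + a₁ * z + a₂ * z ^ 2 + a₃ * z ^ 3 + z ^ 4 * H z)
    (hre : ∀ z ∈ Metric.ball (0 : ℂ) 1, 0 ≤ (Q z).re) :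
    |a₃.re - a₁.re| ≤ 4 * a₀.re - 2 * a₂.re := by
  have key : ∀ ε : ℝ, |ε| ≤ 1 → 0 ≤ 4 * a₀.re - 2 * a₂.re + ε * (a₃.re - a₁.re) := by
    intro ε hε
    have hr : ∀ r ∈ Ioo (0 : ℝ) 1, 0 ≤ 4 * a₀.re - 2 * (r ^ 2 * a₂.re)
        + ε * (r ^ 3 * a₃.re - r * a₁.re) := by
      intro r hr
      have hmaps : ∀ z ∈ Metric.ball (0 : ℂ) (1 / r), (r : ℂ) * z ∈ Metric.ball (0 : ℂ) 1 := by
        intro z hz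
        rw [mem_ball_zero_iff] at hz ⊢
        rw [norm_mul, Complex.norm_real, Real.norm_of_nonneg hr.1.le]
        rwa [lt_div_iff₀ hr.1, mul_comm] at hz
      have h1r : 1 < 1 / r := by rw [lt_div_iff₀ hr.1]; linarith [hr.2]
      have := taylor_coeff_nonneg_of_re_sphere_nonneg (g := fun z => Q (r * z))
        (h := fun z => (r : ℂ) ^ 4 * H (r * z)) (b₀ := a₀) (b₁ := (r : ℂ) * a₁)
        (b₂ := ((r ^ 2 : ℝ) : ℂ) * a₂) (b₃ := ((r ^ 3 : ℝ) : ℂ) * a₃)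
        (U := Metric.ball 0 (1 / r))
        (Metric.closedBall_subset_ball h1r)
        ((hH.comp (by fun_prop) hmaps).const_mul _)
        (fun z => by rw [hQ]; push_cast; ring)
        (fun z hz => hre _ (hmaps z (by rw [mem_ball_zero_iff, hz]; exact h1r))) hε
      rw [show (4 : ℂ) = ((4 : ℝ) : ℂ) by simp, show (2 : ℂ) = ((2 : ℝ) : ℂ) by simp,
        Complex.add_re, Complex.sub_re, Complex.re_ofReal_mul, Complex.re_ofReal_mul,
        Complex.re_ofReal_mul, Complex.re_ofReal_mul, Complex.sub_re, Complex.re_ofReal_mul,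
        Complex.re_ofReal_mul] at this
      exact this
    have hc : Continuous fun r : ℝ => 4 * a₀.re - 2 * (r ^ 2 * a₂.re)
        + ε * (r ^ 3 * a₃.re - r * a₁.re) := by fun_prop
    have hlim := (hc.tendsto 1).mono_left (nhdsWithin_le_nhds (s := Iio 1))
    have h0 := ge_of_tendsto hlim (b := 0) (by
      filter_upwards [Ioo_mem_nhdsLT (zero_lt_one' ℝ)] with r h using hr r h)
    simpa using h0
  have h1 := key 1 (by simp)
  have h2 := key (-1) (by simp)
  rw [abs_le]
  constructor <;> linarith

lemma iteratedDeriv_of_eventuallyEq_taylor {F R : ℝ → ℝ} {c₀ c₁ c₂ c₃ : ℝ}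
    (hR : ContDiffAt ℝ 3 R 0)
    (h : F =ᶠ[𝓝 0] fun t => c₀ + c₁ * t ^ 1 + c₂ * t ^ 2 + c₃ * t ^ 3 + t ^ 4 * R t) :
    iteratedDeriv 2 F 0 = 2 * c₂ ∧ iteratedDeriv 3 F 0 = 6 * c₃ := by
  have hR2 : ContDiffAt ℝ 2 R 0 := hR.of_le (by norm_num)
  constructor
  · rw [h.iteratedDeriv_eq]
    rw [iteratedDeriv_fun_add (by fun_prop) (by fun_prop),
      iteratedDeriv_fun_add (by fun_prop) (by fun_prop),
      iteratedDeriv_fun_add (by fun_prop) (by fun_prop),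
      iteratedDeriv_fun_add (by fun_prop) (by fun_prop), iteratedDeriv_const,
      iteratedDeriv_const_mul_field, iteratedDeriv_const_mul_field, iteratedDeriv_const_mul_field,
      iteratedDeriv_fun_mul (by fun_prop) hR2]
    simp only [iteratedDeriv_fun_pow_zero]
    simp [Nat.factorial]
    ring
  · rw [h.iteratedDeriv_eq]
    rw [iteratedDeriv_fun_add (by fun_prop) (by fun_prop),
      iteratedDeriv_fun_add (by fun_prop) (by fun_prop),
      iteratedDeriv_fun_add (by fun_prop) (by fun_prop),
      iteratedDeriv_fun_add (by fun_prop) (by fun_prop), iteratedDeriv_const,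
      iteratedDeriv_const_mul_field, iteratedDeriv_const_mul_field, iteratedDeriv_const_mul_field,
      iteratedDeriv_fun_mul (by fun_prop) hR]
    simp only [iteratedDeriv_fun_pow_zero]
    simp [Nat.factorial]
    ring

lemma contDiffAt_and_abs_iteratedDeriv_three_le {Q : ℂ → ℂ} {F : ℝ → ℝ}
    (hQ : DifferentiableOn ℂ Q (Metric.ball 0 1))
    (hre : ∀ w ∈ Metric.ball (0 : ℂ) 1, 0 ≤ (Q w).re)
    (hF : ∀ t : ℝ, |t| < 1 →
      F t = Real.sqrt (1 - t ^ 2) * (Q ((t / (1 + Real.sqrt (1 - t ^ 2)) : ℝ) : ℂ)).re) :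
    ContDiffAt ℝ 3 F 0 ∧ |iteratedDeriv 3 F 0| ≤ -3 * iteratedDeriv 2 F 0 := by
  obtain ⟨a₀, a₁, a₂, a₃, H, hH, hT⟩ := exists_taylor_three hQ
  have habs := abs_taylor_coeff_le hH hT hre
  set s : ℝ → ℝ := fun t => Real.sqrt (1 - t ^ 2) with hs
  set κ : ℝ → ℝ := fun t => 1 / (1 + s t) with hκ
  have hs0 : s 0 = 1 := by simp [hs]
  have hsd : ContDiffAt ℝ 3 s 0 := by
    refine ContDiffAt.sqrt (by fun_prop) (by simp)
  have hκd : ContDiffAt ℝ 3 κ 0 := by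
    refine ContDiffAt.div contDiffAt_const (by fun_prop) (by rw [hs0]; norm_num)
  have hHd : ContDiffAt ℝ 3 (fun t : ℝ => (H ((t * κ t : ℝ) : ℂ)).re) 0 := by
    have h0 : ContDiffAt ℂ 3 H ((0 * κ 0 : ℝ) : ℂ) := by
      rw [zero_mul, Complex.ofReal_zero]
      exact (hH.analyticAt (Metric.ball_mem_nhds 0 one_pos)).contDiffAt
    have h1 : ContDiffAt ℝ 3 (fun t : ℝ => ((t * κ t : ℝ) : ℂ)) 0 :=
      Complex.ofRealCLM.contDiff.contDiffAt.comp (0 : ℝ) (contDiffAt_id.mul hκd)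
    have h2 : ContDiffAt ℝ 3 (fun t : ℝ => H ((t * κ t : ℝ) : ℂ)) 0 :=
      ContDiffAt.comp (0 : ℝ) (f := fun t : ℝ => ((t * κ t : ℝ) : ℂ)) (g := H)
        (h0.restrict_scalars ℝ) h1
    exact Complex.reCLM.contDiff.contDiffAt.comp (0 : ℝ) h2
  set R : ℝ → ℝ := fun t => -a₀.re * κ t ^ 2 / 2 - a₁.re * t * (κ t ^ 2 / 4 + t ^ 2 * κ t ^ 4 / 8)
    - a₂.re * t ^ 2 * κ t ^ 4 / 4 + a₃.re * t * (κ t ^ 2 / 8 - t ^ 2 * κ t ^ 5 / 4)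
    + s t * κ t ^ 4 * (H ((t * κ t : ℝ) : ℂ)).re with hR
  have hRd : ContDiffAt ℝ 3 R 0 := by
    simp only [hR]; fun_prop
  have hFe : F =ᶠ[𝓝 0] fun t => a₀.re + a₁.re / 2 * t ^ 1 + (-a₀.re / 2 + a₂.re / 4) * t ^ 2
      + (-a₁.re / 8 + a₃.re / 8) * t ^ 3 + t ^ 4 * R t := by
    filter_upwards [Metric.ball_mem_nhds (0 : ℝ) one_pos] with t ht
    have ht : |t| < 1 := by simpa using ht
    obtain ⟨h1, h2⟩ := abs_lt.1 ht
    have hnn : 0 < 1 - t ^ 2 := by nlinarith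
    have hss : s t * s t = 1 - t ^ 2 := Real.mul_self_sqrt hnn.le
    have hsp : 0 < s t := Real.sqrt_pos.2 hnn
    have k1 : κ t * (1 + s t) = 1 := by
      simp only [hκ]; field_simp
    rw [hF t ht, show t / (1 + Real.sqrt (1 - t ^ 2)) = t * κ t by simp [hκ, hs, div_eq_mul_inv],
      hT]
    have hQre : (a₀ + a₁ * ((t * κ t : ℝ) : ℂ) + a₂ * ((t * κ t : ℝ) : ℂ) ^ 2
        + a₃ * ((t * κ t : ℝ) : ℂ) ^ 3 + ((t * κ t : ℝ) : ℂ) ^ 4 * H ((t * κ t : ℝ) : ℂ)).re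
        = a₀.re + a₁.re * (t * κ t) + a₂.re * (t * κ t) ^ 2 + a₃.re * (t * κ t) ^ 3
          + (t * κ t) ^ 4 * (H ((t * κ t : ℝ) : ℂ)).re := by
      rw [← Complex.ofReal_pow, ← Complex.ofReal_pow, ← Complex.ofReal_pow]
      simp only [Complex.add_re, Complex.re_mul_ofReal, Complex.re_ofReal_mul]
    rw [hQre]
    change s t * _ = _
    simp only [hR]
    clear hQre
    generalize (H ((t * κ t : ℝ) : ℂ)).re = y
    generalize κ t = K at *
    generalize s t = σ at *
    have k3 : σ * K = 1 - K := by linear_combination k1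
    have k4 : σ = 1 - t ^ 2 * K := by linear_combination (1 - σ) * k1 + K * hss
    have k2 : t ^ 2 * K ^ 2 = 2 * K - 1 := by linear_combination K * k4 - k3
    have m2 : K ^ 2 = 1 / 4 + t ^ 2 * K ^ 2 / 2 + t ^ 4 * K ^ 4 / 4 := by
      linear_combination (-(2 * K + 1 + t ^ 2 * K ^ 2) / 4) * k2
    have m1 : K - K ^ 2 = 1 / 4 - t ^ 4 * K ^ 4 / 4 := by
      linear_combination (-1 / 2) * k2 - m2
    have e0 : σ = 1 - t ^ 2 / 2 - t ^ 4 * K ^ 2 / 2 := by linear_combination k4 + t ^ 2 / 2 * k2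
    have e1 : σ * K = 1 / 2 - t ^ 2 / 8 - t ^ 4 * (K ^ 2 / 4 + t ^ 2 * K ^ 4 / 8) := by
      linear_combination k3 + k2 / 2 - t ^ 2 / 2 * m2
    have e2 : σ * K ^ 2 = 1 / 4 - t ^ 4 * K ^ 4 / 4 := by linear_combination K * k3 + m1
    have e3 : σ * K ^ 3 = 1 / 8 + t ^ 2 * K ^ 2 / 8 - t ^ 4 * K ^ 5 / 4 := by
      linear_combination K * e2 - k2 / 8
    linear_combination a₀.re * e0 + a₁.re * t * e1 + a₂.re * t ^ 2 * e2 + a₃.re * t ^ 3 * e3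
  obtain ⟨e2, e3⟩ := iteratedDeriv_of_eventuallyEq_taylor hRd hFe
  refine ⟨ContDiffAt.congr_of_eventuallyEq (by fun_prop) hFe, ?_⟩
  rw [e2, e3, show 6 * (-a₁.re / 8 + a₃.re / 8) = 3 / 4 * (a₃.re - a₁.re) by ring, abs_mul,
    abs_of_pos (by norm_num : (0 : ℝ) < 3 / 4)]
  linarith

lemma iteratedDeriv_comp_mul_left (f : ℝ → ℝ) (c : ℝ) (n : ℕ) :
    iteratedDeriv n (fun t => f (c * t)) = fun t => c ^ n * iteratedDeriv n f (c * t) := by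
  induction n with
  | zero => simp
  | succ n ih =>
    rw [iteratedDeriv_succ, ih]
    funext t
    rw [deriv_const_mul_field, deriv_comp_mul_left c (iteratedDeriv n f) t, iteratedDeriv_succ,
      smul_eq_mul, pow_succ, mul_assoc]

lemma ContDiffAt.neg_log_derivs {Y : ℝ → ℝ} (hY : ContDiffAt ℝ 3 Y 0) (h0 : 0 < Y 0) :
    ContDiffAt ℝ 3 (fun t => -Real.log (Y t)) 0 ∧
    deriv (fun t => -Real.log (Y t)) 0 = -(deriv Y 0 / Y 0) ∧
    iteratedDeriv 2 (fun t => -Real.log (Y t)) 0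
      = -(iteratedDeriv 2 Y 0 / Y 0) + (deriv Y 0 / Y 0) ^ 2 ∧
    iteratedDeriv 3 (fun t => -Real.log (Y t)) 0
      = -(iteratedDeriv 3 Y 0 / Y 0) + 3 * (iteratedDeriv 2 Y 0 / Y 0) * (deriv Y 0 / Y 0)
        - 2 * (deriv Y 0 / Y 0) ^ 3 := by
  have hY1 : ∀ᶠ t in 𝓝 (0 : ℝ), ContDiffAt ℝ 3 Y t := hY.eventually (by simp)
  have hpos : ∀ᶠ t in 𝓝 (0 : ℝ), 0 < Y t := hY.continuousAt.eventually_const_lt h0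
  have cY' : ∀ {t}, ContDiffAt ℝ 3 Y t → ContDiffAt ℝ 2 (deriv Y) t := fun h =>
    ContDiffAt.derivWithin h (by norm_num)
  have cY'' : ∀ {t}, ContDiffAt ℝ 3 Y t → ContDiffAt ℝ 1 (iteratedDeriv 2 Y) t := fun h => by
    rw [iteratedDeriv_succ, iteratedDeriv_one]
    exact ContDiffAt.derivWithin (cY' h) (by norm_num)
  have dY : ∀ {t}, ContDiffAt ℝ 3 Y t → HasDerivAt Y (deriv Y t) t := fun h =>
    (h.differentiableAt (by norm_num)).hasDerivAt
  have dY' : ∀ {t}, ContDiffAt ℝ 3 Y t → HasDerivAt (deriv Y) (iteratedDeriv 2 Y t) t := fun h => by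
    rw [iteratedDeriv_succ, iteratedDeriv_one]
    exact ((cY' h).differentiableAt (by norm_num)).hasDerivAt
  have dY'' : ∀ {t}, ContDiffAt ℝ 3 Y t →
      HasDerivAt (iteratedDeriv 2 Y) (iteratedDeriv 3 Y t) t := fun h => by
    rw [iteratedDeriv_succ (n := 2)]
    exact ((cY'' h).differentiableAt (by norm_num)).hasDerivAt
  have e1 : deriv (fun t => -Real.log (Y t)) =ᶠ[𝓝 0] fun t => -(deriv Y t / Y t) := by
    filter_upwards [hY1, hpos] with t h1 h2
    exact ((dY h1).log h2.ne').neg.deriv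
  have e2 : iteratedDeriv 2 (fun t => -Real.log (Y t)) =ᶠ[𝓝 0]
      fun t => -(iteratedDeriv 2 Y t / Y t) + (deriv Y t / Y t) ^ 2 := by
    rw [iteratedDeriv_succ, iteratedDeriv_one]
    refine e1.deriv.trans ?_
    filter_upwards [hY1, hpos] with t h1 h2
    rw [((dY' h1).fun_div (dY h1) h2.ne').fun_neg.deriv]
    field_simp
    ring
  refine ⟨(hY.log h0.ne').neg, e1.eq_of_nhds, e2.eq_of_nhds, ?_⟩
  rw [iteratedDeriv_succ (n := 2), e2.deriv_eq,
    (((dY'' hY).fun_div (dY hY) h0.ne').fun_neg.fun_add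
      (((dY' hY).fun_div (dY hY) h0.ne').fun_pow 2)).deriv]
  have hne := h0.ne'
  simp only [Nat.cast_ofNat, Nat.reduceSub, pow_one]
  field_simp
  ring

/-- The scalar inequality behind the self-concordance of a sum of two logarithms. -/
lemma add_mul_sub_sq_le_two_mul_rpow {c s : ℝ} (hc : 0 ≤ c) (hs : 0 ≤ s) :
    s * (3 * c - s ^ 2) ≤ 2 * c ^ (3 / 2 : ℝ) := by
  have h : c ^ (3 / 2 : ℝ) = Real.sqrt c ^ 3 := by
    rw [Real.sqrt_eq_rpow, ← Real.rpow_natCast, ← Real.rpow_mul hc]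
    norm_num
  rw [h]
  obtain ⟨r, hr, hrc⟩ : ∃ r, 0 ≤ r ∧ r ^ 2 = c := ⟨_, Real.sqrt_nonneg c, Real.sq_sqrt hc⟩
  rw [← hrc, Real.sqrt_sq hr]
  nlinarith [mul_nonneg (sq_nonneg (r - s)) (by positivity : 0 ≤ 2 * r + s)]

lemma convexOn_of_forall_line {V : Type*} [AddCommGroup V] [Module ℝ V] {D : Set V} {f : V → ℝ}
    (hD : Convex ℝ D)
    (hd : ∀ x ∈ D, ∀ h : V, ContDiffAt ℝ 3 (fun t : ℝ => f (x + t • h)) 0)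
    (h2 : ∀ x ∈ D, ∀ h : V, 0 ≤ iteratedDeriv 2 (fun t : ℝ => f (x + t • h)) 0) :
    ConvexOn ℝ D f := by
  refine ⟨hD, fun x hx y hy a b ha hb hab => ?_⟩
  set φ : ℝ → ℝ := fun t => f (x + t • (y - x)) with hφ
  have hmem : ∀ t ∈ Icc (0 : ℝ) 1, x + t • (y - x) ∈ D := fun t ht =>
    hD.add_smul_sub_mem hx hy ht
  have hshift : ∀ t : ℝ, (fun τ : ℝ => f (x + t • (y - x) + τ • (y - x))) = fun τ => φ (τ + t) := by
    intro t
    funext τ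
    simp only [hφ, add_smul]
    congr 1
    abel
  have hcd : ∀ t ∈ Icc (0 : ℝ) 1, ContDiffAt ℝ 3 φ t := by
    intro t ht
    have h := hd _ (hmem t ht) (y - x)
    rw [hshift] at h
    have h' : ContDiffAt ℝ 3 (fun τ => φ (τ + t)) (t - t) := by rwa [sub_self]
    have := h'.comp t (f := fun τ => τ - t) (by fun_prop)
    simpa [Function.comp_def] using this
  have hnn : ∀ t ∈ Icc (0 : ℝ) 1, 0 ≤ deriv^[2] φ t := by
    intro t ht
    have h := h2 _ (hmem t ht) (y - x)
    rw [hshift, iteratedDeriv_comp_add_const] at h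
    rw [← iteratedDeriv_eq_iterate]
    simpa using h
  have hconv : ConvexOn ℝ (Icc (0 : ℝ) 1) φ := by
    refine convexOn_of_deriv2_nonneg' (convex_Icc 0 1)
      (fun t ht => ((hcd t ht).differentiableAt (by norm_num)).differentiableWithinAt)
      (fun t ht => ?_) hnn
    have : ContDiffAt ℝ 2 (deriv φ) t := ContDiffAt.derivWithin (hcd t ht) (by norm_num)
    exact (this.differentiableAt (by norm_num)).differentiableWithinAt
  have := hconv.2 (x := 0) (by simp) (y := 1) (by simp) ha hb hab
  have e : a • x + b • y = x + b • (y - x) := by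
    rw [eq_sub_of_add_eq hab, sub_smul, smul_sub, one_smul]
    abel
  rw [e]
  simpa [hφ] using this

lemma neg_log_const_mul_prod_derivs {ι : Type*} [Fintype ι] (x : ι → ℝ) {c : ℝ} (hc : 0 < c) :
    ContDiffAt ℝ 3 (fun t => -Real.log (c * ∏ i, (1 + t * x i))) 0 ∧
    deriv (fun t => -Real.log (c * ∏ i, (1 + t * x i))) 0 = -∑ i, x i ∧
    iteratedDeriv 2 (fun t => -Real.log (c * ∏ i, (1 + t * x i))) 0 = ∑ i, x i ^ 2 ∧
    iteratedDeriv 3 (fun t => -Real.log (c * ∏ i, (1 + t * x i))) 0 = -2 * ∑ i, x i ^ 3 := by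
  have hev : (fun t => -Real.log (c * ∏ i, (1 + t * x i)))
      =ᶠ[𝓝 0] fun t => -Real.log c + ∑ i, -Real.log (1 + t * x i) := by
    have : ∀ᶠ t in 𝓝 (0 : ℝ), ∀ i, 0 < 1 + t * x i := by
      rw [eventually_all]
      intro i
      exact (by fun_prop : Continuous fun t : ℝ => 1 + t * x i).continuousAt.eventually_const_lt
        (by simp)
    filter_upwards [this] with t ht
    rw [Real.log_mul hc.ne' (Finset.prod_pos fun i _ => ht i).ne',
      Real.log_prod fun i _ => (ht i).ne', Finset.sum_neg_distrib, neg_add]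
  have hd : ∀ i, ContDiffAt ℝ 3 (fun t : ℝ => 1 + t * x i) 0 := fun i => by fun_prop
  have hlin : ∀ i, deriv (fun t : ℝ => 1 + t * x i) = fun _ => x i := by
    intro i; funext t; simp
  have hlin2 : ∀ i, iteratedDeriv 2 (fun t : ℝ => 1 + t * x i) 0 = 0 := by
    intro i; rw [iteratedDeriv_succ', hlin, iteratedDeriv_const]; simp
  have hlin3 : ∀ i, iteratedDeriv 3 (fun t : ℝ => 1 + t * x i) 0 = 0 := by
    intro i; rw [iteratedDeriv_succ', hlin, iteratedDeriv_const]; simp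
  have key := fun i => (hd i).neg_log_derivs (by simp)
  simp only [hlin, hlin2, hlin3, zero_mul, add_zero, div_one, neg_zero, zero_add,
    mul_zero, zero_sub] at key
  have hsum : ContDiffAt ℝ 3 (fun t => ∑ i, -Real.log (1 + t * x i)) 0 :=
    ContDiffAt.sum fun i _ => (key i).1
  refine ⟨ContDiffAt.congr_of_eventuallyEq (contDiffAt_const.add hsum) hev, ?_, ?_, ?_⟩
  · rw [hev.deriv_eq, deriv_const_add, deriv_fun_sum fun i _ =>
      (key i).1.differentiableAt (by norm_num), Finset.sum_congr rfl fun i _ => (key i).2.1]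
    simp
  · rw [hev.iteratedDeriv_eq, iteratedDeriv_const_add (by norm_num), iteratedDeriv_fun_sum
      fun i _ => (key i).1.of_le (by norm_num), Finset.sum_congr rfl fun i _ => (key i).2.2.1]
  · rw [hev.iteratedDeriv_eq, iteratedDeriv_const_add (by norm_num), iteratedDeriv_fun_sum
      fun i _ => (key i).1, Finset.sum_congr rfl fun i _ => (key i).2.2.2, Finset.mul_sum]
    simp

lemma neg_add_neg_sq_le {a b n σ X : ℝ} (hn : 0 ≤ n) (hb : 0 ≤ b) (hσ : σ ^ 2 ≤ n * X ^ 2) :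
    (-a + -σ) ^ 2 ≤ (1 + n) * (b + a ^ 2 + X ^ 2) := by
  have hmid : 2 * a * σ ≤ n * a ^ 2 + X ^ 2 := by
    rcases hn.eq_or_lt with h | h
    · have hσ0 : σ = 0 := by
        rw [← h, zero_mul] at hσ
        exact pow_eq_zero_iff two_ne_zero |>.1 (le_antisymm hσ (sq_nonneg σ))
      rw [hσ0, mul_zero]
      positivity
    · refine le_of_mul_le_mul_left ?_ h
      have : (n * a - σ) ^ 2 = n * (n * a ^ 2) - n * (2 * a * σ) + σ ^ 2 := by ring
      linarith [sq_nonneg (n * a - σ)]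
  have hnb : 0 ≤ n * b := mul_nonneg hn hb
  have e : (1 + n) * (b + a ^ 2 + X ^ 2) - (-a + -σ) ^ 2
    = b + n * b + (n * a ^ 2 + X ^ 2 - 2 * a * σ) + (n * X ^ 2 - σ ^ 2) := by ring
  linarith

lemma neg_log_sub_sub_log_prod_derivs {ι : Type*} [Fintype ι] {F : ℝ → ℝ}
    (hF : ContDiffAt ℝ 3 F 0) {u v : ℝ} (hu : u < F 0) (x : ι → ℝ) {c : ℝ} (hc : 0 < c)
    (hN : ∀ N > 0, (∀ i, |x i| < N) → |iteratedDeriv 3 F 0| ≤ -3 * N * iteratedDeriv 2 F 0)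
    {g : ℝ → ℝ}
    (hg : g = fun t => -Real.log (F t - (u + t * v)) - Real.log (c * ∏ i, (1 + t * x i))) :
    ContDiffAt ℝ 3 g 0 ∧ 0 ≤ iteratedDeriv 2 g 0 ∧
    |iteratedDeriv 3 g 0| ≤ 2 * iteratedDeriv 2 g 0 ^ (3 / 2 : ℝ) ∧
    deriv g 0 ^ 2 ≤ (1 + Fintype.card ι) * iteratedDeriv 2 g 0 := by
  obtain ⟨l0, l1, l2, l3⟩ := neg_log_const_mul_prod_derivs x hc
  set Y : ℝ → ℝ := fun t => F t - (u + t * v) with hY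
  have hYd : ContDiffAt ℝ 3 Y 0 := by simp only [hY]; fun_prop
  have hY0 : 0 < Y 0 := by simp only [hY]; linarith
  have hlin : deriv (fun t : ℝ => u + t * v) = fun _ => v := by funext t; simp
  have hY2 : iteratedDeriv 2 Y 0 = iteratedDeriv 2 F 0 := by
    rw [hY, iteratedDeriv_fun_sub (hF.of_le (by norm_num)) (by fun_prop),
      iteratedDeriv_succ' (f := fun t : ℝ => u + t * v), hlin, iteratedDeriv_const]
    simp
  have hY3 : iteratedDeriv 3 Y 0 = iteratedDeriv 3 F 0 := by
    rw [hY, iteratedDeriv_fun_sub hF (by fun_prop),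
      iteratedDeriv_succ' (f := fun t : ℝ => u + t * v), hlin, iteratedDeriv_const]
    simp
  obtain ⟨k0, k1, k2, k3⟩ := hYd.neg_log_derivs hY0
  have hg' : g = fun t => -Real.log (Y t) + -Real.log (c * ∏ i, (1 + t * x i)) := by
    rw [hg]; funext t; ring
  have g1 : deriv g 0 = -(deriv Y 0 / Y 0) + -∑ i, x i := by
    rw [hg', deriv_fun_add (k0.differentiableAt (by norm_num)) (l0.differentiableAt (by norm_num)),
      k1, l1]
  have g2 : iteratedDeriv 2 g 0 = -(iteratedDeriv 2 F 0 / Y 0) + (deriv Y 0 / Y 0) ^ 2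
      + ∑ i, x i ^ 2 := by
    rw [hg', iteratedDeriv_fun_add (k0.of_le (by norm_num)) (l0.of_le (by norm_num)), k2, l2, hY2]
  have g3 : iteratedDeriv 3 g 0 = -(iteratedDeriv 3 F 0 / Y 0)
      + 3 * (iteratedDeriv 2 F 0 / Y 0) * (deriv Y 0 / Y 0) - 2 * (deriv Y 0 / Y 0) ^ 3
      + -2 * ∑ i, x i ^ 3 := by
    rw [hg', iteratedDeriv_fun_add k0 l0, k3, l3, hY2, hY3]
  set a := deriv Y 0 / Y 0
  set X := Real.sqrt (∑ i, x i ^ 2) with hX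
  have hS : 0 ≤ ∑ i, x i ^ 2 := Finset.sum_nonneg fun i _ => sq_nonneg _
  have hX0 : 0 ≤ X := Real.sqrt_nonneg _
  have hXX : X ^ 2 = ∑ i, x i ^ 2 := Real.sq_sqrt hS
  have hxX : ∀ i, |x i| ≤ X := fun i => Real.abs_le_sqrt
    (Finset.single_le_sum (f := fun i => x i ^ 2) (fun i _ => sq_nonneg _) (Finset.mem_univ i))
  have hbound : |iteratedDeriv 3 F 0| ≤ -3 * X * iteratedDeriv 2 F 0 := by
    have hlim : Tendsto (fun N : ℝ => -3 * N * iteratedDeriv 2 F 0) (𝓝[>] X)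
        (𝓝 (-3 * X * iteratedDeriv 2 F 0)) :=
      ((by fun_prop : Continuous fun N : ℝ => -3 * N * iteratedDeriv 2 F 0).tendsto X).mono_left
        nhdsWithin_le_nhds
    refine ge_of_tendsto hlim ?_
    filter_upwards [self_mem_nhdsWithin] with N (hXN : X < N)
    exact hN N (hX0.trans_lt hXN) fun i => (hxX i).trans_lt hXN
  have hF2 : iteratedDeriv 2 F 0 ≤ 0 := by
    have h1 : 0 < X + 1 := by linarith
    have := (abs_nonneg _).trans (hN (X + 1) h1 fun i => (hxX i).trans_lt (lt_add_one X))
    nlinarith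
  obtain ⟨b, hb⟩ : ∃ b, b = -(iteratedDeriv 2 F 0 / Y 0) := ⟨_, rfl⟩
  have hb0 : 0 ≤ b := by
    rw [hb, ← neg_div]; exact div_nonneg (by linarith) hY0.le
  have hd3 : |iteratedDeriv 3 F 0 / Y 0| ≤ 3 * X * b := by
    rw [abs_div, abs_of_pos hY0, div_le_iff₀ hY0, hb]
    have : 3 * X * -(iteratedDeriv 2 F 0 / Y 0) * Y 0 = -3 * X * iteratedDeriv 2 F 0 := by
      field_simp
    rwa [this]
  have hcube : |∑ i, x i ^ 3| ≤ X ^ 3 := by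
    calc |∑ i, x i ^ 3| ≤ ∑ i, |x i ^ 3| := Finset.abs_sum_le_sum_abs _ _
      _ ≤ ∑ i, X * x i ^ 2 := Finset.sum_le_sum fun i _ => by
        rw [pow_succ', abs_mul, abs_of_nonneg (sq_nonneg (x i))]
        exact mul_le_mul_of_nonneg_right (hxX i) (sq_nonneg _)
      _ = X ^ 3 := by rw [← Finset.mul_sum, ← hXX]; ring
  have hg2 : iteratedDeriv 2 g 0 = b + a ^ 2 + X ^ 2 := by rw [g2, ← hb, hXX]
  refine ⟨by rw [hg']; exact k0.add l0, by rw [hg2]; positivity, ?_, ?_⟩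
  · have h3 : iteratedDeriv 3 g 0 = -(iteratedDeriv 3 F 0 / Y 0) - 3 * b * a - 2 * a ^ 3
        - 2 * ∑ i, x i ^ 3 := by rw [g3, hb]; ring
    have hle : |iteratedDeriv 3 g 0| ≤ 3 * X * b + 3 * b * |a| + 2 * |a| ^ 3 + 2 * X ^ 3 := by
      have e1 : |3 * b * a| = 3 * b * |a| := by
        rw [abs_mul, abs_of_nonneg (by positivity)]
      have e2 : |2 * a ^ 3| = 2 * |a| ^ 3 := by rw [abs_mul, abs_pow]; norm_num
      rw [h3]
      calc _ ≤ |iteratedDeriv 3 F 0 / Y 0| + |3 * b * a| + |2 * a ^ 3| + |2 * ∑ i, x i ^ 3| := by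
            refine (abs_sub _ _).trans (add_le_add_left ((abs_sub _ _).trans
              (add_le_add_left ((abs_sub _ _).trans (add_le_add_left ?_ _)) _)) _)
            rw [abs_neg]
        _ ≤ _ := by
            rw [e1, e2, abs_mul, abs_two]
            linarith
    refine hle.trans ?_
    rw [hg2]
    have := add_mul_sub_sq_le_two_mul_rpow (c := b + a ^ 2 + X ^ 2) (s := |a| + X)
      (by positivity) (by positivity)
    refine le_trans (le_of_eq ?_) this
    rw [← sq_abs a]
    ring
  · rw [g1, hg2]
    have hcs : (∑ i, x i) ^ 2 ≤ Fintype.card ι * X ^ 2 := by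
      rw [hXX]
      simpa using sq_sum_le_card_mul_sum_sq (s := Finset.univ) (f := x)
    exact neg_add_neg_sq_le (Nat.cast_nonneg _) hb0 hcs

/-- Simultaneous diagonalization of a positive definite and a Hermitian matrix, read off on the
line they span. -/
lemma Matrix.PosDef.exists_det_line {n : Type*} [Fintype n] [DecidableEq n] {ρ h : Matrix n n ℂ}
    (hρ : ρ.PosDef) (hh : h.IsHermitian) :
    ∃ x : n → ℝ, (∀ t : ℝ, (ρ + (t : ℂ) • h).det.re = ρ.det.re * ∏ i, (1 + t * x i)) ∧
      ∀ t : ℝ, (∀ i, 0 < 1 + t * x i) → (ρ + (t : ℂ) • h).PosDef := by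
  set A := cfc (fun x : ℝ => x ^ (1 / 2 : ℝ)) ρ with hA
  have hApd : A.PosDef := hρ.cfc_rpow _
  have hAA : A * A = ρ := hρ.cfc_rpow_half_mul_self
  have hAu : IsUnit A := hApd.isUnit
  have hAd : IsUnit A.det := (Matrix.isUnit_iff_isUnit_det A).1 hAu
  set M := A⁻¹ * h * A⁻¹ with hM
  have hMh : M.IsHermitian := by
    have := Matrix.isHermitian_conjTranspose_mul_mul (A⁻¹) hh
    rwa [hApd.isHermitian.inv.eq] at this
  have hline : ∀ t : ℝ, ρ + (t : ℂ) • h = A * ((1 : ℂ) • 1 + (t : ℂ) • M) * A := by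
    intro t
    have : A * M * A = h := by
      rw [hM, Matrix.mul_assoc A⁻¹, ← Matrix.mul_assoc A, Matrix.mul_nonsing_inv A hAd, one_mul,
        Matrix.mul_assoc, Matrix.nonsing_inv_mul A hAd, mul_one]
    rw [one_smul, mul_add, mul_one, add_mul, hAA, Matrix.mul_smul, Matrix.smul_mul, this]
  refine ⟨hMh.eigenvalues, fun t => ?_, fun t ht => ?_⟩
  · rw [hline, Matrix.det_mul, Matrix.det_mul, mul_right_comm, ← Matrix.det_mul, hAA,
      Matrix.det_smul_one_add_smul, hMh.roots_charpoly_eq_eigenvalues, Multiset.map_map]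
    have : (Multiset.map ((fun y => (1 : ℂ) + t * y) ∘ (RCLike.ofReal ∘ hMh.eigenvalues))
        Finset.univ.val).prod = ((∏ i, (1 + t * hMh.eigenvalues i) : ℝ) : ℂ) := by
      push_cast
      rfl
    rw [this, Complex.re_mul_ofReal]
  · have h1 : ((1 : ℂ) • (1 : Matrix n n ℂ) + (t : ℂ) • M).PosDef := by
      have e : (1 : ℂ) • (1 : Matrix n n ℂ) + (t : ℂ) • M
          = (hMh.eigenvectorUnitary : Matrix n n ℂ)
            * diagonal (fun i => ((1 + t * hMh.eigenvalues i : ℝ) : ℂ))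
            * star (hMh.eigenvectorUnitary : Matrix n n ℂ) := by
        have hd : diagonal (fun i => ((1 + t * hMh.eigenvalues i : ℝ) : ℂ))
            = 1 + (t : ℂ) • diagonal (RCLike.ofReal ∘ hMh.eigenvalues) := by
          ext i j
          by_cases hij : i = j
          · subst hij; simp
          · simp [hij]
        rw [hd, mul_add, mul_one, add_mul, Matrix.mul_smul, Matrix.smul_mul,
          Unitary.mul_star_self_of_mem hMh.eigenvectorUnitary.2, one_smul]
        conv_lhs => rw [hMh.spectral_theorem, Unitary.conjStarAlgAut_apply]
      rw [e, Matrix.IsUnit.posDef_star_right_conjugate_iff Unitary.isUnit_coe,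
        Matrix.posDef_diagonal_iff]
      exact fun i => Complex.zero_lt_real.2 (ht i)
    have h2 := h1.conjTranspose_mul_mul_same (Matrix.mulVec_injective_of_isUnit hAu)
    rw [hApd.isHermitian.eq] at h2
    rwa [hline]

lemma Herm.coe_smul {d : ℕ} (c : ℝ) (A : Herm d) :
    ((c • A : Herm d) : Matrix (Fin d) (Fin d) ℂ) = (c : ℂ) • (A : Matrix (Fin d) (Fin d) ℂ) := by
  rw [selfAdjoint.val_smul, Complex.coe_smul]

/-- The positive definite elements of `Herm d`. -/
def posDefSet (d : ℕ) : Set (Herm d) := {ρ | (ρ : Matrix (Fin d) (Fin d) ℂ).PosDef}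

lemma add_mem_posDefSet {d : ℕ} {A B : Herm d} (hA : A ∈ posDefSet d) (hB : B ∈ posDefSet d) :
    A + B ∈ posDefSet d := Matrix.PosDef.add hA hB

lemma smul_mem_posDefSet {d : ℕ} {A : Herm d} (hA : A ∈ posDefSet d) {c : ℝ} (hc : 0 < c) :
    c • A ∈ posDefSet d := by
  change ((c • A : Herm d) : Matrix (Fin d) (Fin d) ℂ).PosDef
  rw [selfAdjoint.val_smul]
  exact Matrix.PosDef.smul hA hc

lemma convex_posDefSet (d : ℕ) : Convex ℝ (posDefSet d) := by
  intro A hA B hB a b ha hb hab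
  rcases ha.eq_or_lt with rfl | ha
  · rw [zero_add] at hab; subst hab; simpa using hB
  rcases hb.eq_or_lt with rfl | hb
  · rw [add_zero] at hab; subst hab; simpa using hA
  exact add_mem_posDefSet (smul_mem_posDefSet hA ha) (smul_mem_posDefSet hB hb)

lemma isOpen_posDefSet (d : ℕ) : IsOpen (posDefSet d) := by
  rw [isOpen_iff_mem_nhds]
  intro ρ hρ
  set φ : Herm d × (Fin d → ℂ) → ℝ := fun p =>
    (star p.2 ⬝ᵥ ((p.1 : Matrix (Fin d) (Fin d) ℂ) *ᵥ p.2)).re with hφ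
  have hφc : Continuous φ := by
    refine Complex.continuous_re.comp (Continuous.dotProduct (by fun_prop) ?_)
    exact Continuous.matrix_mulVec (continuous_subtype_val.comp continuous_fst) continuous_snd
  have hev : ∀ᶠ A in 𝓝 ρ, ∀ v ∈ Metric.sphere (0 : Fin d → ℂ) 1, 0 < φ (A, v) := by
    refine (isCompact_sphere 0 1).eventually_forall_of_forall_eventually fun v hv => ?_
    refine hφc.continuousAt.eventually_const_lt (?_ : 0 < φ (ρ, v))
    have hv0 : v ≠ 0 := by rintro rfl; simp at hv
    exact Matrix.PosDef.re_dotProduct_pos hρ hv0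
  filter_upwards [hev] with A hA
  refine Matrix.PosDef.of_dotProduct_mulVec_pos A.2 fun v hv => ?_
  have hn : 0 < ‖v‖ := norm_pos_iff.2 hv
  have h1 := hA ((‖v‖⁻¹ : ℝ) • v) (by
    rw [mem_sphere_zero_iff_norm, norm_smul, norm_inv, norm_norm, inv_mul_cancel₀ hn.ne'])
  have h2 : φ (A, (‖v‖⁻¹ : ℝ) • v) = ‖v‖⁻¹ ^ 2 * φ (A, v) := by
    simp only [hφ]
    rw [← Complex.coe_smul, Matrix.mulVec_smul, star_smul, smul_dotProduct, dotProduct_smul,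
      smul_smul, Complex.star_def, Complex.conj_ofReal, ← Complex.ofReal_mul, smul_eq_mul,
      Complex.re_ofReal_mul, sq]
  rw [h2] at h1
  have h3 : 0 < φ (A, v) := pos_of_mul_pos_right h1 (by positivity)
  have him : (star v ⬝ᵥ ((A : Matrix (Fin d) (Fin d) ℂ) *ᵥ v)).im = 0 :=
    Matrix.IsHermitian.im_star_dotProduct_mulVec_self A.2 v
  exact Complex.lt_def.2 ⟨h3, him.symm⟩

lemma exists_smul_one_sub_mem_posDefSet {d : ℕ} (ρ : Herm d) :
    ∃ C : ℝ, 0 < C ∧ C • (1 : Herm d) - ρ ∈ posDefSet d := by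
  have h1 : (1 : Herm d) ∈ posDefSet d := by
    change ((1 : Herm d) : Matrix (Fin d) (Fin d) ℂ).PosDef
    simpa using Matrix.PosDef.one
  have hc : Continuous fun t : ℝ => (1 : Herm d) - t • ρ := by
    refine continuous_induced_rng.2 (?_ : Continuous fun t : ℝ =>
      ((1 : Matrix (Fin d) (Fin d) ℂ) - t • (ρ : Matrix (Fin d) (Fin d) ℂ)))
    fun_prop
  have : ∀ᶠ t in 𝓝[>] (0 : ℝ), (1 : Herm d) - t • ρ ∈ posDefSet d :=
    (hc.continuousAt.eventually_mem ((isOpen_posDefSet d).mem_nhds (by simpa using h1))).filter_mono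
      nhdsWithin_le_nhds
  obtain ⟨t, ht, ht0⟩ := (this.and self_mem_nhdsWithin).exists
  have ht0 : 0 < t := ht0
  refine ⟨t⁻¹, inv_pos.2 ht0, ?_⟩
  have := smul_mem_posDefSet ht (inv_pos.2 ht0)
  rwa [smul_sub, smul_smul, inv_mul_cancel₀ ht0.ne', one_smul] at this

/-- Nonnegative, positively homogeneous functions on the positive definite cone whose restrictions
to segments have third derivative controlled by the second one. -/
structure IsConicPotential {d : ℕ} (ψ : Herm d → ℝ) : Prop where
  nonneg : ∀ A ∈ posDefSet d, 0 ≤ ψ A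
  smul : ∀ A ∈ posDefSet d, ∀ c : ℝ, 0 < c → ψ (c • A) = c * ψ A
  line : ∀ A B : Herm d, A + B ∈ posDefSet d → A - B ∈ posDefSet d →
    ContDiffAt ℝ 3 (fun t : ℝ => ψ (A + t • B)) 0 ∧
    |iteratedDeriv 3 (fun t : ℝ => ψ (A + t • B)) 0|
      ≤ -3 * iteratedDeriv 2 (fun t : ℝ => ψ (A + t • B)) 0

namespace IsConicPotential

variable {d : ℕ} {ψ : Herm d → ℝ}

lemma exists_line (hψ : IsConicPotential ψ) {ρ : Herm d} (hρ : ρ ∈ posDefSet d) (h : Herm d) :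
    ∃ x : Fin d → ℝ,
      (∀ t : ℝ, ((ρ + t • h : Herm d) : Matrix (Fin d) (Fin d) ℂ).det.re
        = (ρ : Matrix (Fin d) (Fin d) ℂ).det.re * ∏ i, (1 + t * x i)) ∧
      ContDiffAt ℝ 3 (fun t : ℝ => ψ (ρ + t • h)) 0 ∧
      ∀ N > 0, (∀ i, |x i| < N) → |iteratedDeriv 3 (fun t : ℝ => ψ (ρ + t • h)) 0|
        ≤ -3 * N * iteratedDeriv 2 (fun t : ℝ => ψ (ρ + t • h)) 0 := by
  obtain ⟨x, hdet, hpd⟩ := Matrix.PosDef.exists_det_line hρ h.2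
  have hcoe : ∀ t : ℝ, ((ρ + t • h : Herm d) : Matrix (Fin d) (Fin d) ℂ)
      = (ρ : Matrix (Fin d) (Fin d) ℂ) + (t : ℂ) • (h : Matrix (Fin d) (Fin d) ℂ) := fun t => by
    rw [AddSubgroup.coe_add, Herm.coe_smul]
  have hmem : ∀ t : ℝ, (∀ i, 0 < 1 + t * x i) → ρ + t • h ∈ posDefSet d := fun t ht => by
    change ((ρ + t • h : Herm d) : Matrix (Fin d) (Fin d) ℂ).PosDef
    rw [hcoe]; exact hpd t ht
  have key : ∀ N > 0, (∀ i, |x i| < N) → ContDiffAt ℝ 3 (fun t : ℝ => ψ (ρ + t • h)) 0 ∧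
      |iteratedDeriv 3 (fun t : ℝ => ψ (ρ + t • h)) 0|
        ≤ -3 * N * iteratedDeriv 2 (fun t : ℝ => ψ (ρ + t • h)) 0 := by
    intro N hN hx
    have hx' : ∀ i, |N⁻¹ * x i| < 1 := fun i => by
      rw [abs_mul, abs_of_pos (inv_pos.2 hN), inv_mul_lt_iff₀ hN, mul_one]
      exact hx i
    have hp : ρ + N⁻¹ • h ∈ posDefSet d :=
      hmem _ fun i => by linarith [(abs_lt.1 (hx' i)).1]
    have hm : ρ - N⁻¹ • h ∈ posDefSet d := by
      rw [sub_eq_add_neg, ← neg_smul]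
      exact hmem _ fun i => by linarith [(abs_lt.1 (hx' i)).2]
    obtain ⟨hd, hb⟩ := hψ.line ρ (N⁻¹ • h) hp hm
    have hF : (fun t : ℝ => ψ (ρ + t • h)) = fun t => (fun s : ℝ => ψ (ρ + s • N⁻¹ • h)) (N * t) := by
      funext t
      simp only [smul_smul]
      congr 3
      field_simp
    rw [hF]
    have hd' : ContDiffAt ℝ 3 (fun s : ℝ => ψ (ρ + s • N⁻¹ • h)) (N * 0) := by rwa [mul_zero]
    refine ⟨hd'.comp (0 : ℝ) (f := fun t => N * t) (by fun_prop), ?_⟩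
    rw [iteratedDeriv_comp_mul_left (fun s : ℝ => ψ (ρ + s • N⁻¹ • h)),
      iteratedDeriv_comp_mul_left (fun s : ℝ => ψ (ρ + s • N⁻¹ • h))]
    simp only [mul_zero]
    rw [abs_mul, abs_of_pos (by positivity)]
    calc _ ≤ N ^ 3 * (-3 * iteratedDeriv 2 (fun s : ℝ => ψ (ρ + s • N⁻¹ • h)) 0) := by gcongr
      _ = _ := by ring
  refine ⟨x, fun t => by rw [hcoe, hdet], ?_, fun N hN hx => (key N hN hx).2⟩
  refine (key (∑ i, |x i| + 1) (by positivity) fun i => ?_).1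
  have : |x i| ≤ ∑ i, |x i| :=
    Finset.single_le_sum (f := fun i => |x i|) (fun i _ => abs_nonneg _) (Finset.mem_univ i)
  linarith

lemma iteratedDeriv_two_nonpos (hψ : IsConicPotential ψ) {ρ : Herm d} (hρ : ρ ∈ posDefSet d)
    (h : Herm d) : iteratedDeriv 2 (fun t : ℝ => ψ (ρ + t • h)) 0 ≤ 0 := by
  obtain ⟨x, -, -, hN⟩ := hψ.exists_line hρ h
  have h0 : 0 < ∑ i, |x i| + 1 := by positivity
  have := (abs_nonneg _).trans (hN (∑ i, |x i| + 1) h0 fun i => by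
    have : |x i| ≤ ∑ i, |x i| :=
      Finset.single_le_sum (f := fun i => |x i|) (fun i _ => abs_nonneg _) (Finset.mem_univ i)
    linarith)
  nlinarith

lemma concaveOn (hψ : IsConicPotential ψ) : ConcaveOn ℝ (posDefSet d) ψ := by
  rw [← neg_convexOn_iff]
  refine convexOn_of_forall_line (convex_posDefSet d) (fun ρ hρ h => ?_) fun ρ hρ h => ?_
  · obtain ⟨x, -, hd, -⟩ := hψ.exists_line hρ h
    exact hd.neg
  · have := iteratedDeriv_fun_neg 2 (fun t : ℝ => ψ (ρ + t • h)) 0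
    simp only [Pi.neg_apply]
    rw [this]
    linarith [hψ.iteratedDeriv_two_nonpos hρ h]

lemma add_le (hψ : IsConicPotential ψ) {A B : Herm d} (hA : A ∈ posDefSet d)
    (hB : B ∈ posDefSet d) : ψ A + ψ B ≤ ψ (A + B) := by
  have h := hψ.concaveOn.2 hA hB (show (0 : ℝ) ≤ 1 / 2 by norm_num)
    (show (0 : ℝ) ≤ 1 / 2 by norm_num) (by norm_num)
  rw [← smul_add _ A B, hψ.smul _ (add_mem_posDefSet hA hB) _ (by norm_num), smul_eq_mul,
    smul_eq_mul] at h
  linarith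

lemma mono (hψ : IsConicPotential ψ) {A B : Herm d} (hA : A ∈ posDefSet d)
    (hAB : B - A ∈ posDefSet d) : ψ A ≤ ψ B := by
  have h := hψ.add_le hA hAB
  rw [add_sub_cancel] at h
  linarith [hψ.nonneg _ hAB]

lemma continuousAt (hψ : IsConicPotential ψ) {ρ : Herm d} (hρ : ρ ∈ posDefSet d) :
    ContinuousAt ψ ρ := by
  have key : ∀ ε ∈ Ioo (0 : ℝ) 1, ∀ᶠ A in 𝓝 ρ, (1 - ε) * ψ ρ ≤ ψ A ∧ ψ A ≤ (1 + ε) * ψ ρ := by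
    intro ε hε
    have h1 : Continuous fun A : Herm d => A - (1 - ε) • ρ := by fun_prop
    have h2 : Continuous fun A : Herm d => (1 + ε) • ρ - A := by fun_prop
    have e1 := h1.continuousAt.eventually_mem (x := ρ) ((isOpen_posDefSet d).mem_nhds (by
      have : ρ - (1 - ε) • ρ = ε • ρ := by rw [sub_smul, one_smul, sub_sub_cancel]
      rw [this]; exact smul_mem_posDefSet hρ hε.1))
    have e2 := h2.continuousAt.eventually_mem (x := ρ) ((isOpen_posDefSet d).mem_nhds (by
      have : (1 + ε) • ρ - ρ = ε • ρ := by rw [add_smul, one_smul, add_sub_cancel_left]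
      rw [this]; exact smul_mem_posDefSet hρ hε.1))
    filter_upwards [e1, e2, (isOpen_posDefSet d).mem_nhds hρ] with A hA1 hA2 hA
    have p1 : 0 < 1 - ε := by linarith [hε.2]
    have p2 : 0 < 1 + ε := by linarith [hε.1]
    exact ⟨by rw [← hψ.smul _ hρ _ p1]; exact hψ.mono (smul_mem_posDefSet hρ p1) hA1,
      by rw [← hψ.smul _ hρ _ p2]; exact hψ.mono hA hA2⟩
  rw [ContinuousAt, tendsto_order]
  constructor
  · intro a ha
    have hc : Continuous fun ε : ℝ => (1 - ε) * ψ ρ := by fun_prop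
    have h := ((hc.continuousAt (x := 0)).eventually_const_lt (by simpa using ha)).filter_mono
      (nhdsWithin_le_nhds (s := Ioi 0))
    obtain ⟨ε, hε1, hε2⟩ := (h.and (Ioo_mem_nhdsGT one_pos)).exists
    filter_upwards [key ε hε2] with A hA using hε1.trans_le hA.1
  · intro a ha
    have hc : Continuous fun ε : ℝ => (1 + ε) * ψ ρ := by fun_prop
    have h := ((hc.continuousAt (x := 0)).eventually_lt_const (by simpa using ha)).filter_mono
      (nhdsWithin_le_nhds (s := Ioi 0))
    obtain ⟨ε, hε1, hε2⟩ := (h.and (Ioo_mem_nhdsGT one_pos)).exists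
    filter_upwards [key ε hε2] with A hA using hA.2.trans_lt hε1

end IsConicPotential

lemma continuous_herm_det_re (d : ℕ) :
    Continuous fun A : Herm d => (A : Matrix (Fin d) (Fin d) ℂ).det.re :=
  Complex.continuous_re.comp (Continuous.matrix_det continuous_subtype_val)

lemma det_re_pos_of_mem_posDefSet {d : ℕ} {A : Herm d} (hA : A ∈ posDefSet d) :
    0 < (A : Matrix (Fin d) (Fin d) ℂ).det.re :=
  (Complex.lt_def.1 (Matrix.PosDef.det_pos hA)).1

lemma det_re_eq_zero_of_mem_closure {d : ℕ} {A : Herm d} (hA : A ∈ closure (posDefSet d))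
    (hA' : A ∉ posDefSet d) : (A : Matrix (Fin d) (Fin d) ℂ).det.re = 0 := by
  have hpsd : (A : Matrix (Fin d) (Fin d) ℂ).PosSemidef := by
    refine Matrix.PosSemidef.of_dotProduct_mulVec_nonneg A.2 fun v => ?_
    have hc : Continuous fun A : Herm d => star v ⬝ᵥ ((A : Matrix (Fin d) (Fin d) ℂ) *ᵥ v) :=
      continuous_const.dotProduct (Continuous.matrix_mulVec continuous_subtype_val continuous_const)
    have : closure (posDefSet d)
        ⊆ {A : Herm d | 0 ≤ star v ⬝ᵥ ((A : Matrix (Fin d) (Fin d) ℂ) *ᵥ v)} :=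
      closure_minimal (fun B hB => (Matrix.PosDef.posSemidef hB).dotProduct_mulVec_nonneg v)
        (isClosed_le continuous_const hc)
    exact this hA
  by_contra hne
  refine hA' (hpsd.posDef_iff_isUnit.2 ((Matrix.isUnit_iff_isUnit_det _).2 ?_))
  exact IsUnit.mk0 _ fun h => hne (by rw [h]; simp)

namespace IsConicPotential

variable {d : ℕ} {ψ : Herm d → ℝ}

lemma convex_hypograph (hψ : IsConicPotential ψ) :
    Convex ℝ {p : ℝ × Herm d | (p.2 : Matrix (Fin d) (Fin d) ℂ).PosDef ∧ p.1 < ψ p.2} := by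
  rintro ⟨u, A⟩ ⟨hA, hu⟩ ⟨v, B⟩ ⟨hB, hv⟩ a b ha hb hab
  have hA : A ∈ posDefSet d := hA
  have hB : B ∈ posDefSet d := hB
  simp only at hu hv
  refine ⟨convex_posDefSet d hA hB ha hb hab, ?_⟩
  have h := hψ.concaveOn.2 hA hB ha hb hab
  change a * u + b * v < ψ (a • A + b • B)
  simp only [smul_eq_mul] at h
  refine lt_of_lt_of_le ?_ h
  rcases ha.eq_or_lt with rfl | ha
  · rw [zero_add] at hab; subst hab; simpa using hv
  · nlinarith [mul_lt_mul_of_pos_left hu ha, mul_le_mul_of_nonneg_left hv.le hb]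

lemma tendsto_atTop_of_mem_frontier (hψ : IsConicPotential ψ) {p : ℝ × Herm d}
    (hp : p ∈ frontier {p : ℝ × Herm d | (p.2 : Matrix (Fin d) (Fin d) ℂ).PosDef ∧ p.1 < ψ p.2}) :
    Tendsto (fun p : ℝ × Herm d => -Real.log (ψ p.2 - p.1)
        - Real.log ((p.2 : Matrix (Fin d) (Fin d) ℂ).det.re))
      (𝓝[{p : ℝ × Herm d | (p.2 : Matrix (Fin d) (Fin d) ℂ).PosDef ∧ p.1 < ψ p.2}] p) atTop := by
  set D := {p : ℝ × Herm d | (p.2 : Matrix (Fin d) (Fin d) ℂ).PosDef ∧ p.1 < ψ p.2} with hD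
  have hdet : Continuous fun p : ℝ × Herm d => (p.2 : Matrix (Fin d) (Fin d) ℂ).det.re :=
    (continuous_herm_det_re d).comp continuous_snd
  have hmem : ∀ᶠ x in 𝓝[D] p, x ∈ D := self_mem_nhdsWithin
  have hcl : p ∈ closure D := hp.1
  have : (𝓝[D] p).NeBot := mem_closure_iff_nhdsWithin_neBot.1 hcl
  by_cases hpd : p.2 ∈ posDefSet d
  · have hc : ContinuousAt (fun x : ℝ × Herm d => ψ x.2 - x.1) p :=
      ((hψ.continuousAt hpd).comp (f := Prod.snd) continuousAt_snd).sub continuousAt_fst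
    have hge : 0 ≤ ψ p.2 - p.1 :=
      ge_of_tendsto (hc.tendsto.mono_left nhdsWithin_le_nhds)
        (hmem.mono fun x hx => (sub_pos.2 hx.2).le)
    have hle : ψ p.2 - p.1 ≤ 0 := by
      by_contra! hlt
      refine hp.2 (mem_interior_iff_mem_nhds.2 ?_)
      filter_upwards [hc.eventually_const_lt hlt,
        continuousAt_snd.eventually_mem ((isOpen_posDefSet d).mem_nhds hpd)] with x h1 h2
      exact ⟨h2, sub_pos.1 h1⟩
    have h0 : ψ p.2 - p.1 = 0 := le_antisymm hle hge
    have ht : Tendsto (fun x : ℝ × Herm d => ψ x.2 - x.1) (𝓝[D] p) (𝓝[>] 0) := by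
      refine tendsto_nhdsWithin_iff.2 ⟨?_, hmem.mono fun x hx => sub_pos.2 hx.2⟩
      rw [← h0]
      exact hc.tendsto.mono_left nhdsWithin_le_nhds
    have hl : Tendsto (fun x : ℝ × Herm d => -Real.log (ψ x.2 - x.1)) (𝓝[D] p) atTop :=
      tendsto_neg_atBot_atTop.comp (Real.tendsto_log_nhdsGT_zero.comp ht)
    have hl' := ((hdet.continuousAt (x := p)).log
      (det_re_pos_of_mem_posDefSet hpd).ne').tendsto.mono_left (nhdsWithin_le_nhds (s := D))
    exact hl.atTop_add hl'.neg
  · have hcl2 : p.2 ∈ closure (posDefSet d) :=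
      map_mem_closure continuous_snd hcl fun x hx => hx.1
    have h0 := det_re_eq_zero_of_mem_closure hcl2 hpd
    have ht : Tendsto (fun x : ℝ × Herm d => (x.2 : Matrix (Fin d) (Fin d) ℂ).det.re) (𝓝[D] p)
        (𝓝[>] 0) := by
      refine tendsto_nhdsWithin_iff.2
        ⟨?_, hmem.mono fun x hx => det_re_pos_of_mem_posDefSet hx.1⟩
      rw [← h0]
      exact (hdet.tendsto p).mono_left nhdsWithin_le_nhds
    have hl : Tendsto (fun x : ℝ × Herm d => -Real.log ((x.2 : Matrix (Fin d) (Fin d) ℂ).det.re))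
        (𝓝[D] p) atTop :=
      tendsto_neg_atBot_atTop.comp (Real.tendsto_log_nhdsGT_zero.comp ht)
    obtain ⟨C, -, hC⟩ := exists_smul_one_sub_mem_posDefSet p.2
    have hCc : Continuous fun x : ℝ × Herm d => C • (1 : Herm d) - x.2 := by fun_prop
    refine tendsto_atTop_add_left_of_le' _ (-Real.log (ψ (C • 1) - (p.1 - 1))) ?_ hl
    filter_upwards [hmem, (hCc.continuousAt.eventually_mem
        ((isOpen_posDefSet d).mem_nhds hC)).filter_mono nhdsWithin_le_nhds,
      (continuousAt_fst.eventually_const_lt (sub_one_lt p.1)).filter_mono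
        nhdsWithin_le_nhds] with x hx h1 h2
    have h3 := hψ.mono hx.1 h1
    exact neg_le_neg (Real.log_le_log (sub_pos.2 hx.2) (by linarith))

/-- A function which is controlled along segments as in `IsConicPotential` gives rise to a
self-concordant barrier for the closure of its hypograph. -/
theorem isSelfConcordantBarrier (hψ : IsConicPotential ψ) :
    IsSelfConcordantBarrier ((1 : ℝ) + d)
      {p : ℝ × Herm d | (p.2 : Matrix (Fin d) (Fin d) ℂ).PosDef ∧ p.1 < ψ p.2}
      (fun p => -Real.log (ψ p.2 - p.1) - Real.log ((p.2 : Matrix (Fin d) (Fin d) ℂ).det.re)) := by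
  have key : ∀ p ∈ {p : ℝ × Herm d | (p.2 : Matrix (Fin d) (Fin d) ℂ).PosDef ∧ p.1 < ψ p.2},
      ∀ h : ℝ × Herm d, ∀ g : ℝ → ℝ,
      g = (fun t : ℝ => -Real.log (ψ (p + t • h).2 - (p + t • h).1)
        - Real.log (((p + t • h).2 : Matrix (Fin d) (Fin d) ℂ).det.re)) →
      ContDiffAt ℝ 3 g 0 ∧ 0 ≤ iteratedDeriv 2 g 0 ∧
        |iteratedDeriv 3 g 0| ≤ 2 * iteratedDeriv 2 g 0 ^ (3 / 2 : ℝ) ∧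
        deriv g 0 ^ 2 ≤ (1 + d) * iteratedDeriv 2 g 0 := by
    rintro ⟨u, ρ⟩ ⟨hρ, hu⟩ ⟨v, η⟩ g rfl
    obtain ⟨x, hdet, hd, hN⟩ := hψ.exists_line hρ η
    have := neg_log_sub_sub_log_prod_derivs hd (v := v) (by simpa using hu) x
      (det_re_pos_of_mem_posDefSet hρ) hN rfl
    rw [Fintype.card_fin] at this
    simp_rw [← hdet] at this
    exact this
  exact ⟨convexOn_of_forall_line hψ.convex_hypograph (fun p hp h => (key p hp h _ rfl).1)
      fun p hp h => (key p hp h _ rfl).2.1,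
    fun p hp => hψ.tendsto_atTop_of_mem_frontier hp,
    fun p hp h => (key p hp h _ rfl).2.2.1, fun p hp h => (key p hp h _ rfl).2.2.2⟩

end IsConicPotential

lemma isConicPotential_PsiS {q k n : ℕ} (G : Herm q →ₗ[ℝ] Herm k) (Z : Herm q →ₗ[ℝ] Herm n)
    (hG : ∀ ρ ∈ posDefSet q, G ρ ∈ posDefSet k) (hZ : ∀ ρ ∈ posDefSet q, Z ρ ∈ posDefSet n)
    {S : Matrix (Fin n) (Fin k) ℂ} (hS : Sᴴ * S = 1) {α : ℝ} (hα : α ∈ Set.Ico (1 / 2 : ℝ) 1) :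
    IsConicPotential fun ρ => PsiS α S (G ρ : Matrix (Fin k) (Fin k) ℂ)
      (Z ρ : Matrix (Fin n) (Fin n) ℂ) where
  nonneg A hA := PsiS_nonneg α hS (hG A hA) (hZ A hA)
  smul A hA c hc := by
    rw [map_smul, map_smul, Herm.coe_smul, Herm.coe_smul]
    exact PsiS_smul hα hS (hG A hA) (hZ A hA) hc
  line A B hp hm := by
    obtain ⟨Q, hQ, hre, hF⟩ := exists_segment_PsiS hα hS (hG _ hp) (hG _ hm) (hZ _ hp) (hZ _ hm)
    refine contDiffAt_and_abs_iteratedDeriv_three_le hQ hre fun t ht => ?_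
    rw [← hF t ht]
    have e : A + t • B = ((1 + t) / 2) • (A + B) + ((1 - t) / 2) • (A - B) := by module
    rw [e, map_add, map_add, map_smul, map_smul, map_smul, map_smul, AddSubgroup.coe_add,
      AddSubgroup.coe_add, Herm.coe_smul, Herm.coe_smul, Herm.coe_smul, Herm.coe_smul]

end

/-- The barrier `f(u,ρ) = −log(Ψ̂_α(ρ) − u) − log det ρ` is a `(1+q)`-self-concordant
barrier for the closure of `D = {(u,ρ) : ρ ≻ 0, u < Ψ̂_α(ρ)}`, where
`Ψ̂_α(ρ) = Tr[(Ĝ(ρ)^{1/2} Sᴴ 𝒵𝒢̂(ρ)^{(1−α)/α} S Ĝ(ρ)^{1/2})^α]` for positive linear maps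
`Ĝ`, `𝒵𝒢̂` on Hermitian matrices and an isometry `S`. -/
theorem stmt11 {q k n : ℕ}
    (Ghat : Herm q →ₗ[ℝ] Herm k) (ZGhat : Herm q →ₗ[ℝ] Herm n)
    (hGpsd : ∀ ρ : Herm q, (ρ : Matrix (Fin q) (Fin q) ℂ).PosSemidef →
      ((Ghat ρ : Matrix (Fin k) (Fin k) ℂ)).PosSemidef)
    (hGpd : ∀ ρ : Herm q, (ρ : Matrix (Fin q) (Fin q) ℂ).PosDef →
      ((Ghat ρ : Matrix (Fin k) (Fin k) ℂ)).PosDef)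
    (hZGpsd : ∀ ρ : Herm q, (ρ : Matrix (Fin q) (Fin q) ℂ).PosSemidef →
      ((ZGhat ρ : Matrix (Fin n) (Fin n) ℂ)).PosSemidef)
    (hZGpd : ∀ ρ : Herm q, (ρ : Matrix (Fin q) (Fin q) ℂ).PosDef →
      ((ZGhat ρ : Matrix (Fin n) (Fin n) ℂ)).PosDef)
    (S : Matrix (Fin n) (Fin k) ℂ) (hS : Sᴴ * S = 1)
    (α : ℝ) (hα : α ∈ Set.Ico (1 / 2 : ℝ) 1) :
    IsSelfConcordantBarrier ((1 : ℝ) + q)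
      {p : ℝ × Herm q |
        (p.2 : Matrix (Fin q) (Fin q) ℂ).PosDef ∧
        p.1 < PsiS α S (Ghat p.2 : Matrix (Fin k) (Fin k) ℂ)
                (ZGhat p.2 : Matrix (Fin n) (Fin n) ℂ)}
      (fun p =>
        -Real.log (PsiS α S (Ghat p.2 : Matrix (Fin k) (Fin k) ℂ)
            (ZGhat p.2 : Matrix (Fin n) (Fin n) ℂ) - p.1)
        - Real.log ((p.2 : Matrix (Fin q) (Fin q) ℂ).det.re)) :=
  (isConicPotential_PsiS Ghat ZGhat hGpd hZGpd hS hα).isSelfConcordantBarrier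

end
end

section
/- Let Ĝ : ℍ^q → ℍ^k and Ẑ : ℍ^m → ℍ^n be ℝ-linear maps on Hermitian matrices sending positive definite matrices to positive definite matrices, let S be an n×k complex matrix with S†S = I_k, let α ∈ [1/2,1), and define Ψ̂_α(ρ, σ) := Tr[(Ĝ(ρ)^{1/2} S† Ẑ(σ)^{(1−α)/α} S Ĝ(ρ)^{1/2})^α] for positive definite ρ ∈ ℍ^q, σ ∈ ℍ^m. Fix such ρ and σ, and set G := Ĝ(ρ) and Z_S := S† Ẑ(σ)^{(1−α)/α} S. Then for every Hermitian H ∈ ℍ^q, the directional derivative of the map ρ' ↦ Ψ̂_α(ρ', σ) at ρ in direction H equals Tr[ H · Ĝ†( Z_S^{1/2} g'(Z_S^{1/2} G Z_S^{1/2}) Z_S^{1/2} ) ], where g'(x) := α x^{α−1} is applied via the continuous functional calculus and Ĝ† is the adjoint of Ĝ with respect to the Hilbert–Schmidt inner product ⟨M,N⟩ = Tr[MN] on Hermitian matrices. -/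
open Matrix
open scoped ComplexOrder

noncomputable section

section Helpers

open Filter Topology

variable {k : ℕ} {A B : Matrix (Fin k) (Fin k) ℂ}

theorem trace_cfc_eq_sum (hA : A.IsHermitian) (f : ℝ → ℝ) :
    (cfc f A).trace = ∑ i, (f (hA.eigenvalues i) : ℂ) := by
  rw [hA.cfc_eq f, IsHermitian.cfc, Unitary.conjStarAlgAut_apply, Matrix.trace_mul_comm,
    ← Matrix.mul_assoc]
  simp [Matrix.trace]

theorem trace_cfc_mul_comm (f : ℝ → ℝ) (hAB : (A * B).IsHermitian) (hBA : (B * A).IsHermitian) :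
    (cfc f (A * B)).trace = (cfc f (B * A)).trace := by
  rw [trace_cfc_eq_sum hAB, trace_cfc_eq_sum hBA,
    (IsHermitian.eigenvalues_eq_eigenvalues_iff hAB hBA).2 (charpoly_mul_comm A B)]

/-- The trace of a product of functions of two Hermitian matrices, as a double sum over the
eigenvalues weighted by the overlaps of the eigenvectors. -/
theorem re_trace_cfc_mul_cfc (hA : A.IsHermitian) (hB : B.IsHermitian) (g h : ℝ → ℝ) :
    (cfc g A * cfc h B).trace.re = ∑ i, ∑ j, g (hA.eigenvalues i) * h (hB.eigenvalues j) *
      Complex.normSq ((star (hA.eigenvectorUnitary : Matrix (Fin k) (Fin k) ℂ) *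
        (hB.eigenvectorUnitary : Matrix (Fin k) (Fin k) ℂ)) i j) := by
  set U : Matrix (Fin k) (Fin k) ℂ := ↑hA.eigenvectorUnitary with hU
  set V : Matrix (Fin k) (Fin k) ℂ := ↑hB.eigenvectorUnitary with hV
  set W := star U * V with hW
  have hcycle : (cfc g A * cfc h B).trace =
      (diagonal (fun i => (g (hA.eigenvalues i) : ℂ)) *
        (W * diagonal (fun j => (h (hB.eigenvalues j) : ℂ)) * Wᴴ)).trace := by
    rw [hA.cfc_eq g, hB.cfc_eq h, IsHermitian.cfc, IsHermitian.cfc,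
      Unitary.conjStarAlgAut_apply, Unitary.conjStarAlgAut_apply, ← hU, ← hV,
      Matrix.mul_assoc U, Matrix.mul_assoc U, Matrix.trace_mul_comm U]
    simp only [hW, star_eq_conjTranspose, conjTranspose_mul, conjTranspose_conjTranspose,
      Matrix.mul_assoc]
    rfl
  rw [hcycle, Matrix.trace, Complex.re_sum]
  refine Finset.sum_congr rfl fun i _ => ?_
  rw [diag_apply, diagonal_mul, Matrix.mul_apply, Complex.re_ofReal_mul, Complex.re_sum,
    Finset.mul_sum]
  refine Finset.sum_congr rfl fun j _ => ?_
  rw [mul_diagonal, conjTranspose_apply, mul_right_comm, ← starRingEnd_apply, Complex.mul_conj,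
    ← Complex.ofReal_mul, Complex.ofReal_re]
  ring

/-- **Klein's inequality** for functions lying below their tangent lines on the positive reals. -/
theorem re_trace_cfc_sub_le {f f' : ℝ → ℝ}
    (hf : ∀ x y : ℝ, 0 < x → 0 < y → f y - f x ≤ f' x * (y - x))
    (hA : A.PosDef) (hB : B.PosDef) :
    (cfc f B).trace.re - (cfc f A).trace.re ≤ (cfc f' A * (B - A)).trace.re := by
  have hA' : IsSelfAdjoint A := hA.1
  have hB' : IsSelfAdjoint B := hB.1
  have cont (g : ℝ → ℝ) (C : Matrix (Fin k) (Fin k) ℂ) : ContinuousOn g (spectrum ℝ C) :=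
    (Matrix.finite_real_spectrum (A := C)).continuousOn g
  have h1 := re_trace_cfc_mul_cfc hA.1 hB.1 (fun _ => 1) f
  have h2 := re_trace_cfc_mul_cfc hA.1 hB.1 f (fun _ => 1)
  have h3 := re_trace_cfc_mul_cfc hA.1 hB.1 f' id
  have h4 := re_trace_cfc_mul_cfc hA.1 hB.1 (fun x => f' x * x) (fun _ => 1)
  rw [cfc_const_one ℝ A, one_mul] at h1
  rw [cfc_const_one ℝ B, mul_one] at h2 h4
  rw [cfc_id ℝ B] at h3
  rw [cfc_mul f' (fun x => x) A (cont _ _) (cont _ _), cfc_id' ℝ A] at h4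
  rw [mul_sub, trace_sub, Complex.sub_re, h1, h2, h3, h4, ← Finset.sum_sub_distrib,
    ← Finset.sum_sub_distrib]
  refine Finset.sum_le_sum fun i _ => ?_
  rw [← Finset.sum_sub_distrib, ← Finset.sum_sub_distrib]
  refine Finset.sum_le_sum fun j _ => ?_
  have := mul_le_mul_of_nonneg_right
    (hf _ _ (hA.eigenvalues_pos i) (hB.eigenvalues_pos j))
    (Complex.normSq_nonneg ((star (hA.1.eigenvectorUnitary : Matrix (Fin k) (Fin k) ℂ) *
        (hB.1.eigenvectorUnitary : Matrix (Fin k) (Fin k) ℂ)) i j))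
  simp only [id]
  linarith

theorem spectrum_subset_Ioi_iff_posDef (hA : A.IsHermitian) :
    spectrum ℝ A ⊆ Set.Ioi 0 ↔ A.PosDef := by
  rw [hA.spectrum_real_eq_range_eigenvalues, Set.range_subset_iff, hA.posDef_iff_eigenvalues_pos]
  rfl

theorem cfc_posDef (hA : A.PosDef) {f : ℝ → ℝ} (hf : ∀ x, 0 < x → 0 < f x) :
    (cfc f A).PosDef := by
  have hherm : (cfc f A).IsHermitian := cfc_predicate f A
  have hA' : IsSelfAdjoint A := hA.1
  rw [← spectrum_subset_Ioi_iff_posDef hherm, cfc_map_spectrum f A hA'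
    ((Matrix.finite_real_spectrum (A := A)).continuousOn f)]
  rintro _ ⟨x, hx, rfl⟩
  exact hf x ((spectrum_subset_Ioi_iff_posDef hA.1).2 hA hx)

theorem mpow_posDef (hA : A.PosDef) (p : ℝ) : (mpow A p).PosDef :=
  cfc_posDef hA fun _ hx => Real.rpow_pos_of_pos hx p

theorem mpow_half_mul_self (hA : A.PosDef) : mpow A (1 / 2) * mpow A (1 / 2) = A := by
  have hA' : IsSelfAdjoint A := hA.1
  have cont (g : ℝ → ℝ) : ContinuousOn g (spectrum ℝ A) :=
    (Matrix.finite_real_spectrum (A := A)).continuousOn g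
  rw [mpow, ← cfc_mul _ _ A (cont _) (cont _)]
  conv_rhs => rw [← cfc_id' ℝ A]
  refine cfc_congr fun x hx => ?_
  have hx0 : 0 < x := (spectrum_subset_Ioi_iff_posDef hA.1).2 hA hx
  rw [← Real.rpow_add hx0, add_halves, Real.rpow_one]

open scoped Matrix.Norms.L2Operator in
theorem eventually_posDef {X : Type*} [TopologicalSpace X]
    {a : X → Matrix (Fin k) (Fin k) ℂ} {x₀ : X} (ha : ContinuousAt a x₀)
    (hherm : ∀ x, (a x).IsHermitian) (h₀ : (a x₀).PosDef) : ∀ᶠ x in 𝓝 x₀, (a x).PosDef := by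
  have hs : Set.Ioi (0 : ℝ) ∈ 𝓝ˢ (spectrum ℝ (a x₀)) :=
    isOpen_Ioi.mem_nhdsSet.2 ((spectrum_subset_Ioi_iff_posDef (hherm x₀)).2 h₀)
  have := ((upperHemicontinuous_spectrum ℝ (Matrix (Fin k) (Fin k) ℂ)).upperHemicontinuousAt
    (a x₀) _ hs)
  filter_upwards [ha.eventually this] with x hx
  exact (spectrum_subset_Ioi_iff_posDef (hherm x)).1 (subset_of_mem_nhdsSet hx)

open scoped Matrix.Norms.L2Operator in
theorem continuousOn_cfc_posDef {f : ℝ → ℝ} (hf : ContinuousOn f (Set.Ioi 0)) :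
    ContinuousOn (cfc f) {M : Matrix (Fin k) (Fin k) ℂ | M.PosDef} := by
  refine ContinuousOn.cfc_of_mem_nhdsSet (𝕜 := ℝ) (p := IsSelfAdjoint) (s := Set.Ioi 0) f
    (isOpen_Ioi.mem_nhdsSet.2 ?_) continuousOn_id (fun M hM => hM.1) hf
  exact Set.iUnion₂_subset fun M hM => (spectrum_subset_Ioi_iff_posDef hM.1).2 hM

theorem hasDerivAt_of_sub_le {φ ψ : ℝ → ℝ} (hψ : ContinuousAt ψ 0)
    (h₁ : ∀ᶠ t in 𝓝 (0 : ℝ), φ t - φ 0 ≤ t * ψ 0)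
    (h₂ : ∀ᶠ t in 𝓝 (0 : ℝ), φ 0 - φ t ≤ -t * ψ t) : HasDerivAt φ (ψ 0) 0 := by
  rw [hasDerivAt_iff_isLittleO, Asymptotics.isLittleO_iff]
  intro c hc
  filter_upwards [h₁, h₂, Metric.continuousAt_iff'.1 hψ c hc] with t ht₁ ht₂ ht₃
  rw [Real.dist_eq] at ht₃
  have hb : |t * (ψ t - ψ 0)| ≤ c * |t| := by
    rw [abs_mul, mul_comm]
    exact mul_le_mul_of_nonneg_right ht₃.le (abs_nonneg t)
  simp only [sub_zero, smul_eq_mul, Real.norm_eq_abs]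
  have := neg_abs_le (t * (ψ t - ψ 0))
  rw [abs_le]
  constructor <;> nlinarith [abs_nonneg (t * (ψ t - ψ 0))]

/-- Derivative of a trace function along a line of Hermitian matrices. -/
theorem hasDerivAt_re_trace_cfc {f f' : ℝ → ℝ}
    (hf : ∀ x y : ℝ, 0 < x → 0 < y → f y - f x ≤ f' x * (y - x))
    (hf' : ContinuousOn f' (Set.Ioi 0)) (hA : A.PosDef) (hB : B.IsHermitian) :
    HasDerivAt (fun t : ℝ => (cfc f (A + t • B)).trace.re) (cfc f' A * B).trace.re 0 := by
  have hcont : Continuous fun t : ℝ => A + t • B := by fun_prop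
  have hherm (t : ℝ) : (A + t • B).IsHermitian := hA.1.add (hB.smul (IsSelfAdjoint.all t))
  have hpos := eventually_posDef hcont.continuousAt hherm (x₀ := 0) (by simpa using hA)
  have hψ : ContinuousAt (fun t : ℝ => (cfc f' (A + t • B) * B).trace.re) 0 := by
    have h : ContinuousAt (fun t : ℝ => cfc f' (A + t • B)) 0 := by
      have := (continuousOn_cfc_posDef hf' (A + (0 : ℝ) • B) (by simpa using hA)).tendsto.comp
        (tendsto_nhdsWithin_iff.2 ⟨hcont.continuousAt (x := 0), hpos⟩)
      exact this
    have hl : Continuous fun M : Matrix (Fin k) (Fin k) ℂ => (M * B).trace.re := by fun_prop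
    exact hl.continuousAt.comp h
  have key := hasDerivAt_of_sub_le (φ := fun t : ℝ => (cfc f (A + t • B)).trace.re) hψ ?_ ?_
  · simpa using key
  · filter_upwards [hpos] with t ht
    simpa using re_trace_cfc_sub_le hf hA ht
  · filter_upwards [hpos] with t ht
    simpa using re_trace_cfc_sub_le hf ht hA

theorem rpow_sub_rpow_le {α : ℝ} (h₀ : 0 ≤ α) (h₁ : α ≤ 1) {x y : ℝ} (hx : 0 < x) (hy : 0 < y) :
    y ^ α - x ^ α ≤ α * x ^ (α - 1) * (y - x) := by
  have h := rpow_one_add_le_one_add_mul_self (s := y / x - 1)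
    (by linarith [div_pos hy hx]) h₀ h₁
  rw [add_sub_cancel, Real.div_rpow hy.le hx.le, div_le_iff₀ (Real.rpow_pos_of_pos hx α)] at h
  have hxα : x ^ α = x ^ (α - 1) * x := by
    rw [← Real.rpow_add_one hx.ne', sub_add_cancel]
  have hyx : (1 + α * (y / x - 1)) * x ^ α = x ^ α + α * x ^ (α - 1) * (y - x) := by
    rw [hxα]
    field_simp
  linarith

end Helpers

/-- Gradient formula in `ρ` for `Ψ̂_α(ρ, σ) = Tr[(Ĝ(ρ)^{1/2} Sᴴ Ẑ(σ)^{(1−α)/α} S Ĝ(ρ)^{1/2})^α]`: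
for Hermitian directions `H`, the directional derivative at `ρ` equals
`Tr[H · Ĝ†(Z_S^{1/2} g'(Z_S^{1/2} G Z_S^{1/2}) Z_S^{1/2})]`, where `G = Ĝ(ρ)`,
`Z_S = Sᴴ Ẑ(σ)^{(1−α)/α} S` and `g'(x) = α x^{α−1}`. -/
theorem stmt15 {q k m n : ℕ}
    (Ghat : Matrix (Fin q) (Fin q) ℂ →ₗ[ℝ] Matrix (Fin k) (Fin k) ℂ)
    (Zhat : Matrix (Fin m) (Fin m) ℂ →ₗ[ℝ] Matrix (Fin n) (Fin n) ℂ)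
    (hGherm : ∀ M : Matrix (Fin q) (Fin q) ℂ, M.IsHermitian → (Ghat M).IsHermitian)
    (hZherm : ∀ M : Matrix (Fin m) (Fin m) ℂ, M.IsHermitian → (Zhat M).IsHermitian)
    (hGpd : ∀ M : Matrix (Fin q) (Fin q) ℂ, M.PosDef → (Ghat M).PosDef)
    (hZpd : ∀ M : Matrix (Fin m) (Fin m) ℂ, M.PosDef → (Zhat M).PosDef)
    (S : Matrix (Fin n) (Fin k) ℂ) (hS : Sᴴ * S = 1)
    (α : ℝ) (hα : α ∈ Set.Ico (1 / 2 : ℝ) 1)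
    (ρ : Matrix (Fin q) (Fin q) ℂ) (hρ : ρ.PosDef)
    (σ : Matrix (Fin m) (Fin m) ℂ) (hσ : σ.PosDef)
    (Gadj : Matrix (Fin k) (Fin k) ℂ →ₗ[ℝ] Matrix (Fin q) (Fin q) ℂ)
    (hGadj : ∀ (M : Matrix (Fin q) (Fin q) ℂ) (N : Matrix (Fin k) (Fin k) ℂ),
      M.IsHermitian → N.IsHermitian → (Ghat M * N).trace = (M * Gadj N).trace) :
    ∀ H : Matrix (Fin q) (Fin q) ℂ, H.IsHermitian →
      HasDerivAt
        (fun t : ℝ =>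
          ((mpow (mpow (Ghat (ρ + t • H)) (1 / 2) * Sᴴ * mpow (Zhat σ) ((1 - α) / α) * S
            * mpow (Ghat (ρ + t • H)) (1 / 2)) α).trace).re)
        ((H * Gadj
            (mpow (Sᴴ * mpow (Zhat σ) ((1 - α) / α) * S) (1 / 2)
              * cfc (fun x : ℝ => α * x ^ (α - 1))
                  (mpow (Sᴴ * mpow (Zhat σ) ((1 - α) / α) * S) (1 / 2) * Ghat ρ
                    * mpow (Sᴴ * mpow (Zhat σ) ((1 - α) / α) * S) (1 / 2))
              * mpow (Sᴴ * mpow (Zhat σ) ((1 - α) / α) * S) (1 / 2))).trace).re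
        0 := by
  intro H hH
  have hα₀ : 0 ≤ α := by linarith [hα.1]
  have hSinj : Function.Injective S.mulVec := by
    refine Function.LeftInverse.injective (g := Sᴴ.mulVec) fun v => ?_
    rw [mulVec_mulVec, hS, one_mulVec]
  set Z := Sᴴ * mpow (Zhat σ) ((1 - α) / α) * S with hZ
  have hZpos : Z.PosDef := (mpow_posDef (hZpd σ hσ) _).conjTranspose_mul_mul_same hSinj
  set R := mpow Z (1 / 2) with hR
  have hRpos : R.PosDef := mpow_posDef hZpos _
  have hRR : R * R = Z := mpow_half_mul_self hZpos
  have hGline (t : ℝ) : Ghat (ρ + t • H) = Ghat ρ + t • Ghat H := by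
    rw [map_add, map_smul]
  have hconj {M : Matrix (Fin k) (Fin k) ℂ} (hM : M.IsHermitian) : (R * M * R).IsHermitian := by
    simpa only [hRpos.1.eq] using isHermitian_mul_mul_conjTranspose R hM
  have hYpos : (R * Ghat ρ * R).PosDef := by
    have := (hGpd ρ hρ).conjTranspose_mul_mul_same (mulVec_injective_of_isUnit hRpos.isUnit)
    rwa [hRpos.1.eq] at this
  have hGpos : ∀ᶠ t : ℝ in nhds 0, (Ghat (ρ + t • H)).PosDef := by
    refine eventually_posDef ?_ (fun t => ?_) (by simpa using hGpd ρ hρ)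
    · simp only [hGline]
      fun_prop
    · exact hGherm _ (hρ.1.add (hH.smul (IsSelfAdjoint.all t)))
  have hderiv := hasDerivAt_re_trace_cfc (f := fun x => x ^ α) (f' := fun x => α * x ^ (α - 1))
    (fun x y hx hy => rpow_sub_rpow_le hα₀ hα.2.le hx hy)
    (continuousOn_const.mul fun x hx =>
      (Real.continuousAt_rpow_const x _ (Or.inl (ne_of_gt hx))).continuousWithinAt)
    hYpos (hconj (hGherm H hH))
  set D := cfc (fun x : ℝ => α * x ^ (α - 1)) (R * Ghat ρ * R) with hD
  have hDherm : D.IsHermitian := cfc_predicate (p := IsSelfAdjoint) _ _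
  have hvalue : (H * Gadj (R * D * R)).trace = (D * (R * Ghat H * R)).trace := by
    rw [← hGadj H _ hH (hconj hDherm), ← Matrix.mul_assoc D, Matrix.trace_mul_comm _ R,
      Matrix.trace_mul_comm (Ghat H)]
    simp only [Matrix.mul_assoc]
  rw [hvalue]
  refine hderiv.congr_of_eventuallyEq ?_
  filter_upwards [hGpos] with t ht
  set G := Ghat (ρ + t • H) with hG
  set Q := mpow G (1 / 2) with hQ
  have hQherm : Qᴴ = Q := (mpow_posDef ht _).1
  have hQQ : Q * Q = G := mpow_half_mul_self ht
  have hleft : Q * Sᴴ * mpow (Zhat σ) ((1 - α) / α) * S * Q = (Q * R) * (R * Q) := by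
    rw [Matrix.mul_assoc Q R, ← Matrix.mul_assoc R R, hRR, hZ]
    simp only [Matrix.mul_assoc]
  have hright : R * Ghat ρ * R + t • (R * Ghat H * R) = (R * Q) * (Q * R) := by
    rw [Matrix.mul_assoc R Q, ← Matrix.mul_assoc Q Q, hQQ, hG, hGline]
    simp [Matrix.mul_add, Matrix.add_mul, Matrix.mul_assoc]
  have hQR : (Q * R)ᴴ = R * Q := by rw [conjTranspose_mul, hQherm, hRpos.1.eq]
  rw [hleft, hright, mpow, trace_cfc_mul_comm]
  · rw [← hQR]
    exact isHermitian_mul_conjTranspose_self _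
  · rw [← hQR]
    exact isHermitian_conjTranspose_mul_self _

end
end

section
/- Let Ĝ : ℍ^q → ℍ^k and Ẑ : ℍ^m → ℍ^n be ℝ-linear maps on Hermitian matrices sending positive definite matrices to positive definite matrices, let S be an n×k complex matrix with S†S = I_k, let α ∈ [1/2,1), and define Ψ̂_α(ρ, σ) := Tr[(Ĝ(ρ)^{1/2} S† Ẑ(σ)^{(1−α)/α} S Ĝ(ρ)^{1/2})^α] for positive definite ρ ∈ ℍ^q, σ ∈ ℍ^m. Fix such ρ and σ, and set G := Ĝ(ρ), Z := Ẑ(σ), h(x) := x^{(1−α)/α}, g'(x) := α x^{α−1}, and Z_S := S† h(Z) S. Then for every Hermitian H ∈ ℍ^m, the directional derivative of the map σ' ↦ Ψ̂_α(ρ, σ') at σ in direction H equals Tr[ H · Ẑ†( Dh(Z)[ S G^{1/2} g'(G^{1/2} Z_S G^{1/2}) G^{1/2} S† ] ) ], where Dh(Z)[M] denotes the Fréchet derivative at Z of the spectral function X ↦ h(X) (defined via the continuous functional calculus) in direction M, and Ẑ† is the adjoint of Ẑ with respect to the Hilbert–Schmidt inner product ⟨M,N⟩ = Tr[MN] on Hermitian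 matrices. -/
open Matrix
open scoped ComplexOrder

attribute [local instance] Matrix.frobeniusNormedAddCommGroup Matrix.frobeniusNormedSpace

noncomputable section

theorem abs_rpow_sub_taylor_le {a x r : ℝ} (ha : 0 < a) (hx : 0 ≤ x) (hr : 0 < r) (hr1 : r ≤ 1) :
    |x ^ r - a ^ r - r * a ^ (r - 1) * (x - a)| ≤ a ^ r / a ^ 2 * (x - a) ^ 2 := by
  obtain ⟨y, rfl⟩ : ∃ y, x = a * y := ⟨x / a, by field_simp⟩
  have hy : 0 ≤ y := by
    by_contra h
    nlinarith [mul_pos ha (neg_pos.2 (not_le.1 h))]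
  have hup : y ^ r ≤ 1 + r * (y - 1) := by
    have := rpow_one_add_le_one_add_mul_self (s := y - 1) (by linarith) hr.le hr1
    simpa using this
  have hlow : 1 + r * (y - 1) - (y - 1) ^ 2 ≤ y ^ r := by
    rcases hy.eq_or_lt with rfl | hy0
    · rw [Real.zero_rpow hr.ne']
      linarith
    have h1 : y ^ (1 - r) ≤ 1 + (1 - r) * (y - 1) := by
      have := rpow_one_add_le_one_add_mul_self (s := y - 1) (p := 1 - r) (by linarith)
        (by linarith) (by linarith)
      simpa using this
    have h2 : y ^ r * y ^ (1 - r) = y := by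
      rw [← Real.rpow_add hy0]; simp
    have h3 : 0 < y ^ r := Real.rpow_pos_of_pos hy0 r
    have h4 : 0 < 1 + (1 - r) * (y - 1) := lt_of_lt_of_le (Real.rpow_pos_of_pos hy0 _) h1
    have h5 : y ≤ y ^ r * (1 + (1 - r) * (y - 1)) := by
      nlinarith [mul_le_mul_of_nonneg_left h1 h3.le]
    have h6 : (1 + r * (y - 1) - (y - 1) ^ 2) * (1 + (1 - r) * (y - 1)) ≤ y := by
      have h7 : y - (1 + r * (y - 1) - (y - 1) ^ 2) * (1 + (1 - r) * (y - 1))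
          = (y - 1) ^ 2 * ((1 - r) * y + r * (1 - (1 - r))) := by ring
      have : 0 ≤ (y - 1) ^ 2 * ((1 - r) * y + r * (1 - (1 - r))) := by
        have : 0 ≤ 1 - r := by linarith
        have : 0 ≤ 1 - (1 - r) := by linarith
        positivity
      linarith
    exact le_of_mul_le_mul_right (h6.trans h5) h4
  have hpow : a ^ (r - 1) = a ^ r / a := by rw [Real.rpow_sub_one ha.ne']
  have hap : 0 < a ^ r := Real.rpow_pos_of_pos ha r
  rw [Real.mul_rpow ha.le hy, hpow]
  have e1 : a ^ r * y ^ r - a ^ r - r * (a ^ r / a) * (a * y - a)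
      = a ^ r * (y ^ r - 1 - r * (y - 1)) := by field_simp
  have e2 : a ^ r / a ^ 2 * (a * y - a) ^ 2 = a ^ r * (y - 1) ^ 2 := by field_simp
  rw [e1, e2, abs_mul, abs_of_pos hap]
  refine mul_le_mul_of_nonneg_left ?_ hap.le
  rw [abs_le]
  constructor <;> nlinarith [sq_nonneg (y - 1)]

section Calculus

variable {ι : Type*} [Fintype ι]

theorem LinearMap.hasDerivAt_comp {κ ν E : Type*} [Fintype κ] [Fintype ν] [NormedAddCommGroup E]
    [NormedSpace ℝ E] (ℓ : Matrix κ ν ℂ →ₗ[ℝ] E) {B : ℝ → Matrix κ ν ℂ} {M : Matrix κ ν ℂ} {x : ℝ}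
    (hB : HasDerivAt B M x) : HasDerivAt (fun t => ℓ (B t)) (ℓ M) x :=
  (LinearMap.toContinuousLinearMap ℓ).hasFDerivAt.comp_hasDerivAt x hB

theorem Matrix.hasDerivAt_mulVec_apply {B : ℝ → Matrix ι ι ℂ} {M : Matrix ι ι ℂ} {x : ℝ}
    (hB : HasDerivAt B M x) (u : ι → ℂ) (i : ι) :
    HasDerivAt (fun t => (B t *ᵥ u) i) ((M *ᵥ u) i) x :=
  LinearMap.hasDerivAt_comp
    { toFun := fun X : Matrix ι ι ℂ => (X *ᵥ u) i
      map_add' := fun X Y => by simp [add_mulVec]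
      map_smul' := fun c X => by simp [smul_mulVec] } hB

theorem Matrix.hasDerivAt_re_dotProduct_mulVec {B : ℝ → Matrix ι ι ℂ} {M : Matrix ι ι ℂ} {x : ℝ}
    (hB : HasDerivAt B M x) (u : ι → ℂ) :
    HasDerivAt (fun t => (star u ⬝ᵥ (B t *ᵥ u)).re) (star u ⬝ᵥ (M *ᵥ u)).re x :=
  LinearMap.hasDerivAt_comp
    { toFun := fun X : Matrix ι ι ℂ => (star u ⬝ᵥ (X *ᵥ u)).re
      map_add' := fun X Y => by simp [add_mulVec]
      map_smul' := fun c X => by simp [smul_mulVec] } hB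

theorem Matrix.star_mulVec_dotProduct_mulVec (U X : Matrix ι ι ℂ) (c : ι → ℂ) :
    star (U *ᵥ c) ⬝ᵥ (X *ᵥ (U *ᵥ c)) = star c ⬝ᵥ ((Uᴴ * X * U) *ᵥ c) := by
  rw [star_mulVec, ← dotProduct_mulVec, mulVec_mulVec, mulVec_mulVec, Matrix.mul_assoc]

theorem Matrix.hasDerivAt_mul_apply {X Y : ℝ → Matrix ι ι ℂ} {X' Y' : Matrix ι ι ℂ} {x : ℝ}
    (hX : HasDerivAt X X' x) (hY : HasDerivAt Y Y' x) (i j : ι) :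
    HasDerivAt (fun t => (X t * Y t) i j) ((X' * Y x + X x * Y') i j) x := by
  have h : ∀ {W : ℝ → Matrix ι ι ℂ} {W' : Matrix ι ι ℂ}, HasDerivAt W W' x → ∀ a b : ι,
      HasDerivAt (fun t => W t a b) (W' a b) x := fun hW a b =>
    LinearMap.hasDerivAt_comp (Matrix.entryLinearMap ℝ ℂ a b) hW
  simp only [add_apply, mul_apply, ← Finset.sum_add_distrib]
  exact HasDerivAt.fun_sum fun k _ => (h hX i k).mul (h hY k j)

theorem Matrix.IsHermitian.of_hasDerivAt {B : ℝ → Matrix ι ι ℂ} {D : Matrix ι ι ℂ} {x : ℝ}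
    (hB : HasDerivAt B D x) (h : ∀ t, (B t).IsHermitian) : D.IsHermitian := by
  have h1 := LinearMap.hasDerivAt_comp (conjTransposeLinearEquiv ι ι ℝ ℂ).toLinearMap hB
  have h2 : (fun t => (conjTransposeLinearEquiv ι ι ℝ ℂ).toLinearMap (B t)) = B :=
    funext fun t => h t
  rw [h2] at h1
  exact h1.unique hB

variable [DecidableEq ι]

open scoped MatrixOrder in
theorem Matrix.PosDef.eventually_add_smul_posSemidef {A M : Matrix ι ι ℂ} (hA : A.PosDef)
    (hM : M.IsHermitian) : ∀ᶠ t : ℝ in nhds 0, (A + t • M).PosSemidef := by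
  obtain ⟨ε, hε, hεA⟩ : ∃ ε : ℝ, 0 < ε ∧ algebraMap ℝ (Matrix ι ι ℂ) ε ≤ A := by
    obtain h | h := isEmpty_or_nonempty ι
    · exact ⟨1, one_pos, (Subsingleton.elim _ _).le⟩
    · obtain ⟨i, hi⟩ := Finite.exists_min hA.1.eigenvalues
      refine ⟨_, hA.eigenvalues_pos i, ?_⟩
      rw [algebraMap_le_iff_le_spectrum (ha := hA.1.isSelfAdjoint)]
      intro x hx
      rw [hA.1.spectrum_real_eq_range_eigenvalues] at hx
      obtain ⟨j, rfl⟩ := hx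
      exact hi j
  obtain ⟨c, hc, hcM⟩ : ∃ c : ℝ, 0 < c ∧ ∀ s : ℝ, |s| ≤ 1 →
      algebraMap ℝ (Matrix ι ι ℂ) (-c) ≤ s • M := by
    refine ⟨1 + ∑ i, |hM.eigenvalues i|, by positivity, fun s hs => ?_⟩
    have : s • M = cfc (fun x : ℝ => s * x) M := by
      rw [cfc_const_mul_id s M (ha := hM.isSelfAdjoint)]
    rw [this]
    rw [algebraMap_le_cfc_iff (fun x : ℝ => s * x) (-_) M (by fun_prop) hM.isSelfAdjoint]
    intro x hx
    rw [hM.spectrum_real_eq_range_eigenvalues] at hx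
    obtain ⟨j, rfl⟩ := hx
    have h1 := Finset.single_le_sum (f := fun i => |hM.eigenvalues i|)
      (fun i _ => abs_nonneg _) (Finset.mem_univ j)
    have h2 : |s * hM.eigenvalues j| ≤ |hM.eigenvalues j| := by
      rw [abs_mul]; exact mul_le_of_le_one_left (abs_nonneg _) hs
    have := neg_abs_le (s * hM.eigenvalues j)
    linarith
  have hev : ∀ᶠ t : ℝ in nhds 0, |t| * (c / ε) < 1 := by
    have : Filter.Tendsto (fun t : ℝ => |t| * (c / ε)) (nhds 0) (nhds 0) := by
      have h : Continuous fun t : ℝ => |t| * (c / ε) := by fun_prop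
      simpa using h.tendsto 0
    exact this.eventually_lt_const one_pos
  filter_upwards [hev] with t ht
  rw [← Matrix.nonneg_iff_posSemidef]
  have h1 := hcM (t * (c / ε)) (by
    rw [abs_mul, abs_of_pos (div_pos hc hε)]; exact ht.le)
  have h2 : algebraMap ℝ (Matrix ι ι ℂ) (-ε) ≤ t • M := by
    have h3 := smul_le_smul_of_nonneg_left h1 (a := ε / c) (by positivity)
    rw [smul_smul] at h3
    have e1 : ε / c * (t * (c / ε)) = t := by field_simp
    rw [e1, Algebra.algebraMap_eq_smul_one, smul_smul] at h3
    have e2 : ε / c * -c = -ε := by field_simp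
    rwa [e2, ← Algebra.algebraMap_eq_smul_one] at h3
  have := add_le_add hεA h2
  rwa [← map_add, add_neg_cancel, map_zero] at this

theorem Matrix.IsHermitian.re_dotProduct_cfc_mulVec {B : Matrix ι ι ℂ} (hB : B.IsHermitian)
    (f : ℝ → ℝ) (u : ι → ℂ) :
    (star u ⬝ᵥ (cfc f B *ᵥ u)).re = ∑ j, f (hB.eigenvalues j) *
      Complex.normSq (((hB.eigenvectorUnitary : Matrix ι ι ℂ)ᴴ *ᵥ u) j) := by
  have : star u ⬝ᵥ (cfc f B *ᵥ u) = star ((hB.eigenvectorUnitary : Matrix ι ι ℂ)ᴴ *ᵥ u) ⬝ᵥ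
      (diagonal (fun j => (f (hB.eigenvalues j) : ℂ)) *ᵥ
        ((hB.eigenvectorUnitary : Matrix ι ι ℂ)ᴴ *ᵥ u)) := by
    rw [hB.cfc_eq, Matrix.IsHermitian.cfc, Unitary.conjStarAlgAut_apply, star_mulVec,
      conjTranspose_conjTranspose, ← dotProduct_mulVec, mulVec_mulVec, mulVec_mulVec,
      star_eq_conjTranspose]
    rfl
  rw [this]
  simp only [dotProduct, mulVec_diagonal, Complex.re_sum]
  refine Finset.sum_congr rfl fun j _ => ?_
  simp [Complex.normSq_apply]
  ring

theorem Matrix.IsHermitian.abs_re_dotProduct_cfc_sub_le {A B : Matrix ι ι ℂ}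
    (hB : B.IsHermitian) {f : ℝ → ℝ} {a d C : ℝ}
    (hf : ∀ x ∈ spectrum ℝ B, |f x - f a - d * (x - a)| ≤ C * (x - a) ^ 2) {u : ι → ℂ}
    (hu : A *ᵥ u = (a : ℂ) • u) :
    |(star u ⬝ᵥ (cfc f B *ᵥ u)).re - f a * (star u ⬝ᵥ u).re
        - d * (star u ⬝ᵥ ((B - A) *ᵥ u)).re|
      ≤ C * (star ((B - A) *ᵥ u) ⬝ᵥ ((B - A) *ᵥ u)).re := by
  have hsa : IsSelfAdjoint B := hB
  have hlin : cfc (fun x : ℝ => x - a) B = B - (a : ℂ) • 1 := by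
    rw [cfc_sub (fun x : ℝ => x) (fun _ => a) B, cfc_id' ℝ B, cfc_const a B,
      Algebra.algebraMap_eq_smul_one]
    simp
  have hBA : (B - A) *ᵥ u = (B - (a : ℂ) • (1 : Matrix ι ι ℂ)) *ᵥ u := by
    simp [sub_mulVec, hu, smul_mulVec]
  have hherm : (B - (a : ℂ) • (1 : Matrix ι ι ℂ))ᴴ = B - (a : ℂ) • 1 := by
    simp [hB.eq]
  have h0 : (star u ⬝ᵥ u).re = (star u ⬝ᵥ (cfc (fun _ : ℝ => (1 : ℝ)) B *ᵥ u)).re := by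
    rw [cfc_const (1 : ℝ) B]; simp
  have h2 : star ((B - A) *ᵥ u) ⬝ᵥ ((B - A) *ᵥ u)
      = star u ⬝ᵥ (cfc (fun x : ℝ => (x - a) ^ 2) B *ᵥ u) := by
    rw [cfc_pow (fun x : ℝ => x - a) 2 B, hlin, hBA, star_mulVec, hherm, ← dotProduct_mulVec,
      mulVec_mulVec, pow_two]
  rw [h2, h0, hBA, ← hlin]
  simp only [hB.re_dotProduct_cfc_mulVec, Finset.mul_sum, ← Finset.sum_sub_distrib]
  refine (Finset.abs_sum_le_sum_abs _ _).trans (Finset.sum_le_sum fun j _ => ?_)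
  have := hf _ (hB.eigenvalues_mem_spectrum_real j)
  set w := Complex.normSq (((hB.eigenvectorUnitary : Matrix ι ι ℂ)ᴴ *ᵥ u) j) with hw
  have hw0 : 0 ≤ w := Complex.normSq_nonneg _
  calc _ = |f (hB.eigenvalues j) - f a - d * (hB.eigenvalues j - a)| * w := by
        rw [← abs_of_nonneg hw0, ← abs_mul, abs_of_nonneg hw0]; congr 1; ring
    _ ≤ C * (hB.eigenvalues j - a) ^ 2 * w := mul_le_mul_of_nonneg_right this hw0
    _ = _ := by ring

theorem hasDerivAt_zero_of_abs_le {e φ : ℝ → ℝ} {x : ℝ} (hφ : HasDerivAt φ 0 x) (hx : φ x = 0)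
    (h : ∀ᶠ t in nhds x, |e t| ≤ φ t) : HasDerivAt e 0 x := by
  have hex : e x = 0 := by
    have := h.self_of_nhds
    rw [hx] at this
    exact abs_eq_zero.1 (le_antisymm this (abs_nonneg _))
  rw [hasDerivAt_iff_isLittleO] at hφ ⊢
  refine Asymptotics.IsBigO.trans_isLittleO ?_ hφ
  refine Asymptotics.IsBigO.of_bound 1 ?_
  filter_upwards [h] with t ht
  simpa [hex, hx] using ht.trans (le_abs_self _)

theorem Matrix.hasDerivAt_re_dotProduct_rpow_mulVec {B : ℝ → Matrix ι ι ℂ} {M : Matrix ι ι ℂ}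
    (hB : HasDerivAt B M 0) (hpos : ∀ᶠ t in nhds 0, (B t).PosSemidef) {a r : ℝ} (ha : 0 < a)
    (hr : 0 < r) (hr1 : r ≤ 1) {u : ι → ℂ} (hu : B 0 *ᵥ u = (a : ℂ) • u) :
    HasDerivAt (fun t => (star u ⬝ᵥ (cfc (fun x : ℝ => x ^ r) (B t) *ᵥ u)).re)
      (r * a ^ (r - 1) * (star u ⬝ᵥ (M *ᵥ u)).re) 0 := by
  have hBsub : HasDerivAt (fun t => B t - B 0) M 0 := hB.sub_const _
  have hφ : HasDerivAt (fun t => a ^ r / a ^ 2 *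
      (star ((B t - B 0) *ᵥ u) ⬝ᵥ ((B t - B 0) *ᵥ u)).re) 0 0 := by
    have hsum : HasDerivAt (fun t => ∑ i, ((((B t - B 0) *ᵥ u) i).re ^ 2
        + (((B t - B 0) *ᵥ u) i).im ^ 2)) 0 0 := by
      have : ∀ i ∈ (Finset.univ : Finset ι), HasDerivAt (fun t => (((B t - B 0) *ᵥ u) i).re ^ 2
        + (((B t - B 0) *ᵥ u) i).im ^ 2) 0 0 := fun i _ => by
        have h := hasDerivAt_mulVec_apply hBsub u i
        have hre : HasDerivAt (fun t => (((B t - B 0) *ᵥ u) i).re) ((M *ᵥ u) i).re 0 :=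
          Complex.reCLM.hasFDerivAt.comp_hasDerivAt (0 : ℝ) h
        have him : HasDerivAt (fun t => (((B t - B 0) *ᵥ u) i).im) ((M *ᵥ u) i).im 0 :=
          Complex.imCLM.hasFDerivAt.comp_hasDerivAt (0 : ℝ) h
        simpa using (hre.fun_pow 2).fun_add (him.fun_pow 2)
      simpa using HasDerivAt.fun_sum this
    have := hsum.const_mul (a ^ r / a ^ 2)
    rw [mul_zero] at this
    refine this.congr_of_eventuallyEq (Filter.Eventually.of_forall fun t => ?_)
    simp only [dotProduct, Complex.re_sum]
    congr 1
    refine Finset.sum_congr rfl fun i _ => ?_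
    simp
    ring
  have he := hasDerivAt_zero_of_abs_le
    (e := fun t => (star u ⬝ᵥ (cfc (fun x : ℝ => x ^ r) (B t) *ᵥ u)).re
      - a ^ r * (star u ⬝ᵥ u).re - r * a ^ (r - 1) * (star u ⬝ᵥ ((B t - B 0) *ᵥ u)).re)
    hφ (by simp) (by
      filter_upwards [hpos] with t ht
      refine ht.1.abs_re_dotProduct_cfc_sub_le (f := fun x => x ^ r) (fun x hx => ?_) hu
      refine abs_rpow_sub_taylor_le ha ?_ hr hr1
      rw [ht.1.spectrum_real_eq_range_eigenvalues] at hx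
      obtain ⟨j, rfl⟩ := hx
      exact ht.eigenvalues_nonneg j)
  have hlin := ((hasDerivAt_re_dotProduct_mulVec hBsub u).const_mul (r * a ^ (r - 1))).add_const
    (a ^ r * (star u ⬝ᵥ u).re)
  have := he.add hlin
  rw [zero_add] at this
  refine this.congr_of_eventuallyEq (Filter.Eventually.of_forall fun t => ?_)
  simp only [Pi.add_apply]
  ring

namespace Matrix.IsHermitian

variable {A : Matrix ι ι ℂ} (hA : A.IsHermitian)

/-- The matrix of `X` in the orthonormal eigenbasis of the Hermitian matrix `A`. -/
def conjEigen (X : Matrix ι ι ℂ) : Matrix ι ι ℂ :=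
  (hA.eigenvectorUnitary : Matrix ι ι ℂ)ᴴ * X * (hA.eigenvectorUnitary : Matrix ι ι ℂ)

theorem eigenvectorUnitary_mul_conjTranspose :
    (hA.eigenvectorUnitary : Matrix ι ι ℂ) * (hA.eigenvectorUnitary : Matrix ι ι ℂ)ᴴ = 1 :=
  Unitary.mul_star_self_of_mem hA.eigenvectorUnitary.2

theorem conjTranspose_mul_eigenvectorUnitary :
    (hA.eigenvectorUnitary : Matrix ι ι ℂ)ᴴ * (hA.eigenvectorUnitary : Matrix ι ι ℂ) = 1 :=
  Unitary.star_mul_self_of_mem hA.eigenvectorUnitary.2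

theorem isUnit_eigenvectorUnitary : IsUnit (hA.eigenvectorUnitary : Matrix ι ι ℂ) :=
  ⟨⟨_, _, hA.eigenvectorUnitary_mul_conjTranspose, hA.conjTranspose_mul_eigenvectorUnitary⟩, rfl⟩

theorem conjEigen_mul (X Y : Matrix ι ι ℂ) :
    hA.conjEigen (X * Y) = hA.conjEigen X * hA.conjEigen Y := by
  simp only [conjEigen, Matrix.mul_assoc]
  rw [← Matrix.mul_assoc (hA.eigenvectorUnitary : Matrix ι ι ℂ) _ (Y * _),
    hA.eigenvectorUnitary_mul_conjTranspose, Matrix.one_mul]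

theorem trace_conjEigen (X : Matrix ι ι ℂ) : (hA.conjEigen X).trace = X.trace := by
  rw [conjEigen, trace_mul_comm, ← Matrix.mul_assoc, hA.eigenvectorUnitary_mul_conjTranspose,
    Matrix.one_mul]

theorem isHermitian_conjEigen {X : Matrix ι ι ℂ} (hX : X.IsHermitian) :
    (hA.conjEigen X).IsHermitian :=
  isHermitian_conjTranspose_mul_mul _ hX

theorem conjEigen_cfc (f : ℝ → ℝ) :
    hA.conjEigen (cfc f A) = diagonal fun i => (f (hA.eigenvalues i) : ℂ) := by
  rw [hA.cfc_eq, Matrix.IsHermitian.cfc, Unitary.conjStarAlgAut_apply, star_eq_conjTranspose,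
    conjEigen]
  simp only [Matrix.mul_assoc]
  rw [hA.conjTranspose_mul_eigenvectorUnitary, ← Matrix.mul_assoc,
    hA.conjTranspose_mul_eigenvectorUnitary, Matrix.one_mul, Matrix.mul_one]
  rfl

theorem conjEigen_self : hA.conjEigen A = diagonal fun i => (hA.eigenvalues i : ℂ) := by
  have h := hA.conjEigen_cfc fun x => x
  rwa [cfc_id' ℝ A hA.isSelfAdjoint] at h

theorem mulVec_eigenvectorUnitary_mulVec {c : ι → ℂ} {a : ℝ}
    (hc : ∀ i, c i ≠ 0 → hA.eigenvalues i = a) :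
    A *ᵥ ((hA.eigenvectorUnitary : Matrix ι ι ℂ) *ᵥ c)
      = (a : ℂ) • ((hA.eigenvectorUnitary : Matrix ι ι ℂ) *ᵥ c) := by
  have h : (hA.eigenvectorUnitary : Matrix ι ι ℂ) * hA.conjEigen A
      = A * (hA.eigenvectorUnitary : Matrix ι ι ℂ) := by
    simp only [conjEigen, ← Matrix.mul_assoc]
    rw [hA.eigenvectorUnitary_mul_conjTranspose, Matrix.one_mul]
  rw [mulVec_mulVec, ← h, hA.conjEigen_self, ← mulVec_mulVec, ← mulVec_smul]
  congr 1
  ext i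
  rw [mulVec_diagonal]
  by_cases hi : c i = 0
  · simp [hi]
  · simp [hc i hi]

end Matrix.IsHermitian

open Matrix.IsHermitian

theorem Matrix.hasDerivAt_re_conjEigen_rpow {B : ℝ → Matrix ι ι ℂ} {M : Matrix ι ι ℂ}
    (hB : HasDerivAt B M 0) (hpos : ∀ᶠ t in nhds 0, (B t).PosSemidef) (h0 : (B 0).PosDef)
    {r : ℝ} (hr : 0 < r) (hr1 : r ≤ 1) {a : ℝ} (ha : 0 < a) {c : ι → ℂ}
    (hc : ∀ i, c i ≠ 0 → h0.1.eigenvalues i = a) :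
    HasDerivAt (fun t => (star c ⬝ᵥ
        (h0.1.conjEigen (cfc (fun x : ℝ => x ^ r) (B t)) *ᵥ c)).re)
      (r * a ^ (r - 1) * (star c ⬝ᵥ (h0.1.conjEigen M *ᵥ c)).re) 0 := by
  have := hasDerivAt_re_dotProduct_rpow_mulVec hB hpos ha hr hr1
    (h0.1.mulVec_eigenvectorUnitary_mulVec hc)
  simpa only [star_mulVec_dotProduct_mulVec, conjEigen] using this

/-- First-order perturbation of the trace function `B ↦ Tr (B ^ r)`, `0 < r ≤ 1`. -/
theorem Matrix.hasDerivAt_re_trace_rpow {B : ℝ → Matrix ι ι ℂ} {M : Matrix ι ι ℂ}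
    (hB : HasDerivAt B M 0) (hpos : ∀ᶠ t in nhds 0, (B t).PosSemidef) (h0 : (B 0).PosDef)
    {r : ℝ} (hr : 0 < r) (hr1 : r ≤ 1) :
    HasDerivAt (fun t => (cfc (fun x : ℝ => x ^ r) (B t)).trace.re)
      (cfc (fun x : ℝ => r * x ^ (r - 1)) (B 0) * M).trace.re 0 := by
  have hterm : ∀ i ∈ (Finset.univ : Finset ι),
      HasDerivAt (fun t => (h0.1.conjEigen (cfc (fun x : ℝ => x ^ r) (B t)) i i).re)
        (r * h0.1.eigenvalues i ^ (r - 1) * (h0.1.conjEigen M i i).re) 0 := fun i _ => by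
    have := hasDerivAt_re_conjEigen_rpow hB hpos h0 hr hr1 (h0.eigenvalues_pos i)
      (c := Pi.single i 1) fun j hj => by
        rcases eq_or_ne j i with rfl | h
        · rfl
        · simp [h] at hj
    simpa using this
  have htr : ∀ X : Matrix ι ι ℂ, X.trace.re = ∑ i, (h0.1.conjEigen X i i).re := fun X => by
    rw [← h0.1.trace_conjEigen, trace, Complex.re_sum]; rfl
  have hval : (cfc (fun x : ℝ => r * x ^ (r - 1)) (B 0) * M).trace.re
      = ∑ i, r * h0.1.eigenvalues i ^ (r - 1) * (h0.1.conjEigen M i i).re := by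
    rw [htr]
    refine Finset.sum_congr rfl fun i _ => ?_
    rw [conjEigen_mul, conjEigen_cfc, diagonal_mul, Complex.re_ofReal_mul]
  simp only [hval, htr]
  exact HasDerivAt.fun_sum hterm

/-- Entries of the derivative of `t ↦ (B t) ^ r` in an eigenbasis of `B 0`, inside an
eigenspace of `B 0`. -/
theorem Matrix.conjEigen_deriv_rpow_of_eq {B : ℝ → Matrix ι ι ℂ} {M D : Matrix ι ι ℂ}
    (hB : HasDerivAt B M 0) (hpos : ∀ᶠ t in nhds 0, (B t).PosSemidef) (h0 : (B 0).PosDef)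
    (hM : M.IsHermitian) (hD : D.IsHermitian) {r : ℝ} (hr : 0 < r) (hr1 : r ≤ 1)
    (hBr : HasDerivAt (fun t => cfc (fun x : ℝ => x ^ r) (B t)) D 0) {i j : ι}
    (hij : h0.1.eigenvalues i = h0.1.eigenvalues j) :
    h0.1.conjEigen D i j = r * (h0.1.eigenvalues i ^ (r - 1) : ℝ) * h0.1.conjEigen M i j := by
  set a := h0.1.eigenvalues i with ha
  have key : ∀ c : ι → ℂ, (∀ l, c l ≠ 0 → h0.1.eigenvalues l = a) →
      (star c ⬝ᵥ (h0.1.conjEigen D *ᵥ c)).re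
        = r * a ^ (r - 1) * (star c ⬝ᵥ (h0.1.conjEigen M *ᵥ c)).re := fun c hc => by
    have h1 := hasDerivAt_re_conjEigen_rpow hB hpos h0 hr hr1 (h0.eigenvalues_pos i) hc
    have h2 := hasDerivAt_re_dotProduct_mulVec hBr
      ((h0.1.eigenvectorUnitary : Matrix ι ι ℂ) *ᵥ c)
    simp only [star_mulVec_dotProduct_mulVec] at h2
    exact h2.unique h1
  set T : Matrix ι ι ℂ := h0.1.conjEigen D - ((r * a ^ (r - 1) : ℝ) : ℂ) • h0.1.conjEigen M with hT
  have hTherm : T.IsHermitian := by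
    refine (h0.1.isHermitian_conjEigen hD).sub ?_
    rw [IsHermitian, conjTranspose_smul, (h0.1.isHermitian_conjEigen hM).eq]
    simp
  have keyT : ∀ c : ι → ℂ, (∀ l, c l ≠ 0 → h0.1.eigenvalues l = a) →
      (star c ⬝ᵥ (T *ᵥ c)).re = 0 := fun c hc => by
    rw [hT, sub_mulVec, smul_mulVec, dotProduct_sub, dotProduct_smul, Complex.sub_re, key c hc,
      smul_eq_mul, Complex.re_ofReal_mul, sub_self]
  have hsupp : ∀ z w : ℂ, ∀ l, (Pi.single i z + Pi.single j w : ι → ℂ) l ≠ 0 →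
      h0.1.eigenvalues l = a := fun z w l hl => by
    rcases eq_or_ne l i with rfl | h
    · rfl
    rcases eq_or_ne l j with rfl | h'
    · exact hij.symm
    · simp [h, h'] at hl
  have hform : ∀ z w : ℂ, star (Pi.single i z + Pi.single j w : ι → ℂ) ⬝ᵥ
      (T *ᵥ (Pi.single i z + Pi.single j w : ι → ℂ)) =
      star z * T i i * z + star z * T i j * w + star w * T j i * z + star w * T j j * w :=
    fun z w => by
      simp only [star_add, Pi.star_single, mulVec_add, dotProduct_add, add_dotProduct,
        mulVec_single, single_dotProduct, Pi.smul_apply, Matrix.col_apply,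
        MulOpposite.smul_eq_mul_unop, MulOpposite.unop_op]
      ring
  have e1 := keyT _ (hsupp 1 0)
  have e2 := keyT _ (hsupp 0 1)
  have e3 := keyT _ (hsupp 1 1)
  have e4 := keyT _ (hsupp 1 Complex.I)
  rw [hform] at e1 e2 e3 e4
  have hji : T j i = star (T i j) := (hTherm.apply j i).symm
  rw [hji] at e1 e2 e3 e4
  simp at e1 e2 e3 e4
  have hT0 : T i j = 0 := by
    apply Complex.ext <;> simp <;> linarith
  rw [hT, sub_apply, smul_apply, sub_eq_zero] at hT0
  rw [hT0]
  simp

/-- The first divided difference of `x ↦ x ^ r`. -/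
def rpowDivDiff (r a b : ℝ) : ℝ :=
  if a = b then r * a ^ (r - 1) else (a ^ r - b ^ r) / (a - b)

theorem rpowDivDiff_comm (r a b : ℝ) : rpowDivDiff r a b = rpowDivDiff r b a := by
  unfold rpowDivDiff
  rcases eq_or_ne a b with rfl | h
  · rfl
  · rw [if_neg h, if_neg h.symm, ← neg_sub b a, ← neg_sub (b ^ r), neg_div_neg_eq]

theorem Matrix.isHermitian_cfc (f : ℝ → ℝ) (A : Matrix ι ι ℂ) : (cfc f A).IsHermitian :=
  cfc_predicate f A

/-- The Daleckii–Krein formula for the derivative of `t ↦ (B t) ^ r` at `t = 0`. -/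
theorem Matrix.conjEigen_deriv_rpow {B : ℝ → Matrix ι ι ℂ} {A M D : Matrix ι ι ℂ}
    (hB : HasDerivAt B M 0) (hpos : ∀ᶠ t in nhds 0, (B t).PosSemidef) (hA : A.PosDef)
    (hBA : B 0 = A) (hM : M.IsHermitian) {r : ℝ} (hr : 0 < r) (hr1 : r ≤ 1)
    (hBr : HasDerivAt (fun t => cfc (fun x : ℝ => x ^ r) (B t)) D 0) (i j : ι) :
    hA.1.conjEigen D i j = rpowDivDiff r (hA.1.eigenvalues i) (hA.1.eigenvalues j) *
      hA.1.conjEigen M i j := by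
  subst hBA
  unfold rpowDivDiff
  split_ifs with hij
  · rw [conjEigen_deriv_rpow_of_eq hB hpos hA hM
      (.of_hasDerivAt hBr fun t => isHermitian_cfc _ _) hr hr1 hBr hij]
    push_cast
    rfl
  have hcomm : M * cfc (fun x : ℝ => x ^ r) (B 0) + B 0 * D
      = D * B 0 + cfc (fun x : ℝ => x ^ r) (B 0) * M := by
    ext a b
    refine (hasDerivAt_mul_apply hB hBr a b).unique
      ((hasDerivAt_mul_apply hBr hB a b).congr_of_eventuallyEq ?_)
    filter_upwards [hpos] with t ht
    have := cfc_commute_cfc (fun x : ℝ => x) (fun x : ℝ => x ^ r) (B t)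
    rw [cfc_id' ℝ (B t) ht.1.isSelfAdjoint] at this
    rw [this.eq]
  have h := congrArg hA.1.conjEigen hcomm
  have hadd : ∀ X Y : Matrix ι ι ℂ,
      hA.1.conjEigen (X + Y) = hA.1.conjEigen X + hA.1.conjEigen Y := fun X Y => by
    simp [conjEigen, Matrix.mul_add, Matrix.add_mul]
  simp only [hadd, conjEigen_mul, conjEigen_cfc, conjEigen_self] at h
  have hent := congrFun (congrFun h i) j
  simp only [add_apply, mul_diagonal, diagonal_mul] at hent
  have hne : (hA.1.eigenvalues i : ℂ) - hA.1.eigenvalues j ≠ 0 :=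
    sub_ne_zero.2 fun h => hij (Complex.ofReal_injective h)
  push_cast
  rw [div_mul_eq_mul_div, eq_div_iff hne]
  linear_combination hent

/-- The derivative of `X ↦ X ^ r` at a positive definite matrix is symmetric for the
Hilbert–Schmidt pairing. -/
theorem Matrix.PosDef.trace_mul_deriv_rpow_comm {A X Y DX DY : Matrix ι ι ℂ} (hA : A.PosDef)
    (hX : X.IsHermitian) (hY : Y.IsHermitian) {r : ℝ} (hr : 0 < r) (hr1 : r ≤ 1)
    (hDX : HasDerivAt (fun t : ℝ => cfc (fun x : ℝ => x ^ r) (A + t • X)) DX 0)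
    (hDY : HasDerivAt (fun t : ℝ => cfc (fun x : ℝ => x ^ r) (A + t • Y)) DY 0) :
    (X * DY).trace = (DX * Y).trace := by
  have hline : ∀ W : Matrix ι ι ℂ, HasDerivAt (fun t : ℝ => A + t • W) W 0 := fun W => by
    have := ((hasDerivAt_id (0 : ℝ)).smul_const W).const_add A
    rwa [one_smul] at this
  have eX := conjEigen_deriv_rpow (hline X) (hA.eventually_add_smul_posSemidef hX) hA (by simp)
    hX hr hr1 hDX
  have eY := conjEigen_deriv_rpow (hline Y) (hA.eventually_add_smul_posSemidef hY) hA (by simp)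
    hY hr hr1 hDY
  rw [← hA.1.trace_conjEigen, ← hA.1.trace_conjEigen (DX * Y), conjEigen_mul, conjEigen_mul]
  simp only [trace, diag_apply, mul_apply, eX, eY]
  refine Finset.sum_congr rfl fun i _ => Finset.sum_congr rfl fun j _ => ?_
  rw [rpowDivDiff_comm]
  ring

theorem Matrix.PosDef.cfc_rpow_s16 {A : Matrix ι ι ℂ} (hA : A.PosDef) (r : ℝ) :
    (cfc (fun x : ℝ => x ^ r) A).PosDef := by
  rw [← hA.1.isUnit_eigenvectorUnitary.posDef_star_left_conjugate_iff, star_eq_conjTranspose,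
    ← conjEigen, conjEigen_cfc, posDef_diagonal_iff]
  exact fun i => by exact_mod_cast Real.rpow_pos_of_pos (hA.eigenvalues_pos i) r

theorem Matrix.PosSemidef.cfc_rpow_s16 {A : Matrix ι ι ℂ} (hA : A.PosSemidef) (r : ℝ) :
    (cfc (fun x : ℝ => x ^ r) A).PosSemidef := by
  rw [← hA.1.isUnit_eigenvectorUnitary.posSemidef_star_left_conjugate_iff, star_eq_conjTranspose,
    ← conjEigen, conjEigen_cfc, posSemidef_diagonal_iff]
  exact fun i => by exact_mod_cast Real.rpow_nonneg (hA.eigenvalues_nonneg i) r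

end Calculus

/-- Gradient formula in `σ` for `Ψ̂_α(ρ, σ) = Tr[(Ĝ(ρ)^{1/2} Sᴴ Ẑ(σ)^{(1−α)/α} S Ĝ(ρ)^{1/2})^α]`:
for Hermitian directions `H`, the directional derivative at `σ` equals
`Tr[H · Ẑ†(Dh(Z)[S G^{1/2} g'(G^{1/2} Z_S G^{1/2}) G^{1/2} Sᴴ])]`, where `G = Ĝ(ρ)`,
`Z = Ẑ(σ)`, `h(x) = x^{(1−α)/α}`, `g'(x) = α x^{α−1}`, `Z_S = Sᴴ h(Z) S`, and `Dh(Z)[·]`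
is the Fréchet derivative of the spectral function `X ↦ h(X)` at `Z`. -/
theorem stmt16 {q k m n : ℕ}
    (Ghat : Matrix (Fin q) (Fin q) ℂ →ₗ[ℝ] Matrix (Fin k) (Fin k) ℂ)
    (Zhat : Matrix (Fin m) (Fin m) ℂ →ₗ[ℝ] Matrix (Fin n) (Fin n) ℂ)
    (hGherm : ∀ M : Matrix (Fin q) (Fin q) ℂ, M.IsHermitian → (Ghat M).IsHermitian)
    (hZherm : ∀ M : Matrix (Fin m) (Fin m) ℂ, M.IsHermitian → (Zhat M).IsHermitian)
    (hGpd : ∀ M : Matrix (Fin q) (Fin q) ℂ, M.PosDef → (Ghat M).PosDef)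
    (hZpd : ∀ M : Matrix (Fin m) (Fin m) ℂ, M.PosDef → (Zhat M).PosDef)
    (S : Matrix (Fin n) (Fin k) ℂ) (hS : Sᴴ * S = 1)
    (α : ℝ) (hα : α ∈ Set.Ico (1 / 2 : ℝ) 1)
    (ρ : Matrix (Fin q) (Fin q) ℂ) (hρ : ρ.PosDef)
    (σ : Matrix (Fin m) (Fin m) ℂ) (hσ : σ.PosDef)
    (Zadj : Matrix (Fin n) (Fin n) ℂ →ₗ[ℝ] Matrix (Fin m) (Fin m) ℂ)
    (hZadj : ∀ (M : Matrix (Fin m) (Fin m) ℂ) (N : Matrix (Fin n) (Fin n) ℂ),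
      M.IsHermitian → N.IsHermitian → (Zhat M * N).trace = (M * Zadj N).trace)
    (Dh : Matrix (Fin n) (Fin n) ℂ →ₗ[ℝ] Matrix (Fin n) (Fin n) ℂ)
    (hDh : ∀ M : Matrix (Fin n) (Fin n) ℂ, M.IsHermitian →
      HasDerivAt (fun t : ℝ => mpow (Zhat σ + t • M) ((1 - α) / α)) (Dh M) 0) :
    ∀ H : Matrix (Fin m) (Fin m) ℂ, H.IsHermitian →
      HasDerivAt
        (fun t : ℝ =>
          ((mpow (mpow (Ghat ρ) (1 / 2) * Sᴴ * mpow (Zhat (σ + t • H)) ((1 - α) / α) * S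
            * mpow (Ghat ρ) (1 / 2)) α).trace).re)
        ((H * Zadj (Dh
            (S * mpow (Ghat ρ) (1 / 2)
              * cfc (fun x : ℝ => α * x ^ (α - 1))
                  (mpow (Ghat ρ) (1 / 2) * (Sᴴ * mpow (Zhat σ) ((1 - α) / α) * S)
                    * mpow (Ghat ρ) (1 / 2))
              * mpow (Ghat ρ) (1 / 2) * Sᴴ)))).trace.re
        0 := by
  intro H hH
  have hα0 : 0 < α := by have := hα.1; linarith
  have hp : 0 < (1 - α) / α := div_pos (by linarith [hα.2]) hα0
  have hp1 : (1 - α) / α ≤ 1 := by rw [div_le_one hα0]; linarith [hα.1]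
  have hZ := hZpd σ hσ
  have hK := hZherm H hH
  have hZt : ∀ t : ℝ, Zhat (σ + t • H) = Zhat σ + t • Zhat H := fun t => by simp
  have hR : (mpow (Ghat ρ) (1 / 2)).PosDef := (hGpd ρ hρ).cfc_rpow_s16 _
  set R := mpow (Ghat ρ) (1 / 2) with hRdef
  set p := (1 - α) / α with hpdef
  set V := S * R with hV
  have hVH : Vᴴ = R * Sᴴ := by rw [hV, conjTranspose_mul, hR.1.eq]
  have hVinj : Function.Injective V.mulVec := by
    have hSinj : Function.Injective S.mulVec := fun x y hxy => by
      have := congrArg (Sᴴ *ᵥ ·) hxy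
      simpa [mulVec_mulVec, hS] using this
    have : V.mulVec = S.mulVec ∘ R.mulVec := by
      ext x
      simp [hV, mulVec_mulVec]
    rw [this]
    exact hSinj.comp (mulVec_injective_of_isUnit hR.isUnit)
  have hform : ∀ X : Matrix (Fin n) (Fin n) ℂ, R * Sᴴ * X * S * R = Vᴴ * X * V := fun X => by
    rw [hVH, hV]; simp only [Matrix.mul_assoc]
  have hB : HasDerivAt (fun t : ℝ => Vᴴ * mpow (Zhat σ + t • Zhat H) p * V)
      (Vᴴ * Dh (Zhat H) * V) 0 :=
    LinearMap.hasDerivAt_comp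
      { toFun := fun X : Matrix (Fin n) (Fin n) ℂ => Vᴴ * X * V
        map_add' := fun X Y => by simp [Matrix.mul_add, Matrix.add_mul]
        map_smul' := fun c X => by simp } (hDh _ hK)
  have hpos : ∀ᶠ t : ℝ in nhds 0, (Vᴴ * mpow (Zhat σ + t • Zhat H) p * V).PosSemidef := by
    filter_upwards [hZ.eventually_add_smul_posSemidef hK] with t ht
    exact (ht.cfc_rpow_s16 p).conjTranspose_mul_mul_same V
  have h0 : (Vᴴ * mpow (Zhat σ + (0 : ℝ) • Zhat H) p * V).PosDef := by
    rw [zero_smul, add_zero]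
    exact (hZ.cfc_rpow_s16 p).conjTranspose_mul_mul_same hVinj
  have hmain := hasDerivAt_re_trace_rpow hB hpos h0 hα0 hα.2.le
  have hB0 : R * (Sᴴ * mpow (Zhat σ) p * S) * R = Vᴴ * mpow (Zhat σ) p * V := by
    rw [← hform]; simp only [Matrix.mul_assoc]
  simp only [hZt, hform, hB0]
  simp only [zero_smul, add_zero] at hmain
  set g := cfc (fun x : ℝ => α * x ^ (α - 1)) (Vᴴ * mpow (Zhat σ) p * V) with hg
  have hN : V * g * R * Sᴴ = V * g * Vᴴ := by rw [hVH]; simp only [Matrix.mul_assoc]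
  rw [hN]
  have hNherm : (V * g * Vᴴ).IsHermitian :=
    isHermitian_mul_mul_conjTranspose V (isHermitian_cfc _ _)
  have hDN := hDh _ hNherm
  have hDNherm : (Dh (V * g * Vᴴ)).IsHermitian := .of_hasDerivAt hDN fun t => isHermitian_cfc _ _
  have hval : (g * (Vᴴ * Dh (Zhat H) * V)).trace = (H * Zadj (Dh (V * g * Vᴴ))).trace := by
    rw [← hZadj _ _ hH hDNherm, trace_mul_comm (Zhat H),
      ← hZ.trace_mul_deriv_rpow_comm hNherm hK hp hp1 hDN (hDh _ hK), ← Matrix.mul_assoc,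
      trace_mul_comm]
    simp only [Matrix.mul_assoc]
  rw [← hval]
  exact hmain

end
end
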